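/- Let k ≥ 1 and m ≥ 3 be integers, let λ_0, …, λ_k be integers with λ_j ≠ 0 for at least one index j, and let R be a union of primes in at least k·φ(m)/(k+1) residue classes in the reduced residue system modulo m. Assume RH and GRH_m. Let α_1, …, α_k be pairwise distinct non-zero integers, set R′ := R ∩ [2, k·(max{1865, m^{φ(m)}, max_{1≤j≤k}|α_j|} + 2)], and assume c_2(ᾱ;R′) < (k·e^{1+6.550·φ(m)}·m^{φ(m)})^{−k}. Write D := D(m,k,ᾱ;R′). Suppose H is a real number with max_{0≤i≤k}|λ_i| ≤ H and (log H)/D ≥ max{1866, m^{φ(m)}+1, max_{1≤j≤k}|α_j|+1, e^{2(2.539kφ(m)+5.724k+0.054)/D}+1}. Set R″ := R ∩ [2, 2k·log H/D + 2k). Then for some prime p ∈ R″ one has |λ_0 + λ_1·F_p(α_1) + … + λ_k·F_p(α_k)|_p > H^{−E}, where E := (2k·log log H)/D + (−2k·log D + 2k² + 3k·log 2 − 2k)/D + 4k(2.539kφ(m)+5.724k+0.054)/D² + 0.015k² + 0.235k + 1.034. -/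

import Mathlib

open scoped BigOperators
open Filter Real
open scoped Nat

noncomputable section

/-- The Riemann Hypothesis: every zero of the Riemann zeta function in the
critical strip lies on the critical line. -/
def RH : Prop :=
  ∀ s : ℂ, riemannZeta s = 0 → 0 < s.re → s.re < 1 → s.re = 1 / 2

/-- GRH for Dirichlet L-functions modulo `m` (equivalently, for the `m`-th
cyclotomic Dedekind zeta function). -/
def GRH (m : ℕ) : Prop :=
  ∀ (_ : NeZero m) (χ : DirichletCharacter ℂ m) (s : ℂ),
    DirichletCharacter.LFunction χ s = 0 → 0 < s.re → s.re < 1 → s.re = 1 / 2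

/-- Euler's factorial series `F_p(t) = ∑ n! tⁿ` in `ℚ_p`. -/
def eulerF (p : ℕ) [Fact p.Prime] (t : ℤ) : ℚ_[p] :=
  ∑' n : ℕ, (n ! : ℚ_[p]) * (t : ℚ_[p]) ^ n

/-- `max_{1≤j≤k} |α_j|` as a natural number. -/
def maxAbs {k : ℕ} (α : Fin k → ℤ) : ℕ :=
  Finset.univ.sup fun j => (α j).natAbs

/-- `max_{1≤j≤k} |α_j|_p`. -/
def padicMaxAbs (p : ℕ) {k : ℕ} (α : Fin k → ℤ) : ℝ :=
  ⨆ j, ((padicNorm p ((α j : ℚ))) : ℝ)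

/-- `c₁ = 2^k (max |α_j|)^k`. -/
def c1val (k : ℕ) (α : Fin k → ℤ) : ℝ := 2 ^ k * (maxAbs α : ℝ) ^ k

/-- `c₂(ᾱ; R) = c₁ ∏_{p ∈ R} (max_i |α_i|_p)^{k+1}`. -/
def c2val (k : ℕ) (α : Fin k → ℤ) (R : Set ℕ) : ℝ :=
  c1val k α * ∏' p : R, padicMaxAbs (p : ℕ) α ^ (k + 1)

/-- `D(m,k,ᾱ;R)`. -/
def Dval (m k : ℕ) (α : Fin k → ℤ) (R : Set ℕ) : ℝ :=
  -(Real.log (c2val k α R) + k * (Real.log k + (Real.log m + 6.550) * m.totient + 1))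

open Complex in
lemma integral_circleMap_pow_mul_eq_zero {f : ℂ → ℂ} {c : ℂ} {r : ℝ} (hr : 0 < r)
    (hf : DiffContOnCl ℂ f (Metric.ball c r)) (n : ℕ) :
    ∫ θ in (0:ℝ)..2 * π, circleMap 0 r θ ^ (n + 1) * f (circleMap c r θ) = 0 := by
  have h2 : DiffContOnCl ℂ (fun z => (z - c) ^ n * f z) (Metric.ball c r) :=
    DiffContOnCl.smul (f := f) (c := fun z => (z - c) ^ n)
      ((differentiable_id.sub_const c).pow n).diffContOnCl hf
  have h1 : ∮ z in C(c, r), (z - c) ^ n * f z = 0 :=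
    Complex.circleIntegral_eq_zero_of_differentiable_on_off_countable hr.le Set.countable_empty
      (h2.continuousOn_ball) (fun z hz => h2.differentiableAt Metric.isOpen_ball hz.1)
  rw [circleIntegral] at h1
  have h3 : ∀ θ : ℝ, deriv (circleMap c r) θ • ((circleMap c r θ - c) ^ n * f (circleMap c r θ))
      = I * (circleMap 0 r θ ^ (n + 1) * f (circleMap c r θ)) := by
    intro θ
    simp only [deriv_circleMap, circleMap_sub_center, smul_eq_mul]
    ring
  simp only [h3] at h1
  rw [intervalIntegral.integral_const_mul] at h1
  simpa using h1

open Complex in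
lemma integral_circleMap_inv_pow_mul {f : ℂ → ℂ} {c : ℂ} {r : ℝ} (hr : 0 < r)
    (hf : DiffContOnCl ℂ f (Metric.ball c r)) (n : ℕ) :
    ∫ θ in (0:ℝ)..2 * π, (circleMap 0 r θ ^ n)⁻¹ * f (circleMap c r θ)
      = 2 * π / n ! * iteratedDeriv n f c := by
  have h1 := DiffContOnCl.circleIntegral_one_div_sub_center_pow_smul hr n hf
  rw [circleIntegral] at h1
  have h3 : ∀ θ : ℝ, deriv (circleMap c r) θ • ((1 / (circleMap c r θ - c) ^ (n + 1)) •
      f (circleMap c r θ)) = I * ((circleMap 0 r θ ^ n)⁻¹ * f (circleMap c r θ)) := by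
    intro θ
    have : circleMap 0 r θ ≠ 0 := circleMap_ne_center hr.ne'
    simp only [deriv_circleMap, circleMap_sub_center, smul_eq_mul]
    field_simp
    ring
  simp only [h3] at h1
  rw [intervalIntegral.integral_const_mul] at h1
  have hI : (I : ℂ) ≠ 0 := I_ne_zero
  apply mul_left_cancel₀ hI
  rw [h1, smul_eq_mul]
  ring

open Complex in
/-- Borel–Carathéodory bound for the Taylor coefficients of a function with bounded real part. -/
lemma norm_iteratedDeriv_le_of_re_le_aux {f : ℂ → ℂ} {c : ℂ} {r A : ℝ} (hr : 0 < r)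
    (hf : DiffContOnCl ℂ f (Metric.ball c r)) (hfc : f c = 0)
    (hA : ∀ z ∈ Metric.sphere c r, (f z).re ≤ A) (n : ℕ) :
    ‖iteratedDeriv (n + 1) f c‖ ≤ (n + 1)! * (2 * A / r ^ (n + 1)) := by
  set w : ℝ → ℂ := circleMap 0 r with hw
  have hw0 : ∀ θ, w θ ≠ 0 := fun θ => circleMap_ne_center hr.ne'
  have hwn : ∀ θ, ‖w θ‖ = r := fun θ => by simp [hw, abs_of_pos hr]
  have hwcont : Continuous w := continuous_circleMap 0 r
  have hconj : ∀ θ, (starRingEnd ℂ) (w θ) = r ^ 2 * (w θ)⁻¹ := by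
    intro θ
    have := Complex.mul_conj (w θ)
    rw [Complex.normSq_eq_norm_sq, hwn] at this
    field_simp [hw0 θ]
    rw [mul_comm, this]; push_cast; ring
  have hmem : ∀ θ, circleMap c r θ ∈ Metric.sphere c r := fun θ => circleMap_mem_sphere c hr.le θ
  have hfcont : Continuous fun θ => f (circleMap c r θ) := by
    rw [← continuousOn_univ]
    exact hf.continuousOn_ball.comp (continuous_circleMap c r).continuousOn
      (fun θ _ => Metric.sphere_subset_closedBall (hmem θ))
  have hinv : Continuous fun θ => (w θ ^ (n + 1))⁻¹ :=
    (hwcont.pow _).inv₀ (fun θ => pow_ne_zero _ (hw0 θ))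
  have conjint : ∀ g : ℂ → ℂ, DiffContOnCl ℂ g (Metric.ball c r) →
      ∫ θ in (0:ℝ)..2 * π, (w θ ^ (n + 1))⁻¹ * (starRingEnd ℂ) (g (circleMap c r θ)) = 0 := by
    intro g hg
    have h := congrArg (starRingEnd ℂ) (integral_circleMap_pow_mul_eq_zero hr hg n)
    rw [← intervalIntegral.intervalIntegral_conj, map_zero] at h
    have h3 : ∀ θ : ℝ, (starRingEnd ℂ) (circleMap 0 r θ ^ (n + 1) * g (circleMap c r θ)) =
        ((r : ℂ) ^ 2) ^ (n + 1) * ((w θ ^ (n + 1))⁻¹ * (starRingEnd ℂ) (g (circleMap c r θ))) := by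
      intro θ
      rw [map_mul, map_pow, ← hw, hconj]
      rw [mul_pow, inv_pow]; ring
    simp only [h3] at h
    rw [intervalIntegral.integral_const_mul] at h
    have hr' : ((r : ℂ) ^ 2) ^ (n + 1) ≠ 0 := by
      have : (r : ℂ) ≠ 0 := by exact_mod_cast hr.ne'
      positivity
    exact (mul_eq_zero.mp h).resolve_left hr'
  have h1 := integral_circleMap_inv_pow_mul hr hf (n + 1)
  have h2 := conjint f hf
  have h4 := conjint (fun _ => (1 : ℂ)) diffContOnCl_const
  have h5 := integral_circleMap_inv_pow_mul hr hf 0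
  simp only [pow_zero, inv_one, one_mul, iteratedDeriv_zero, hfc, mul_zero] at h5
  have h6 : ∫ θ in (0:ℝ)..2 * π, (f (circleMap c r θ)).re = 0 := by
    have := congrArg Complex.re h5
    have h7 := intervalIntegral.intervalIntegral_re (f := fun θ => f (circleMap c r θ))
      (hfcont.intervalIntegrable 0 (2 * π)) (μ := MeasureTheory.volume)
    simp only [RCLike.re_to_complex] at h7
    rw [h7, this]; simp
  have key : (2 * π / (n + 1)! * iteratedDeriv (n + 1) f c : ℂ) =
      ∫ θ in (0:ℝ)..2 * π, (w θ ^ (n + 1))⁻¹ * ((2 * ((f (circleMap c r θ)).re - A) : ℝ) : ℂ) := by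
    have e : ∀ θ : ℝ, (w θ ^ (n + 1))⁻¹ * ((2 * ((f (circleMap c r θ)).re - A) : ℝ) : ℂ) =
        (w θ ^ (n + 1))⁻¹ * f (circleMap c r θ) +
        (w θ ^ (n + 1))⁻¹ * (starRingEnd ℂ) (f (circleMap c r θ)) -
        (2 * A : ℂ) * ((w θ ^ (n + 1))⁻¹ * (starRingEnd ℂ) (1 : ℂ)) := by
      intro θ
      have := Complex.add_conj (f (circleMap c r θ))
      rw [← mul_add, this]; push_cast; simp; ring
    simp only [e]
    rw [intervalIntegral.integral_sub, intervalIntegral.integral_add, h2,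
      intervalIntegral.integral_const_mul, h4, h1]
    · simp
    all_goals
      apply Continuous.intervalIntegrable
      have := hfcont.star
      try simp only [map_one]
      first
        | fun_prop
        | exact hinv.mul this
        | exact hinv.mul hfcont
        | exact (hinv.mul hfcont).add (hinv.mul this)
  have key2 : ‖(2 * π / (n + 1)! * iteratedDeriv (n + 1) f c : ℂ)‖ ≤
      ∫ θ in (0:ℝ)..2 * π, (r ^ (n + 1))⁻¹ * (2 * (A - (f (circleMap c r θ)).re)) := by
    rw [key]
    refine (intervalIntegral.norm_integral_le_integral_norm (by positivity)).trans (le_of_eq ?_)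
    refine intervalIntegral.integral_congr (fun θ _ => ?_)
    have := hA _ (hmem θ)
    rw [norm_mul, norm_inv, norm_pow, hwn, Complex.norm_real, Real.norm_eq_abs]
    congr 1
    rw [abs_mul, abs_two, abs_of_nonpos (sub_nonpos.mpr this), neg_sub]
  have h7 : ∫ θ in (0:ℝ)..2 * π, (r ^ (n + 1))⁻¹ * (2 * (A - (f (circleMap c r θ)).re)) =
      (r ^ (n + 1))⁻¹ * (2 * (2 * π * A)) := by
    rw [intervalIntegral.integral_const_mul, intervalIntegral.integral_const_mul,
      intervalIntegral.integral_sub, h6]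
    · simp
    · exact continuous_const.intervalIntegrable _ _
    · exact (Complex.continuous_re.comp hfcont).intervalIntegrable _ _
  rw [h7, norm_mul] at key2
  have h8 : ‖(2 * π / (n + 1)! : ℂ)‖ = 2 * π / (n + 1)! := by
    have : (2 * π / (n + 1)! : ℂ) = ((2 * π / (n + 1)! : ℝ) : ℂ) := by push_cast; rfl
    rw [this, Complex.norm_real, Real.norm_eq_abs, abs_of_pos (by positivity)]
  rw [h8] at key2
  have hpi := Real.pi_pos
  have hfac : (0 : ℝ) < (n + 1)! := by positivity
  rw [div_mul_eq_mul_div, div_le_iff₀ hfac] at key2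
  have : 2 * π * ‖iteratedDeriv (n + 1) f c‖ ≤ 2 * π * ((n + 1)! * (2 * A / r ^ (n + 1))) := by
    refine key2.trans (le_of_eq ?_)
    field_simp
  exact le_of_mul_le_mul_left this (by positivity)

lemma norm_iteratedDeriv_le_of_re_le {f : ℂ → ℂ} {c : ℂ} {R A : ℝ} (hR : 0 < R)
    (hf : DifferentiableOn ℂ f (Metric.ball c R)) (hfc : f c = 0)
    (hA : ∀ z ∈ Metric.ball c R, (f z).re ≤ A) (n : ℕ) :
    ‖iteratedDeriv (n + 1) f c‖ ≤ (n + 1)! * (2 * A / R ^ (n + 1)) := by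
  have hlim : Tendsto (fun r : ℝ => ((n + 1)! * (2 * A / r ^ (n + 1)) : ℝ)) (nhdsWithin R (Set.Iio R))
      (nhds ((n + 1)! * (2 * A / R ^ (n + 1)))) := by
    have : ContinuousAt (fun r : ℝ => ((n + 1)! * (2 * A / r ^ (n + 1)) : ℝ)) R :=
      continuousAt_const.mul (continuousAt_const.div (continuousAt_id.pow _) (by positivity))
    exact this.tendsto.mono_left nhdsWithin_le_nhds
  refine ge_of_tendsto hlim ?_
  filter_upwards [Ioo_mem_nhdsLT hR] with r hr
  have hcl : Metric.closedBall c r ⊆ Metric.ball c R := Metric.closedBall_subset_ball hr.2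
  refine norm_iteratedDeriv_le_of_re_le_aux hr.1 ?_ hfc
    (fun z hz => hA z (hcl (Metric.sphere_subset_closedBall hz))) n
  exact (hf.mono (by rw [closure_ball _ hr.1.ne']; exact hcl)).diffContOnCl

/-- Bounds for the Taylor coefficients of the logarithmic derivative of a zero-free function. -/
lemma norm_iteratedDeriv_logDeriv_le {F : ℂ → ℂ} {c : ℂ} {R A : ℝ} (hR : 0 < R)
    (hF : DifferentiableOn ℂ F (Metric.ball c R)) (hne : ∀ z ∈ Metric.ball c R, F z ≠ 0)
    (hM : ∀ z ∈ Metric.ball c R, ‖F z‖ ≤ Real.exp A * ‖F c‖) (j : ℕ) :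
    ‖iteratedDeriv j (logDeriv F) c‖ ≤ (j + 1)! * (2 * A / R ^ (j + 1)) := by
  have hd : DifferentiableOn ℂ (logDeriv F) (Metric.ball c R) := by
    intro z hz
    exact ((hF.deriv Metric.isOpen_ball z hz).div (hF z hz) (hne z hz))
  have hcmem : c ∈ Metric.ball c R := Metric.mem_ball_self hR
  obtain ⟨f, hf0, hf⟩ := hd.isExactOn_ball.with_val_at c 0
  have hfd : DifferentiableOn ℂ f (Metric.ball c R) :=
    fun z hz => (hf z hz).differentiableAt.differentiableWithinAt
  have hexp : ∀ z ∈ Metric.ball c R, F z = F c * Complex.exp (f z) := by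
    have hconst : ∀ z ∈ Metric.ball c R, F z * Complex.exp (-f z) = F c * Complex.exp (-f c) := by
      intro z hz
      refine (convex_ball c R).is_const_of_fderivWithin_eq_zero (𝕜 := ℂ)
        (f := fun z => F z * Complex.exp (-f z)) (s := Metric.ball c R) ?_ ?_ hz hcmem
      · exact hF.mul hfd.neg.cexp
      · intro x hx
        have hFx : HasDerivAt F (deriv F x) x :=
          (hF.differentiableAt (Metric.isOpen_ball.mem_nhds hx)).hasDerivAt
        have h1 := hFx.mul ((hf x hx).neg.cexp)
        have h2 : deriv F x * Complex.exp (-f x) + F x * (Complex.exp (-f x) * -logDeriv F x) = 0 := by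
          rw [logDeriv_apply]
          field_simp [hne x hx]
          ring
        have h3 : HasDerivAt (fun z => F z * Complex.exp (-f z)) 0 x := by
          rw [← h2]; exact h1
        rw [fderivWithin_of_isOpen Metric.isOpen_ball hx]
        have := h3.hasFDerivAt.fderiv
        rw [this]; ext; simp
    intro z hz
    have h := hconst z hz
    rw [hf0, neg_zero, Complex.exp_zero, mul_one] at h
    rw [← h, mul_assoc, ← Complex.exp_add]; simp
  have hre : ∀ z ∈ Metric.ball c R, (f z).re ≤ A := by
    intro z hz
    have h := hM z hz
    rw [hexp z hz, norm_mul, Complex.norm_exp, mul_comm] at h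
    have hpos : 0 < ‖F c‖ := norm_pos_iff.mpr (hne c hcmem)
    exact Real.exp_le_exp.mp (le_of_mul_le_mul_right h hpos)
  have h := norm_iteratedDeriv_le_of_re_le hR hfd hf0 hre j
  rw [iteratedDeriv_succ'] at h
  have heq : iteratedDeriv j (deriv f) c = iteratedDeriv j (logDeriv F) c := by
    apply Filter.EventuallyEq.iteratedDeriv_eq
    filter_upwards [Metric.isOpen_ball.mem_nhds hcmem] with z hz using (hf z hz).deriv
  rwa [heq] at h

/-- Partial sums of a Dirichlet character. -/
def charSum {m : ℕ} (χ : DirichletCharacter ℂ m) (n : ℕ) : ℂ := ∑ i ∈ Finset.range n, χ (i : ZMod m)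

lemma charSum_period {m : ℕ} [NeZero m] {χ : DirichletCharacter ℂ m} (hχ : χ ≠ 1) :
    charSum χ m = 0 := by
  have h := MulChar.sum_eq_zero_of_ne_one hχ
  rw [charSum, ← h]
  refine Finset.sum_bij (fun i _ => (i : ZMod m)) (by simp) ?_ ?_ (by simp)
  · intro a ha b hb hab
    rw [Finset.mem_range] at ha hb
    have := congrArg ZMod.val hab
    rwa [ZMod.val_cast_of_lt ha, ZMod.val_cast_of_lt hb] at this
  · intro b _
    exact ⟨b.val, by simp [ZMod.val_lt], by simp⟩

lemma charSum_add_period {m : ℕ} [NeZero m] {χ : DirichletCharacter ℂ m} (hχ : χ ≠ 1) (n : ℕ) :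
    charSum χ (m + n) = charSum χ n := by
  have h := charSum_period hχ
  rw [charSum] at *
  rw [Finset.sum_range_add, h, zero_add, charSum]
  simp

lemma sum_norm_char_le {m : ℕ} (χ : DirichletCharacter ℂ m) :
    ∑ i ∈ Finset.range m, ‖χ (i : ZMod m)‖ ≤ m.totient := by
  rw [Nat.totient_eq_card_coprime, Finset.card_filter]
  push_cast
  refine Finset.sum_le_sum fun i _ => ?_
  split_ifs with h
  · exact χ.norm_le_one _
  · rw [MulChar.map_nonunit, norm_zero]
    rwa [ZMod.isUnit_iff_coprime, Nat.coprime_comm]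

lemma norm_charSum_le {m : ℕ} [NeZero m] {χ : DirichletCharacter ℂ m} (hχ : χ ≠ 1) (n : ℕ) :
    ‖charSum χ n‖ ≤ m.totient / 2 := by
  induction n using Nat.strong_induction_on with
  | _ n ih =>
  by_cases hn : n < m
  · have h0 := charSum_period hχ
    have h1 : charSum χ n = -∑ i ∈ Finset.Ico n m, χ (i : ZMod m) := by
      rw [charSum, ← Finset.sum_range_add_sum_Ico _ hn.le] at h0
      exact eq_neg_of_add_eq_zero_left h0
    have h2 := sum_norm_char_le χ
    rw [← Finset.sum_range_add_sum_Ico _ hn.le] at h2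
    have h3 : ‖charSum χ n‖ ≤ ∑ i ∈ Finset.range n, ‖χ (i : ZMod m)‖ := norm_sum_le _ _
    have h4 : ‖charSum χ n‖ ≤ ∑ i ∈ Finset.Ico n m, ‖χ (i : ZMod m)‖ := by
      rw [h1, norm_neg]; exact norm_sum_le _ _
    linarith
  · have hm : 0 < m := Nat.pos_of_ne_zero (NeZero.ne m)
    obtain ⟨l, rfl⟩ := Nat.exists_eq_add_of_le (not_lt.mp hn)
    rw [charSum_add_period hχ]
    exact ih l (by omega)

lemma norm_charSum_succ_le {m : ℕ} (hm : m ≠ 1) (χ : DirichletCharacter ℂ m) (n : ℕ) :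
    ‖charSum χ (n + 1)‖ ≤ n := by
  rw [charSum, Finset.sum_range_succ']
  have : χ ((0 : ℕ) : ZMod m) = 0 := by
    rw [Nat.cast_zero]; exact DirichletCharacter.map_zero' χ hm
  rw [this, add_zero]
  refine (norm_sum_le _ _).trans ?_
  refine (Finset.sum_le_sum (fun i _ => χ.norm_le_one _)).trans ?_
  simp

lemma norm_cpow_sub_cpow_le {s : ℂ} (hs : 0 < s.re) {a b : ℝ} (ha : 0 < a) (hab : a ≤ b) :
    ‖(a : ℂ) ^ (-s) - (b : ℂ) ^ (-s)‖ ≤ ‖s‖ / s.re * (a ^ (-s.re) - b ^ (-s.re)) := by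
  have hs0 : s ≠ 0 := by rintro rfl; simp at hs
  have h0 : (0 : ℝ) ∉ Set.uIcc a b := by
    rw [Set.uIcc_of_le hab]; intro h; exact absurd h.1 (not_le.mpr ha)
  have h1 := integral_cpow (a := a) (b := b) (r := -s - 1)
    (Or.inr ⟨by intro h; apply hs0; have := congrArg (fun z => -(z + 1)) h; simpa using this, h0⟩)
  have h2 := integral_rpow (a := a) (b := b) (r := -s.re - 1)
    (Or.inr ⟨by linarith, h0⟩)
  rw [sub_add_cancel] at h1 h2
  have h3 : ‖∫ x : ℝ in a..b, (x : ℂ) ^ (-s - 1)‖ ≤ ∫ x : ℝ in a..b, x ^ (-s.re - 1) := by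
    refine (intervalIntegral.norm_integral_le_integral_norm hab).trans (le_of_eq ?_)
    refine intervalIntegral.integral_congr fun x hx => ?_
    rw [Set.uIcc_of_le hab] at hx
    have : 0 < x := ha.trans_le hx.1
    simp [Complex.norm_cpow_eq_rpow_re_of_pos this]
  rw [h1, h2, norm_div, norm_neg, div_neg, ← neg_div, neg_sub] at h3
  rw [norm_sub_rev]
  rw [div_le_iff₀ (norm_pos_iff.mpr hs0)] at h3
  refine h3.trans (le_of_eq ?_)
  field_simp

/-- The terms of the series for `L(s, χ)` obtained by partial summation. -/
def abelTerm {m : ℕ} (χ : DirichletCharacter ℂ m) (n : ℕ) (s : ℂ) : ℂ :=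
  charSum χ (n + 2) * (((n + 1 : ℕ) : ℂ) ^ (-s) - ((n + 2 : ℕ) : ℂ) ^ (-s))

lemma norm_abelTerm_le {m : ℕ} (χ : DirichletCharacter ℂ m) (n : ℕ) {s : ℂ} (hs : 0 < s.re) :
    ‖abelTerm χ n s‖ ≤ ‖s‖ / s.re * (‖charSum χ (n + 2)‖ *
      (((n + 1 : ℕ) : ℝ) ^ (-s.re) - ((n + 2 : ℕ) : ℝ) ^ (-s.re))) := by
  have := norm_cpow_sub_cpow_le hs (a := ((n + 1 : ℕ) : ℝ)) (b := ((n + 2 : ℕ) : ℝ))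
    (by positivity) (by push_cast; linarith)
  rw [abelTerm, norm_mul]
  simp only [Complex.ofReal_natCast] at this
  refine (mul_le_mul_of_nonneg_left this (norm_nonneg _)).trans (le_of_eq ?_)
  ring

lemma sum_abelTerm {m : ℕ} (hm : m ≠ 1) (χ : DirichletCharacter ℂ m) (s : ℂ) (N : ℕ) :
    ∑ n ∈ Finset.range N, abelTerm χ n s =
      (∑ n ∈ Finset.range (N + 1), LSeries.term (fun n => χ (n : ZMod m)) s n)
        - charSum χ (N + 1) * ((N + 1 : ℕ) : ℂ) ^ (-s) := by
  induction N with
  | zero =>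
    simp [charSum, DirichletCharacter.map_zero' χ hm]
  | succ N ih =>
    rw [Finset.sum_range_succ, ih, Finset.sum_range_succ _ (N + 1), abelTerm,
      LSeries.term_of_ne_zero (Nat.succ_ne_zero N), div_eq_mul_inv, ← Complex.cpow_neg]
    have : charSum χ (N + 2) = charSum χ (N + 1) + χ ((N + 1 : ℕ) : ZMod m) := by
      rw [charSum, Finset.sum_range_succ, charSum]
    rw [this]; ring

lemma telescope_sum_le {b c : ℕ → ℝ} (B : ℕ) (hb : Antitone b) (hb0 : ∀ n, 0 ≤ b n)
    (hc : ∀ n, c n ≤ n + 1) (hcB : ∀ n, c n ≤ B) (N : ℕ) :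
    ∑ n ∈ Finset.range N, c n * (b n - b (n + 1)) ≤ ∑ n ∈ Finset.range B, b n := by
  have key : ∀ N, ∑ n ∈ Finset.range N, c n * (b n - b (n + 1)) ≤
      (∑ n ∈ Finset.range (min N B), b n) - (min N B : ℕ) * b N := by
    intro N
    induction N with
    | zero => simp
    | succ N ih =>
      rw [Finset.sum_range_succ]
      have hd : 0 ≤ b N - b (N + 1) := sub_nonneg.mpr (hb N.le_succ)
      rcases lt_or_ge N B with h | h
      · rw [min_eq_left (by omega : N + 1 ≤ B), Finset.sum_range_succ]
        rw [min_eq_left h.le] at ih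
        have := mul_le_mul_of_nonneg_right (hc N) hd
        push_cast
        nlinarith
      · rw [min_eq_right (by omega : B ≤ N + 1)]
        rw [min_eq_right h] at ih
        have := mul_le_mul_of_nonneg_right (hcB N) hd
        nlinarith
  refine (key N).trans ?_
  have h1 : ∑ n ∈ Finset.range (min N B), b n ≤ ∑ n ∈ Finset.range B, b n :=
    Finset.sum_le_sum_of_subset_of_nonneg (Finset.range_mono (min_le_right _ _)) (fun i _ _ => hb0 i)
  have h2 : 0 ≤ ((min N B : ℕ) : ℝ) * b N := mul_nonneg (Nat.cast_nonneg _) (hb0 N)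
  linarith

lemma sum_rpow_neg_half_le (B : ℕ) (hB : 1 ≤ B) :
    ∑ n ∈ Finset.range B, ((n + 1 : ℕ) : ℝ) ^ (-(1 / 2 : ℝ)) ≤ 2 * √B - 1 := by
  induction B, hB using Nat.le_induction with
  | base => norm_num
  | succ B hB ih =>
    rw [Finset.sum_range_succ]
    have : ((B + 1 : ℕ) : ℝ) ^ (-(1 / 2 : ℝ)) ≤ 2 * (√((B + 1 : ℕ) : ℝ) - √B) := by
      rw [Real.rpow_neg (by positivity), ← Real.sqrt_eq_rpow]
      have h1 : 0 < √((B + 1 : ℕ) : ℝ) := Real.sqrt_pos.mpr (by positivity)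
      have h2 := Real.sq_sqrt (show (0 : ℝ) ≤ ((B + 1 : ℕ) : ℝ) by positivity)
      have h3 := Real.sq_sqrt (show (0 : ℝ) ≤ (B : ℝ) by positivity)
      rw [inv_le_iff_one_le_mul₀ h1]
      push_cast at *
      nlinarith [sq_nonneg (√((B : ℝ) + 1) - √B)]
    linarith

lemma sum_norm_abelTerm_le {m : ℕ} [NeZero m] (hm : m ≠ 1) {χ : DirichletCharacter ℂ m} (hχ : χ ≠ 1)
    {B : ℕ} (hB : m.totient = 2 * B) {s : ℂ} (hs : 0 < s.re) (N : ℕ) :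
    ∑ n ∈ Finset.range N, ‖abelTerm χ n s‖ ≤
      ‖s‖ / s.re * ∑ n ∈ Finset.range B, ((n + 1 : ℕ) : ℝ) ^ (-s.re) := by
  refine (Finset.sum_le_sum fun n _ => norm_abelTerm_le χ n hs).trans ?_
  rw [← Finset.mul_sum]
  refine mul_le_mul_of_nonneg_left ?_ (by positivity)
  refine telescope_sum_le (b := fun n => ((n + 1 : ℕ) : ℝ) ^ (-s.re)) B ?_ ?_ ?_ ?_ N
  · intro a b hab
    exact Real.rpow_le_rpow_of_nonpos (by positivity) (by exact_mod_cast Nat.succ_le_succ hab)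
      (by linarith)
  · intro n; positivity
  · intro n
    have := norm_charSum_succ_le hm χ (n + 1)
    exact_mod_cast this
  · intro n
    have := norm_charSum_le hχ (n + 2)
    rw [hB] at this
    push_cast at this
    linarith

lemma summable_norm_abelTerm {m : ℕ} [NeZero m] (hm : m ≠ 1) {χ : DirichletCharacter ℂ m} (hχ : χ ≠ 1)
    {B : ℕ} (hB : m.totient = 2 * B) {s : ℂ} (hs : 0 < s.re) :
    Summable fun n => ‖abelTerm χ n s‖ :=
  summable_of_sum_range_le (fun _ => norm_nonneg _) (sum_norm_abelTerm_le hm hχ hB hs)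

lemma tendsto_charSum_mul_cpow {m : ℕ} [NeZero m] {χ : DirichletCharacter ℂ m} (hχ : χ ≠ 1)
    {s : ℂ} (hs : 0 < s.re) :
    Tendsto (fun N : ℕ => charSum χ (N + 1) * ((N + 1 : ℕ) : ℂ) ^ (-s)) atTop (nhds 0) := by
  have h1 : Tendsto (fun N : ℕ => (m.totient / 2 : ℝ) * ((N + 1 : ℕ) : ℝ) ^ (-s.re)) atTop (nhds 0) := by
    have := (tendsto_rpow_neg_atTop hs).comp
      (tendsto_natCast_atTop_atTop.comp (tendsto_add_atTop_nat 1))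
    simpa using this.const_mul (m.totient / 2 : ℝ)
  refine squeeze_zero_norm (fun N => ?_) h1
  rw [norm_mul, Complex.norm_natCast_cpow_of_pos (Nat.succ_pos N)]
  exact mul_le_mul_of_nonneg_right (norm_charSum_le hχ _) (by positivity)

lemma tsum_abelTerm_eq_of_one_lt_re {m : ℕ} [NeZero m] (hm : m ≠ 1) {χ : DirichletCharacter ℂ m}
    (hχ : χ ≠ 1) {B : ℕ} (hB : m.totient = 2 * B) {s : ℂ} (hs : 1 < s.re) :
    ∑' n, abelTerm χ n s = DirichletCharacter.LFunction χ s := by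
  have hs0 : 0 < s.re := by linarith
  have h1 : Tendsto (fun N => ∑ n ∈ Finset.range N, abelTerm χ n s) atTop
      (nhds (∑' n, abelTerm χ n s)) := (summable_norm_abelTerm hm hχ hB hs0).of_norm.hasSum.tendsto_sum_nat
  have h2 : Tendsto (fun N => ∑ n ∈ Finset.range (N + 1), LSeries.term (fun n => χ (n : ZMod m)) s n)
      atTop (nhds (LSeries (fun n => χ (n : ZMod m)) s)) :=
    ((ZMod.LSeriesSummable_of_one_lt_re χ hs).hasSum.tendsto_sum_nat).comp (tendsto_add_atTop_nat 1)
  have h3 := h2.sub (tendsto_charSum_mul_cpow hχ hs0)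
  simp only [← sum_abelTerm hm, sub_zero] at h3
  rw [DirichletCharacter.LFunction_eq_LSeries χ hs]
  exact tendsto_nhds_unique h1 h3

lemma tsum_abelTerm_eq {m : ℕ} [NeZero m] (hm : m ≠ 1) {χ : DirichletCharacter ℂ m}
    (hχ : χ ≠ 1) {B : ℕ} (hB : m.totient = 2 * B) {s : ℂ} (hs : 0 < s.re) :
    ∑' n, abelTerm χ n s = DirichletCharacter.LFunction χ s := by
  set ε : ℝ := min s.re 1 / 2 with hε
  have hε0 : 0 < ε := by positivity
  have hεs : ε < s.re := by have := min_le_left s.re 1; linarith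
  have hε2 : ε < 2 := by have := min_le_right s.re 1; linarith
  set M : ℝ := ‖s‖ + 3 with hM
  set U : Set ℂ := {z | ε < z.re} ∩ Metric.ball 0 M with hU
  have hUo : IsOpen U := (isOpen_lt continuous_const Complex.continuous_re).inter Metric.isOpen_ball
  have hUc : IsPreconnected U :=
    ((convex_halfSpace_re_gt ε).inter (convex_ball 0 M)).isPreconnected
  have hs' : s ∈ U := ⟨hεs, by simp [hM]⟩
  have h2' : (2 : ℂ) ∈ U := ⟨by simpa using hε2, by simp [hM]; linarith [norm_nonneg s]⟩
  have hterm : ∀ n, ∀ z ∈ U, ‖abelTerm χ n z‖ ≤ M * (B * ((n + 1 : ℕ) : ℝ) ^ (-(ε + 1))) := by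
    intro n z hz
    have hz0 : 0 < z.re := hε0.trans hz.1
    have hzM : ‖z‖ ≤ M := by have := hz.2; rw [mem_ball_zero_iff] at this; exact this.le
    have hmv : ((n + 1 : ℕ) : ℝ) ^ (-z.re) - ((n + 2 : ℕ) : ℝ) ^ (-z.re) ≤
        z.re * ((n + 1 : ℕ) : ℝ) ^ (-(z.re + 1)) := by
      have hpos : (0 : ℝ) < ((n + 1 : ℕ) : ℝ) := by positivity
      have hb : 1 + (-z.re) * (1 / ((n + 1 : ℕ) : ℝ)) ≤ (1 + 1 / ((n + 1 : ℕ) : ℝ)) ^ (-z.re) := by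
        have h1 : 0 < 1 / ((n + 1 : ℕ) : ℝ) := by positivity
        have h2 : 0 < 1 + 1 / ((n + 1 : ℕ) : ℝ) := by linarith
        rw [Real.rpow_def_of_pos h2]
        have h3 := Real.log_le_sub_one_of_pos h2
        have h4 := Real.add_one_le_exp (Real.log (1 + 1 / ((n + 1 : ℕ) : ℝ)) * -z.re)
        nlinarith
      have e : ((n + 2 : ℕ) : ℝ) = ((n + 1 : ℕ) : ℝ) * (1 + 1 / ((n + 1 : ℕ) : ℝ)) := by
        field_simp; push_cast; ring
      rw [e, Real.mul_rpow hpos.le (by positivity), neg_add, Real.rpow_add hpos, Real.rpow_neg_one]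
      have := mul_le_mul_of_nonneg_left hb (Real.rpow_nonneg hpos.le (-z.re))
      simp only [one_div] at *
      nlinarith
    have hc : ‖charSum χ (n + 2)‖ ≤ B := by
      have := norm_charSum_le hχ (n + 2); rw [hB] at this; push_cast at this; linarith
    have hmono : ((n + 1 : ℕ) : ℝ) ^ (-(z.re + 1)) ≤ ((n + 1 : ℕ) : ℝ) ^ (-(ε + 1)) :=
      Real.rpow_le_rpow_of_exponent_le (by push_cast; linarith [(Nat.cast_nonneg n : (0:ℝ) ≤ n)])
        (by linarith [show ε < z.re from hz.1])
    calc ‖abelTerm χ n z‖ ≤ ‖z‖ / z.re * (‖charSum χ (n + 2)‖ *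
          (((n + 1 : ℕ) : ℝ) ^ (-z.re) - ((n + 2 : ℕ) : ℝ) ^ (-z.re))) := norm_abelTerm_le χ n hz0
      _ ≤ ‖z‖ / z.re * (‖charSum χ (n + 2)‖ * (z.re * ((n + 1 : ℕ) : ℝ) ^ (-(z.re + 1)))) := by gcongr
      _ = ‖z‖ * (‖charSum χ (n + 2)‖ * ((n + 1 : ℕ) : ℝ) ^ (-(z.re + 1))) := by field_simp
      _ ≤ M * (B * ((n + 1 : ℕ) : ℝ) ^ (-(ε + 1))) := by gcongr
  have hsum : Summable fun n : ℕ => M * (B * ((n + 1 : ℕ) : ℝ) ^ (-(ε + 1))) := by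
    have h : Summable fun n : ℕ => (n : ℝ) ^ (-(ε + 1)) := Real.summable_nat_rpow.mpr (by linarith)
    exact (((summable_nat_add_iff 1).mpr h).mul_left _).mul_left _
  have hdiff : DifferentiableOn ℂ (fun z => ∑' n, abelTerm χ n z) U := by
    refine Complex.differentiableOn_tsum_of_summable_norm hsum ?_ hUo hterm
    intro n z hz
    apply DifferentiableAt.differentiableWithinAt
    unfold abelTerm
    have h1 : ((n + 1 : ℕ) : ℂ) ≠ 0 := by exact_mod_cast Nat.succ_ne_zero n
    have h2 : ((n + 2 : ℕ) : ℂ) ≠ 0 := by exact_mod_cast Nat.succ_ne_zero (n + 1)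
    exact ((differentiableAt_id.neg.const_cpow (Or.inl h1)).sub
      (differentiableAt_id.neg.const_cpow (Or.inl h2))).const_mul _
  have hL := (DirichletCharacter.differentiable_LFunction hχ).differentiableOn (s := U)
  refine (hdiff.analyticOnNhd hUo).eqOn_of_preconnected_of_eventuallyEq (hL.analyticOnNhd hUo)
    hUc h2' ?_ hs'
  have : {z : ℂ | 1 < z.re} ∈ nhds (2 : ℂ) :=
    (isOpen_lt continuous_const Complex.continuous_re).mem_nhds (by simp)
  filter_upwards [this] with z hz using tsum_abelTerm_eq_of_one_lt_re hm hχ hB hz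

lemma norm_LFunction_le {m : ℕ} [NeZero m] (hm : m ≠ 1) {χ : DirichletCharacter ℂ m}
    (hχ : χ ≠ 1) {B : ℕ} (hB : m.totient = 2 * B) {s : ℂ} (hs : 1 / 2 ≤ s.re) :
    ‖DirichletCharacter.LFunction χ s‖ ≤ ‖s‖ / s.re * (2 * √B - 1) := by
  have hs0 : 0 < s.re := by linarith
  rw [← tsum_abelTerm_eq hm hχ hB hs0]
  refine tsum_of_norm_bounded (summable_norm_abelTerm hm hχ hB hs0).hasSum (fun n => le_rfl) |>.trans ?_
  have hB1 : 1 ≤ B := by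
    have := Nat.totient_pos.mpr (Nat.pos_of_ne_zero (NeZero.ne m))
    omega
  refine (Real.tsum_le_of_sum_range_le (fun _ => norm_nonneg _)
    (sum_norm_abelTerm_le hm hχ hB hs0)).trans ?_
  refine mul_le_mul_of_nonneg_left (le_trans ?_ (sum_rpow_neg_half_le B hB1)) (by positivity)
  refine Finset.sum_le_sum fun n _ => Real.rpow_le_rpow_of_exponent_le ?_ (by linarith)
  push_cast; linarith [(Nat.cast_nonneg n : (0:ℝ) ≤ n)]

lemma hasSum_succ_mul_geometric {q : ℝ} (hq0 : 0 ≤ q) (hq : q < 1) (N : ℕ) :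
    HasSum (fun j : ℕ => ((j + N : ℕ) + 1 : ℝ) * q ^ (j + N))
      (q ^ N * (q / (1 - q) ^ 2 + (N + 1) / (1 - q))) := by
  have hn : ‖q‖ < 1 := by rwa [Real.norm_eq_abs, abs_of_nonneg hq0]
  have h1 := hasSum_coe_mul_geometric_of_norm_lt_one hn
  have h2 := hasSum_geometric_of_lt_one hq0 hq
  have h3 := (h1.add (h2.mul_left (N + 1 : ℝ))).mul_left (q ^ N)
  rw [div_eq_mul_inv (N + 1 : ℝ)]
  refine h3.congr_fun ?_ |> fun h => h
  intro j
  push_cast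
  ring

section LogDeriv

variable {F : ℂ → ℂ} {c : ℂ} {R A δ : ℝ}

lemma hasSum_taylor_logDeriv (hF : DifferentiableOn ℂ F (Metric.ball c R))
    (hne : ∀ z ∈ Metric.ball c R, F z ≠ 0) (hδ : 0 ≤ δ) (hδR : δ < R) :
    HasSum (fun j : ℕ => ((j ! : ℂ)⁻¹ * iteratedDeriv j (logDeriv F) c) * (-(δ : ℂ)) ^ j)
      (logDeriv F (c - δ)) := by
  have hd : DifferentiableOn ℂ (logDeriv F) (Metric.ball c R) := by
    intro z hz
    exact ((hF.deriv Metric.isOpen_ball z hz).div (hF z hz) (hne z hz))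
  have hz : c - δ ∈ Metric.ball c R := by
    rw [Metric.mem_ball, dist_eq_norm]; simpa [abs_of_nonneg hδ] using hδR
  have h := Complex.hasSum_taylorSeries_on_ball hd hz
  convert! h using 2 with j
  simp only [smul_eq_mul]
  rw [show c - (δ : ℂ) - c = -δ by ring]
  ring

lemma norm_taylor_logDeriv_le (hR : 0 < R) (hF : DifferentiableOn ℂ F (Metric.ball c R))
    (hne : ∀ z ∈ Metric.ball c R, F z ≠ 0)
    (hM : ∀ z ∈ Metric.ball c R, ‖F z‖ ≤ Real.exp A * ‖F c‖) (hδ : 0 ≤ δ) (j : ℕ) :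
    ‖((j ! : ℂ)⁻¹ * iteratedDeriv j (logDeriv F) c) * (-(δ : ℂ)) ^ j‖ ≤
      2 * A / R * (((j : ℕ) + 1 : ℝ) * (δ / R) ^ j) := by
  have h := norm_iteratedDeriv_logDeriv_le hR hF hne hM j
  rw [norm_mul, norm_mul, norm_inv, Complex.norm_natCast, norm_pow, norm_neg, Complex.norm_real,
    Real.norm_eq_abs, abs_of_nonneg hδ]
  have hj : (0 : ℝ) < j ! := by positivity
  calc (j ! : ℝ)⁻¹ * ‖iteratedDeriv j (logDeriv F) c‖ * δ ^ j
      ≤ (j ! : ℝ)⁻¹ * ((j + 1)! * (2 * A / R ^ (j + 1))) * δ ^ j := by gcongr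
    _ = _ := by
      rw [Nat.factorial_succ, div_pow, pow_succ]
      push_cast
      field_simp

lemma norm_logDeriv_le (hR : 0 < R) (hF : DifferentiableOn ℂ F (Metric.ball c R))
    (hne : ∀ z ∈ Metric.ball c R, F z ≠ 0)
    (hM : ∀ z ∈ Metric.ball c R, ‖F z‖ ≤ Real.exp A * ‖F c‖) (hδ : 0 ≤ δ) (hδR : δ < R) :
    ‖logDeriv F (c - δ)‖ ≤ 2 * A * R / (R - δ) ^ 2 := by
  have hq : δ / R < 1 := (div_lt_one hR).mpr hδR
  have hs := (hasSum_succ_mul_geometric (q := δ / R) (by positivity) hq 0).mul_left (2 * A / R)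
  rw [← (hasSum_taylor_logDeriv hF hne hδ hδR).tsum_eq]
  refine (tsum_of_norm_bounded hs (fun j => ?_)).trans (le_of_eq ?_)
  · simpa using norm_taylor_logDeriv_le hR hF hne hM hδ j
  · have h1 : R - δ ≠ 0 := by linarith
    have h2 : 1 - δ / R = (R - δ) / R := by field_simp
    rw [h2]; field_simp; push_cast; ring

lemma norm_sum_taylor_logDeriv_le (hR : 0 < R) (hF : DifferentiableOn ℂ F (Metric.ball c R))
    (hne : ∀ z ∈ Metric.ball c R, F z ≠ 0)
    (hM : ∀ z ∈ Metric.ball c R, ‖F z‖ ≤ Real.exp A * ‖F c‖) (hδ : 0 ≤ δ) (hδR : δ < R) (N : ℕ) :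
    ‖∑ j ∈ Finset.range N, ((j ! : ℂ)⁻¹ * iteratedDeriv j (logDeriv F) c) * (-(δ : ℂ)) ^ j‖ ≤
      ‖logDeriv F (c - δ)‖ + 2 * A / R * ((δ / R) ^ N *
        ((δ / R) / (1 - δ / R) ^ 2 + (N + 1) / (1 - δ / R))) := by
  have hq : δ / R < 1 := (div_lt_one hR).mpr hδR
  have hs := (hasSum_succ_mul_geometric (q := δ / R) (by positivity) hq N).mul_left (2 * A / R)
  have h := hasSum_taylor_logDeriv hF hne hδ hδR
  have h2 := h.summable.sum_add_tsum_nat_add N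
  rw [h.tsum_eq] at h2
  rw [eq_sub_of_add_eq h2]
  refine (norm_sub_le _ _).trans (add_le_add le_rfl ?_)
  exact tsum_of_norm_bounded hs (fun j => norm_taylor_logDeriv_le hR hF hne hM hδ (j + N))

end LogDeriv

open ArithmeticFunction (vonMangoldt)

/-- The smooth weight `e^{-δu} ∑_{j<N} (δu)^j/j!`. -/
def gammaWeight (N : ℕ) (δ u : ℝ) : ℝ :=
  Real.exp (-(δ * u)) * ∑ j ∈ Finset.range N, (δ * u) ^ j / j !

/-- The coefficients of the Dirichlet series of `-L'/L(s, χ)`. -/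
def twistMangoldt {m : ℕ} (χ : DirichletCharacter ℂ m) (n : ℕ) : ℂ :=
  χ (n : ZMod m) * (vonMangoldt n : ℂ)

lemma iterate_logMul (f : ℕ → ℂ) (j n : ℕ) :
    LSeries.logMul^[j] f n = (Complex.log n) ^ j * f n := by
  induction j with
  | zero => simp
  | succ j ih =>
    rw [Function.iterate_succ_apply', LSeries.logMul, ih, pow_succ]; ring

lemma abscissaOfAbsConv_twist_vonMangoldt_le {m : ℕ} (χ : DirichletCharacter ℂ m) :
    LSeries.abscissaOfAbsConv (twistMangoldt χ) ≤ 1 := by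
  refine LSeries.abscissaOfAbsConv_le_of_forall_lt_LSeriesSummable' fun y hy => ?_
  have : (1 : ℝ) < y := by exact_mod_cast hy
  exact DirichletCharacter.LSeriesSummable_twist_vonMangoldt χ (by simpa using this)

lemma term_logMul_twist {m : ℕ} (χ : DirichletCharacter ℂ m) {δ : ℝ} (j n : ℕ) :
    LSeries.term (LSeries.logMul^[j] (twistMangoldt χ))
      (1 + δ : ℂ) n = χ n * ((vonMangoldt n / n * (Real.log n ^ j * Real.exp (-(δ * Real.log n))) : ℝ) : ℂ) := by
  rcases Nat.eq_zero_or_pos n with rfl | hn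
  · simp
  · rw [LSeries.term_of_ne_zero hn.ne', iterate_logMul, twistMangoldt]
    have hn0 : (n : ℂ) ≠ 0 := by exact_mod_cast hn.ne'
    have hn' : (0 : ℝ) < n := by exact_mod_cast hn
    have e1 : (n : ℂ) ^ (1 + δ : ℂ) = ((n * Real.exp (δ * Real.log n) : ℝ) : ℂ) := by
      rw [Complex.cpow_add _ _ hn0, Complex.cpow_one]
      push_cast
      rw [Complex.cpow_def_of_ne_zero hn0, ← Complex.natCast_log, mul_comm]
      simp [mul_comm]
    rw [e1, ← Complex.natCast_log, Real.exp_neg]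
    push_cast
    have := Complex.exp_ne_zero (δ * (Real.log n : ℂ))
    field_simp

lemma summable_vonMangoldt_weight_aux {δ : ℝ} (hδ : 0 < δ) (j : ℕ) :
    Summable fun n : ℕ => vonMangoldt n / n * (Real.log n ^ j * Real.exp (-(δ * Real.log n))) := by
  have h : LSeriesSummable (LSeries.logMul^[j] (twistMangoldt (1 : DirichletCharacter ℂ 1))) (1 + δ : ℂ) := by
    apply LSeriesSummable_of_abscissaOfAbsConv_lt_re
    rw [LSeries.absicssaOfAbsConv_logPowMul]
    refine (abscissaOfAbsConv_twist_vonMangoldt_le _).trans_lt ?_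
    have : (1 : ℝ) < 1 + δ := by linarith
    simpa using (by exact_mod_cast this : ((1 : ℝ) : EReal) < ((1 + δ : ℝ) : EReal))
  unfold LSeriesSummable at h
  have e := fun n => term_logMul_twist (1 : DirichletCharacter ℂ 1) (δ := δ) j n
  rw [show LSeries.term (LSeries.logMul^[j] (twistMangoldt (1 : DirichletCharacter ℂ 1))) (1 + δ : ℂ) = _ from funext e] at h
  have e2 : ∀ n : ℕ, (1 : DirichletCharacter ℂ 1) (n : ZMod 1) = 1 := by
    intro n; rw [Subsingleton.elim (n : ZMod 1) 1, map_one]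
  simp only [e2, one_mul] at h
  exact Complex.summable_ofReal.mp h

lemma vonMangoldt_mul_gammaWeight (N : ℕ) (δ : ℝ) (n : ℕ) :
    vonMangoldt n / n * gammaWeight N δ (Real.log n) = ∑ j ∈ Finset.range N,
      δ ^ j / j ! * (vonMangoldt n / n * (Real.log n ^ j * Real.exp (-(δ * Real.log n)))) := by
  rw [gammaWeight, Finset.mul_sum, Finset.mul_sum]
  refine Finset.sum_congr rfl fun j _ => ?_
  rw [mul_pow]; ring

lemma summable_vonMangoldt_gammaWeight {δ : ℝ} (hδ : 0 < δ) (N : ℕ) :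
    Summable fun n : ℕ => vonMangoldt n / n * gammaWeight N δ (Real.log n) := by
  simp only [vonMangoldt_mul_gammaWeight]
  exact summable_sum fun j _ => (summable_vonMangoldt_weight_aux hδ j).mul_left _

lemma tsum_twist_gammaWeight_eq {m : ℕ} [NeZero m] (χ : DirichletCharacter ℂ m) {δ : ℝ}
    (hδ : 0 < δ) (N : ℕ) :
    ∑' n : ℕ, χ n * ((vonMangoldt n / n * gammaWeight N δ (Real.log n) : ℝ) : ℂ) =
      -∑ j ∈ Finset.range N, ((j ! : ℂ)⁻¹ *
        iteratedDeriv j (logDeriv (DirichletCharacter.LFunction χ)) (1 + δ)) * (-(δ : ℂ)) ^ j := by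
  have hre : 1 < (1 + δ : ℂ).re := by simpa using hδ
  have hs : ∀ j, Summable fun n : ℕ =>
      χ n * ((vonMangoldt n / n * (Real.log n ^ j * Real.exp (-(δ * Real.log n))) : ℝ) : ℂ) := by
    intro j
    refine Summable.of_norm_bounded (summable_vonMangoldt_weight_aux hδ j) fun n => ?_
    rw [norm_mul, Complex.norm_real]
    have h0 : 0 ≤ vonMangoldt n / n * (Real.log n ^ j * Real.exp (-(δ * Real.log n))) :=
      mul_nonneg (div_nonneg ArithmeticFunction.vonMangoldt_nonneg (Nat.cast_nonneg _))
        (mul_nonneg (pow_nonneg (Real.log_natCast_nonneg _) _) (Real.exp_nonneg _))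
    rw [Real.norm_of_nonneg h0]
    exact mul_le_of_le_one_left h0 (χ.norm_le_one _)
  have h1 : ∀ j, iteratedDeriv j (logDeriv (DirichletCharacter.LFunction χ)) (1 + δ) =
      -((-1) ^ j * ∑' n : ℕ,
        χ n * ((vonMangoldt n / n * (Real.log n ^ j * Real.exp (-(δ * Real.log n))) : ℝ) : ℂ)) := by
    intro j
    have hab : LSeries.abscissaOfAbsConv (twistMangoldt χ)
        < (1 + δ : ℂ).re := by
      refine (abscissaOfAbsConv_twist_vonMangoldt_le _).trans_lt ?_
      exact_mod_cast hre
    have h2 := LSeries_iteratedDeriv j hab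
    have h3 : logDeriv (DirichletCharacter.LFunction χ) =ᶠ[nhds (1 + δ : ℂ)]
        -(LSeries (twistMangoldt χ)) := by
      have : {z : ℂ | 1 < z.re} ∈ nhds (1 + δ : ℂ) :=
        (isOpen_lt continuous_const Complex.continuous_re).mem_nhds hre
      filter_upwards [this] with z hz
      have h5 : LSeries (twistMangoldt χ) z = _ :=
        DirichletCharacter.LSeries_twist_vonMangoldt_eq χ hz
      rw [Pi.neg_apply, h5, logDeriv_apply,
        DirichletCharacter.deriv_LFunction_eq_deriv_LSeries χ hz,
        DirichletCharacter.LFunction_eq_LSeries χ hz]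
      ring
    rw [h3.iteratedDeriv_eq, iteratedDeriv_neg, h2, LSeries]
    simp only [term_logMul_twist]
  have h4 : ∀ n : ℕ, χ n * ((vonMangoldt n / n * gammaWeight N δ (Real.log n) : ℝ) : ℂ) =
      ∑ j ∈ Finset.range N, ((δ ^ j / j ! : ℝ) : ℂ) *
        (χ n * ((vonMangoldt n / n * (Real.log n ^ j * Real.exp (-(δ * Real.log n))) : ℝ) : ℂ)) := by
    intro n
    rw [vonMangoldt_mul_gammaWeight, Complex.ofReal_sum, Finset.mul_sum]
    refine Finset.sum_congr rfl fun j _ => ?_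
    push_cast; ring
  simp only [h4]
  rw [Summable.tsum_finsetSum fun j _ => (hs j).mul_left _, ← Finset.sum_neg_distrib]
  refine Finset.sum_congr rfl fun j _ => ?_
  rw [tsum_mul_left, h1, neg_pow (δ : ℂ)]
  generalize ∑' n : ℕ, χ n *
    ((vonMangoldt n / n * (Real.log n ^ j * Real.exp (-(δ * Real.log n))) : ℝ) : ℂ) = Q
  push_cast
  have : ((-1 : ℂ) ^ j) * (-1) ^ j = 1 := by rw [← mul_pow]; simp
  linear_combination (-(δ : ℂ) ^ j / j ! * Q) * this

lemma norm_inv_LFunction_le {m : ℕ} [NeZero m] (χ : DirichletCharacter ℂ m) {σ : ℝ} (hσ : 1 < σ)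
    {g : ℕ → ℝ} {Z : ℝ} (hg : HasSum g Z) (hχg : ∀ n : ℕ, n ≠ 0 → ‖χ (n : ZMod m)‖ * (n : ℝ) ^ (-σ) ≤ g n)
    (hg0 : 0 ≤ g 0) :
    ‖DirichletCharacter.LFunction χ σ‖⁻¹ ≤ Z := by
  have hσ' : 1 < (σ : ℂ).re := by simpa using hσ
  have h := DirichletCharacter.LSeries.mul_mu_eq_one χ hσ'
  rw [← DirichletCharacter.LFunction_eq_LSeries χ hσ'] at h
  rw [← norm_inv, inv_eq_of_mul_eq_one_right h, LSeries]
  refine tsum_of_norm_bounded hg fun n => ?_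
  rcases eq_or_ne n 0 with rfl | hn
  · simpa using hg0
  · rw [LSeries.term_of_ne_zero hn, norm_div, Complex.norm_natCast_cpow_of_pos (Nat.pos_of_ne_zero hn),
      div_eq_mul_inv, ← Real.rpow_neg (Nat.cast_nonneg n), Complex.ofReal_re]
    refine le_trans ?_ (hχg n hn)
    refine mul_le_mul_of_nonneg_right ?_ (by positivity)
    rw [Pi.mul_apply, norm_mul]
    refine mul_le_of_le_one_right (norm_nonneg _) ?_
    rw [Complex.norm_intCast]
    exact_mod_cast ArithmeticFunction.abs_moebius_le_one

lemma tsum_rpow_three_half_le : ∑' n : ℕ, (n : ℝ) ^ (-(3 / 2 : ℝ)) ≤ 2.616 := by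
  have hstep : ∀ n : ℕ, 3 ≤ n → ((n + 1 : ℕ) : ℝ) ^ (-(3 / 2 : ℝ)) ≤
      2 / √((n : ℝ) + 1 / 2) - 2 / √(((n + 1 : ℕ) : ℝ) + 1 / 2) := by
    intro n _
    set a := √((n : ℝ) + 1 / 2) with ha
    set b := √(((n + 1 : ℕ) : ℝ) + 1 / 2) with hb
    set x := √((n + 1 : ℕ) : ℝ) with hx
    have ha0 : 0 < a := Real.sqrt_pos.mpr (by positivity)
    have hb0 : 0 < b := Real.sqrt_pos.mpr (by positivity)
    have hx0 : 0 < x := Real.sqrt_pos.mpr (by positivity)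
    have ha2 : a ^ 2 = (n : ℝ) + 1 / 2 := Real.sq_sqrt (by positivity)
    have hb2 : b ^ 2 = (n : ℝ) + 3 / 2 := by
      rw [hb, Real.sq_sqrt (by positivity)]; push_cast; ring
    have hx2 : x ^ 2 = (n : ℝ) + 1 := by rw [hx, Real.sq_sqrt (by positivity)]; push_cast; ring
    have e : ((n + 1 : ℕ) : ℝ) ^ (-(3 / 2 : ℝ)) = 1 / x ^ 3 := by
      rw [hx, Real.sqrt_eq_rpow, ← Real.rpow_natCast, ← Real.rpow_mul (by positivity),
        Real.rpow_neg (by positivity), one_div]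
      norm_num
    rw [e]
    have h1 : a * b ≤ x ^ 2 := by nlinarith [sq_nonneg (a - b)]
    have h2 : a + b ≤ 2 * x := by nlinarith [sq_nonneg (a - b)]
    have h3 : 2 / a - 2 / b = 2 / (a * b * (a + b)) := by
      have : b ^ 2 - a ^ 2 = 1 := by linarith
      field_simp
      linear_combination this
    rw [h3, div_le_div_iff₀ (by positivity) (by positivity)]
    have : a * b * (a + b) ≤ x ^ 2 * (2 * x) := by gcongr
    nlinarith
  have hpart : ∀ N : ℕ, ∑ n ∈ Finset.range (N + 4), (n : ℝ) ^ (-(3 / 2 : ℝ)) ≤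
      (∑ n ∈ Finset.range 4, (n : ℝ) ^ (-(3 / 2 : ℝ))) + 2 / √(3.5 : ℝ) - 2 / √(((N + 3 : ℕ) : ℝ) + 1 / 2) := by
    intro N
    induction N with
    | zero => norm_num
    | succ N ih =>
      rw [show N + 1 + 4 = (N + 4) + 1 by ring, Finset.sum_range_succ]
      have := hstep (N + 3) (by omega)
      push_cast at *
      rw [show (N : ℝ) + 3 + 1 = N + 4 by ring] at this
      rw [show (N : ℝ) + 1 + 3 = N + 4 by ring]
      linarith
  refine Real.tsum_le_of_sum_range_le (fun n => by positivity) fun N => ?_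
  have h0 : ∑ n ∈ Finset.range N, (n : ℝ) ^ (-(3 / 2 : ℝ)) ≤
      ∑ n ∈ Finset.range (N + 4), (n : ℝ) ^ (-(3 / 2 : ℝ)) :=
    Finset.sum_le_sum_of_subset_of_nonneg (Finset.range_mono (by omega)) fun _ _ _ => by positivity
  refine h0.trans ((hpart N).trans ?_)
  have h5 : 0 ≤ 2 / √(((N + 3 : ℕ) : ℝ) + 1 / 2) := by positivity
  have e2 : (2 : ℝ) ^ (-(3 / 2 : ℝ)) = 1 / (2 * √2) := by
    rw [Real.rpow_neg (by norm_num), one_div, show (3 / 2 : ℝ) = 1 + 1 / 2 by norm_num,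
      Real.rpow_add (by norm_num), Real.rpow_one, ← Real.sqrt_eq_rpow]
  have e3 : (3 : ℝ) ^ (-(3 / 2 : ℝ)) = 1 / (3 * √3) := by
    rw [Real.rpow_neg (by norm_num), one_div, show (3 / 2 : ℝ) = 1 + 1 / 2 by norm_num,
      Real.rpow_add (by norm_num), Real.rpow_one, ← Real.sqrt_eq_rpow]
  have s2 : 1.4142 ≤ √2 := Real.le_sqrt_of_sq_le (by norm_num)
  have s3 : 1.732 ≤ √3 := Real.le_sqrt_of_sq_le (by norm_num)
  have s4 : 1.8708 ≤ √3.5 := Real.le_sqrt_of_sq_le (by norm_num)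
  have f2 : 1 / (2 * √2) ≤ 0.35357 := by rw [div_le_iff₀ (by positivity)]; linarith
  have f3 : 1 / (3 * √3) ≤ 0.19246 := by rw [div_le_iff₀ (by positivity)]; linarith
  have f4 : 2 / √3.5 ≤ 1.0691 := by rw [div_le_iff₀ (by positivity)]; linarith
  have f0 : (0 : ℝ) ^ (-(3 / 2 : ℝ)) = 0 := Real.zero_rpow (by norm_num)
  simp only [Finset.sum_range_succ, Finset.sum_range_zero, Nat.cast_zero, Nat.cast_one,
    Nat.cast_ofNat, Real.one_rpow, e2, e3, f0]
  linarith

lemma norm_inv_LFunction_three_half_le {m : ℕ} [NeZero m] (χ : DirichletCharacter ℂ m) :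
    ‖DirichletCharacter.LFunction χ ((3 / 2 : ℝ) : ℂ)‖⁻¹ ≤ 2.616 := by
  have hs : Summable fun n : ℕ => (n : ℝ) ^ (-(3 / 2 : ℝ)) :=
    Real.summable_nat_rpow.mpr (by norm_num)
  refine (norm_inv_LFunction_le χ (by norm_num) hs.hasSum (fun n _ => ?_) (by positivity)).trans
    tsum_rpow_three_half_le
  exact mul_le_of_le_one_left (by positivity) (χ.norm_le_one _)

lemma norm_inv_LFunction_three_half_le_of_dvd {m d : ℕ} [NeZero m] (χ : DirichletCharacter ℂ m)
    (hd : d = 2 ∨ d = 3) (hdm : d ∣ m) :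
    ‖DirichletCharacter.LFunction χ ((3 / 2 : ℝ) : ℂ)‖⁻¹ ≤ 2.113 := by
  have hd0 : d ≠ 0 := by omega
  have hs : Summable fun n : ℕ => (n : ℝ) ^ (-(3 / 2 : ℝ)) :=
    Real.summable_nat_rpow.mpr (by norm_num)
  have hinj : Function.Injective fun n : ℕ => d * n := fun a b h =>
    Nat.eq_of_mul_eq_mul_left (Nat.pos_of_ne_zero hd0) h
  set f : ℕ → ℝ := fun n => if d ∣ n then (n : ℝ) ^ (-(3 / 2 : ℝ)) else 0 with hf
  have hfsum : HasSum f ((d : ℝ) ^ (-(3 / 2 : ℝ)) * ∑' n : ℕ, (n : ℝ) ^ (-(3 / 2 : ℝ))) := by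
    rw [← hinj.hasSum_iff]
    · have := hs.hasSum.mul_left ((d : ℝ) ^ (-(3 / 2 : ℝ)))
      convert! this using 2 with n
      simp only [hf, Function.comp_apply, dvd_mul_right, if_true]
      rw [Nat.cast_mul, Real.mul_rpow (by positivity) (by positivity)]
    · intro n hn
      simp only [hf]
      rw [if_neg]
      rintro ⟨c, rfl⟩
      exact hn ⟨c, rfl⟩
  refine (norm_inv_LFunction_le χ (by norm_num) (hs.hasSum.sub hfsum) (fun n _ => ?_) ?_).trans ?_
  · simp only [hf]
    split_ifs with h
    · rw [MulChar.map_nonunit]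
      · simp
      · rw [ZMod.isUnit_iff_coprime]
        intro hc
        have := Nat.dvd_gcd h hdm
        rw [hc.gcd_eq_one] at this
        have := Nat.le_of_dvd one_pos this
        omega
    · rw [sub_zero]
      exact mul_le_of_le_one_left (by positivity) (χ.norm_le_one _)
  · simp [hf, Real.zero_rpow]
  · have h1 := tsum_rpow_three_half_le
    have h0 : 0 ≤ ∑' n : ℕ, (n : ℝ) ^ (-(3 / 2 : ℝ)) := tsum_nonneg fun n => by positivity
    have h3 : 0.19244 ≤ (3 : ℝ) ^ (-(3 / 2 : ℝ)) := by
      rw [Real.rpow_neg (by norm_num), show (3 / 2 : ℝ) = 1 + 1 / 2 by norm_num,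
        Real.rpow_add (by norm_num), Real.rpow_one, ← Real.sqrt_eq_rpow]
      have : √3 ≤ 1.73206 := Real.sqrt_le_iff.mpr (by norm_num)
      have h : (3 * √3)⁻¹ ≥ (3 * 1.73206)⁻¹ := by
        apply inv_anti₀ (by positivity); linarith
      refine le_trans ?_ h
      norm_num
    have h2 : (3 : ℝ) ^ (-(3 / 2 : ℝ)) ≤ (d : ℝ) ^ (-(3 / 2 : ℝ)) :=
      Real.rpow_le_rpow_of_nonpos (by positivity)
        (by rcases hd with rfl | rfl <;> norm_num) (by norm_num)
    nlinarith

lemma norm_inv_LFunction_large_le {m : ℕ} [NeZero m] (χ : DirichletCharacter ℂ m) {δ : ℝ}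
    (hδ : 17 ≤ δ) : ‖DirichletCharacter.LFunction χ ((1 + δ : ℝ) : ℂ)‖⁻¹ ≤ 1.0001 := by
  have hterm : ∀ n : ℕ, ((n + 2 : ℕ) : ℝ) ^ (-(1 + δ)) ≤
      1 / 65536 * (1 / ((n : ℝ) + 1) - 1 / ((n : ℝ) + 2)) := by
    intro n
    have hx : (2 : ℝ) ≤ ((n + 2 : ℕ) : ℝ) := by push_cast; linarith [(Nat.cast_nonneg n : (0:ℝ) ≤ n)]
    have hx0 : (0 : ℝ) < ((n + 2 : ℕ) : ℝ) := by positivity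
    have h1 : ((n + 2 : ℕ) : ℝ) ^ (-(1 + δ)) ≤ ((n + 2 : ℕ) : ℝ) ^ (-(18 : ℝ)) :=
      Real.rpow_le_rpow_of_exponent_le (by linarith) (by linarith)
    refine h1.trans ?_
    rw [Real.rpow_neg hx0.le, show (18 : ℝ) = ((18 : ℕ) : ℝ) by norm_num, Real.rpow_natCast,
      show 18 = 16 + 2 by norm_num, pow_add]
    have h2 : (65536 : ℝ) ≤ ((n + 2 : ℕ) : ℝ) ^ 16 := by
      calc (65536 : ℝ) = 2 ^ 16 := by norm_num
        _ ≤ _ := by gcongr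
    have h3 : (1 / ((n : ℝ) + 1) - 1 / ((n : ℝ) + 2)) = 1 / (((n : ℝ) + 1) * ((n : ℝ) + 2)) := by
      field_simp; ring
    rw [h3, ← one_div, div_mul_div_comm, one_mul]
    apply one_div_le_one_div_of_le (by positivity)
    have h4 : ((n : ℝ) + 1) * ((n : ℝ) + 2) ≤ ((n + 2 : ℕ) : ℝ) ^ 2 := by push_cast; nlinarith
    exact mul_le_mul h2 h4 (by positivity) (by positivity)
  have hs : Summable fun n : ℕ => (n : ℝ) ^ (-(1 + δ)) :=
    Real.summable_nat_rpow.mpr (by linarith)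
  refine (norm_inv_LFunction_le χ (by linarith) hs.hasSum (fun n _ => ?_) (by positivity)).trans ?_
  · exact mul_le_of_le_one_left (by positivity) (χ.norm_le_one _)
  · refine Real.tsum_le_of_sum_range_le (fun n => by positivity) fun N => ?_
    have hpart : ∀ N : ℕ, ∑ n ∈ Finset.range (N + 2), (n : ℝ) ^ (-(1 + δ)) ≤
        1 + 1 / 65536 * (1 - 1 / ((N : ℝ) + 1)) := by
      intro N
      induction N with
      | zero => simp [Finset.sum_range_succ]; rw [Real.zero_rpow (by linarith)]
      | succ N ih =>
        rw [show N + 1 + 2 = (N + 2) + 1 by ring, Finset.sum_range_succ]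
        have := hterm N
        rw [show ((N + 1 : ℕ) : ℝ) + 1 = N + 2 by push_cast; ring]
        linarith
    have h0 : ∑ n ∈ Finset.range N, (n : ℝ) ^ (-(1 + δ)) ≤
        ∑ n ∈ Finset.range (N + 2), (n : ℝ) ^ (-(1 + δ)) :=
      Finset.sum_le_sum_of_subset_of_nonneg (Finset.range_mono (by omega)) fun _ _ _ => by positivity
    have h6 : 0 ≤ 1 / ((N : ℝ) + 1) := by positivity
    have := hpart N
    linarith

lemma LFunction_ne_zero_of_GRH {m : ℕ} [hm0 : NeZero m] (hG : GRH m) {χ : DirichletCharacter ℂ m}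
    (hχ : χ ≠ 1) {s : ℂ} (hs : 1 / 2 < s.re) : DirichletCharacter.LFunction χ s ≠ 0 := by
  intro h
  rcases lt_or_ge s.re 1 with h1 | h1
  · have := hG hm0 χ s h (by linarith) h1
    linarith
  · exact DirichletCharacter.LFunction_ne_zero_of_one_le_re χ (Or.inl hχ) h1 h

lemma norm_div_re_le_of_mem_ball {δ : ℝ} (hδ : 0 < δ) {z : ℂ}
    (hz : z ∈ Metric.ball ((1 + δ : ℝ) : ℂ) (δ + 1 / 2)) :
    1 / 2 < z.re ∧ ‖z‖ / z.re ≤ (1 + δ) / √(δ + 3 / 4) := by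
  rw [Metric.mem_ball, dist_eq_norm] at hz
  have hre : 1 / 2 < z.re := by
    have h1 := (Complex.abs_re_le_norm (z - ((1 + δ : ℝ) : ℂ))).trans_lt hz
    rw [Complex.sub_re, Complex.ofReal_re, abs_lt] at h1
    linarith [h1.1]
  refine ⟨hre, ?_⟩
  have h2 : ‖z - ((1 + δ : ℝ) : ℂ)‖ ^ 2 < (δ + 1 / 2) ^ 2 := by
    have := norm_nonneg (z - ((1 + δ : ℝ) : ℂ)); gcongr
  rw [← Complex.normSq_eq_norm_sq, Complex.normSq_apply] at h2
  simp only [Complex.sub_re, Complex.sub_im, Complex.ofReal_re, Complex.ofReal_im, sub_zero] at h2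
  have h3 : ‖z‖ ^ 2 = z.re * z.re + z.im * z.im := by
    rw [← Complex.normSq_eq_norm_sq, Complex.normSq_apply]
  have hc : 0 < δ + 3 / 4 := by linarith
  rw [div_le_div_iff₀ (by linarith) (Real.sqrt_pos.mpr hc)]
  apply le_of_sq_le_sq _ (by nlinarith)
  rw [mul_pow, mul_pow, Real.sq_sqrt hc.le, h3]
  nlinarith [sq_nonneg ((1 + δ) * z.re - (δ + 3 / 4))]

lemma LFunction_growth_of_GRH {m : ℕ} [NeZero m] (hm : m ≠ 1) (hG : GRH m)
    {χ : DirichletCharacter ℂ m} (hχ : χ ≠ 1) {B : ℕ} (hB : m.totient = 2 * B) {δ Z : ℝ}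
    (hδ : 0 < δ) (hZ : ‖DirichletCharacter.LFunction χ ((1 + δ : ℝ) : ℂ)‖⁻¹ ≤ Z) :
    ∀ z ∈ Metric.ball ((1 + δ : ℝ) : ℂ) (δ + 1 / 2),
      DirichletCharacter.LFunction χ z ≠ 0 ∧
      ‖DirichletCharacter.LFunction χ z‖ ≤
        Real.exp (Real.log ((1 + δ) / √(δ + 3 / 4) * (2 * √B - 1) * Z)) *
          ‖DirichletCharacter.LFunction χ ((1 + δ : ℝ) : ℂ)‖ := by
  intro z hz
  obtain ⟨hre, hzr⟩ := norm_div_re_le_of_mem_ball hδ hz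
  refine ⟨LFunction_ne_zero_of_GRH hG hχ hre, ?_⟩
  have hB1 : (1 : ℝ) ≤ √B := by
    have : 0 < m.totient := Nat.totient_pos.mpr (Nat.pos_of_ne_zero (NeZero.ne m))
    have h1 : 1 ≤ B := by omega
    exact Real.one_le_sqrt.mpr (by exact_mod_cast h1)
  have hc : 0 < ‖DirichletCharacter.LFunction χ ((1 + δ : ℝ) : ℂ)‖ := by
    refine norm_pos_iff.mpr (LFunction_ne_zero_of_GRH hG hχ ?_)
    rw [Complex.ofReal_re]; linarith
  have hZ0 : 0 < Z := (inv_pos.mpr hc).trans_le hZ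
  have hZ1 : 1 ≤ Z * ‖DirichletCharacter.LFunction χ ((1 + δ : ℝ) : ℂ)‖ := by
    rw [← div_le_iff₀ hc, one_div]; exact hZ
  have hs : 0 < √(δ + 3 / 4) := Real.sqrt_pos.mpr (by linarith)
  have hk : 0 < (1 + δ) / √(δ + 3 / 4) * (2 * √B - 1) := mul_pos (by positivity) (by linarith)
  rw [Real.exp_log (mul_pos hk hZ0)]
  calc _ ≤ ‖z‖ / z.re * (2 * √B - 1) := norm_LFunction_le hm hχ hB hre.le
    _ ≤ (1 + δ) / √(δ + 3 / 4) * (2 * √B - 1) := by gcongr; linarith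
    _ ≤ (1 + δ) / √(δ + 3 / 4) * (2 * √B - 1) *
        (Z * ‖DirichletCharacter.LFunction χ ((1 + δ : ℝ) : ℂ)‖) := le_mul_of_one_le_right hk.le hZ1
    _ = _ := by ring

/-- Explicit bound, under GRH, for a smoothed character sum over prime powers. -/
lemma norm_tsum_twist_gammaWeight_le {m : ℕ} [NeZero m] (hm : m ≠ 1) (hG : GRH m)
    {χ : DirichletCharacter ℂ m} (hχ : χ ≠ 1) {B : ℕ} (hB : m.totient = 2 * B) {δ Z : ℝ}
    (hδ : 17 ≤ δ) (hZ : ‖DirichletCharacter.LFunction χ ((3 / 2 : ℝ) : ℂ)‖⁻¹ ≤ Z) (N : ℕ) :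
    ‖∑' n : ℕ, χ n * ((vonMangoldt n / n * gammaWeight N δ (Real.log n) : ℝ) : ℂ)‖ ≤
      8 * Real.log ((1 + 1 / 2) / √(1 / 2 + 3 / 4) * (2 * √B - 1) * Z) +
        Real.log ((1 + δ) / √(δ + 3 / 4) * (2 * √B - 1) * 1.0001) *
          ((δ / (δ + 1 / 2)) ^ N * (8 * δ + 4 * (N + 1))) := by
  have hδ0 : 0 < δ := by linarith
  have hdiff : Differentiable ℂ (DirichletCharacter.LFunction χ) :=
    DirichletCharacter.differentiable_LFunction hχ
  rw [show (3 / 2 : ℝ) = 1 + 1 / 2 by norm_num] at hZ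
  have h1 := LFunction_growth_of_GRH hm hG hχ hB one_half_pos hZ
  have h2 := LFunction_growth_of_GRH hm hG hχ hB hδ0 (norm_inv_LFunction_large_le χ hδ)
  have g1 := norm_logDeriv_le (F := DirichletCharacter.LFunction χ) (R := (1 / 2 : ℝ) + 1 / 2)
    (δ := 1 / 2) (by norm_num) hdiff.differentiableOn (fun z hz => (h1 z hz).1)
    (fun z hz => (h1 z hz).2) (by norm_num) (by norm_num)
  have g2 := norm_sum_taylor_logDeriv_le (F := DirichletCharacter.LFunction χ) (R := δ + 1 / 2)
    (δ := δ) (by linarith) hdiff.differentiableOn (fun z hz => (h2 z hz).1)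
    (fun z hz => (h2 z hz).2) hδ0.le (by linarith) N
  rw [tsum_twist_gammaWeight_eq χ hδ0, norm_neg]
  have e1 : (((1 + 1 / 2 : ℝ) : ℂ) - ((1 / 2 : ℝ) : ℂ)) = 1 := by push_cast; ring
  have e2 : (((1 + δ : ℝ) : ℂ) - (δ : ℂ)) = 1 := by push_cast; ring
  rw [e1] at g1
  rw [e2] at g2
  push_cast at g2
  refine g2.trans (add_le_add (g1.trans (le_of_eq (by ring))) (le_of_eq ?_))
  have hR : δ + 1 / 2 ≠ 0 := by positivity
  have hq : 1 - δ / (δ + 1 / 2) = 1 / (2 * (δ + 1 / 2)) := by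
    field_simp; ring
  rw [hq]
  field_simp
  ring

/-- Abel summation: nonnegative partial sums stay nonnegative under antitone weights. -/
lemma sum_mul_nonneg_of_antitone {c w : ℕ → ℝ} (hw : Antitone w) (hw0 : ∀ n, 0 ≤ w n)
    (hc : ∀ n, 0 ≤ ∑ i ∈ Finset.range n, c i) (n : ℕ) :
    0 ≤ ∑ i ∈ Finset.range n, c i * w i := by
  have key : ∀ n, w n * ∑ i ∈ Finset.range (n + 1), c i ≤
      ∑ i ∈ Finset.range (n + 1), c i * w i := by
    intro n
    induction n with
    | zero => simp [mul_comm]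
    | succ n ih =>
      rw [Finset.sum_range_succ, Finset.sum_range_succ _ (n + 1)]
      have := mul_le_mul_of_nonneg_right (hw (Nat.le_succ n)) (hc (n + 1))
      nlinarith
  cases n with
  | zero => simp
  | succ n => exact (mul_nonneg (hw0 n) (hc (n + 1))).trans (key n)

lemma log_factorial_eq_sum_vonMangoldt (n : ℕ) :
    Real.log (n ! : ℝ) = ∑ d ∈ Finset.Ioc 0 n, vonMangoldt d * (n / d : ℕ) := by
  have h1 : Real.log (n ! : ℝ) = ∑ j ∈ Finset.Ioc 0 n, Real.log j := by
    induction n with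
    | zero => simp
    | succ n ih =>
      rw [Nat.factorial_succ, Nat.cast_mul, Real.log_mul (by positivity) (by positivity), ih,
        Finset.sum_Ioc_succ_top (Nat.zero_le n), add_comm]
  rw [h1]
  have h2 : ∀ j ∈ Finset.Ioc 0 n, Real.log j =
      ∑ d ∈ Finset.Ioc 0 n, if d ∣ j then vonMangoldt d else 0 := by
    intro j hj
    rw [Finset.mem_Ioc] at hj
    rw [← ArithmeticFunction.vonMangoldt_sum, ← Finset.sum_filter]
    refine Finset.sum_congr ?_ fun _ _ => rfl
    ext d
    simp only [Nat.mem_divisors, Finset.mem_filter, Finset.mem_Ioc]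
    constructor
    · rintro ⟨h, _⟩
      exact ⟨⟨Nat.pos_of_dvd_of_pos h hj.1, (Nat.le_of_dvd hj.1 h).trans hj.2⟩, h⟩
    · rintro ⟨_, h⟩
      exact ⟨h, by omega⟩
  rw [Finset.sum_congr rfl h2, Finset.sum_comm]
  refine Finset.sum_congr rfl fun d _ => ?_
  rw [← Finset.sum_filter, Finset.sum_const, Nat.Ioc_filter_dvd_card_eq_div, nsmul_eq_mul, mul_comm]

lemma add_one_pow_le_exp_mul_factorial (n : ℕ) :
    ((n : ℝ) + 1) ^ n ≤ Real.exp n * (n ! : ℝ) := by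
  induction n with
  | zero => simp
  | succ n ih =>
    have hn : (0 : ℝ) < (n : ℝ) + 1 := by positivity
    have h1 : ((n : ℝ) + 1 + 1) ^ (n + 1) ≤ Real.exp 1 * ((n : ℝ) + 1) ^ (n + 1) := by
      have h : (1 + 1 / ((n + 1 : ℕ) : ℝ)) ^ (n + 1) ≤ Real.exp 1 := by
        have h0 := Real.add_one_le_exp (1 / ((n + 1 : ℕ) : ℝ))
        rw [add_comm] at h0
        refine (pow_le_pow_left₀ (by positivity) h0 _).trans (le_of_eq ?_)
        rw [← Real.exp_nat_mul, mul_one_div_cancel (by positivity)]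
      have e : ((n : ℝ) + 1 + 1) = ((n : ℝ) + 1) * (1 + 1 / ((n + 1 : ℕ) : ℝ)) := by
        push_cast; field_simp
      rw [e, mul_pow, mul_comm]
      gcongr
    push_cast [Nat.factorial_succ]
    refine h1.trans ?_
    rw [Real.exp_add, pow_succ]
    have := mul_le_mul_of_nonneg_left ih (mul_pos (Real.exp_pos 1) hn).le
    nlinarith

lemma log_succ_sub_one_le_sum_vonMangoldt_div (n : ℕ) :
    Real.log (n + 1) - 1 ≤ ∑ d ∈ Finset.Ioc 0 n, vonMangoldt d / d := by
  rcases Nat.eq_zero_or_pos n with rfl | hn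
  · simp
  have hn' : (0 : ℝ) < n := by exact_mod_cast hn
  have h1 := Real.log_le_log (by positivity) (add_one_pow_le_exp_mul_factorial n)
  rw [Real.log_pow, Real.log_mul (Real.exp_ne_zero _) (by positivity), Real.log_exp,
    log_factorial_eq_sum_vonMangoldt] at h1
  have h2 : ∑ d ∈ Finset.Ioc 0 n, vonMangoldt d * (n / d : ℕ) ≤
      n * ∑ d ∈ Finset.Ioc 0 n, vonMangoldt d / d := by
    rw [Finset.mul_sum]
    refine Finset.sum_le_sum fun d _ => ?_
    have : ((n / d : ℕ) : ℝ) ≤ (n : ℝ) / d := Nat.cast_div_le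
    calc _ ≤ vonMangoldt d * ((n : ℝ) / d) :=
          mul_le_mul_of_nonneg_left this ArithmeticFunction.vonMangoldt_nonneg
      _ = _ := by ring
  refine le_of_mul_le_mul_left ?_ hn'
  linarith

/-- `e^{-x} ∑_{j<N} x^j/j!`. -/
def gammaTail (N : ℕ) (x : ℝ) : ℝ := Real.exp (-x) * ∑ j ∈ Finset.range N, x ^ j / j !

lemma gammaWeight_eq (N : ℕ) (δ u : ℝ) : gammaWeight N δ u = gammaTail N (δ * u) := rfl

lemma gammaTail_nonneg (N : ℕ) {x : ℝ} (hx : 0 ≤ x) : 0 ≤ gammaTail N x := by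
  unfold gammaTail; positivity

lemma gammaTail_le_one (N : ℕ) {x : ℝ} (hx : 0 ≤ x) : gammaTail N x ≤ 1 := by
  unfold gammaTail
  rw [Real.exp_neg, inv_mul_le_iff₀ (Real.exp_pos _), mul_one]
  exact Real.sum_le_exp_of_nonneg hx N

lemma gammaTail_zero {N : ℕ} (hN : 1 ≤ N) : gammaTail N 0 = 1 := by
  obtain ⟨M, rfl⟩ := Nat.exists_eq_add_of_le' hN
  simp [gammaTail, Finset.sum_range_succ']

lemma hasDerivAt_gammaTail_succ (N : ℕ) (x : ℝ) :
    HasDerivAt (gammaTail (N + 1)) (-(Real.exp (-x) * (x ^ N / N !))) x := by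
  induction N with
  | zero =>
    have h : gammaTail (0 + 1) = fun x => Real.exp (-x) := by ext; simp [gammaTail]
    rw [h]
    simpa using (hasDerivAt_neg x).exp
  | succ N ih =>
    have h : gammaTail (N + 1 + 1) = fun x => gammaTail (N + 1) x +
        Real.exp (-x) * (x ^ (N + 1) / (N + 1)!) := by
      ext y; rw [gammaTail, gammaTail, Finset.sum_range_succ, mul_add]
    rw [h]
    have h2 := ((hasDerivAt_neg x).exp).mul ((hasDerivAt_pow (N + 1) x).div_const ((N + 1)! : ℝ))
    convert! ih.add h2 using 1
    have : (N ! : ℝ) ≠ 0 := by positivity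
    push_cast [Nat.factorial_succ]
    field_simp
    ring

lemma antitoneOn_gammaTail (N : ℕ) : AntitoneOn (gammaTail N) (Set.Ici 0) := by
  cases N with
  | zero => intro x _ y _ _; simp [gammaTail]
  | succ N =>
    refine antitoneOn_of_deriv_nonpos (convex_Ici 0)
      (fun x _ => (hasDerivAt_gammaTail_succ N x).continuousAt.continuousWithinAt)
      (fun x _ => (hasDerivAt_gammaTail_succ N x).differentiableAt.differentiableWithinAt) ?_
    intro x hx
    rw [interior_Ici, Set.mem_Ioi] at hx
    rw [(hasDerivAt_gammaTail_succ N x).deriv]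
    have : 0 ≤ Real.exp (-x) * (x ^ N / N !) := by positivity
    linarith

/-- The decreasing antiderivative `∫_x^∞` of `gammaTail N`. -/
def gammaTailInt (N : ℕ) (x : ℝ) : ℝ := ∑ i ∈ Finset.range N, gammaTail (i + 1) x

lemma gammaTailInt_nonneg (N : ℕ) {x : ℝ} (hx : 0 ≤ x) : 0 ≤ gammaTailInt N x :=
  Finset.sum_nonneg fun _ _ => gammaTail_nonneg _ hx

lemma gammaTailInt_zero (N : ℕ) : gammaTailInt N 0 = N := by
  simp [gammaTailInt, gammaTail_zero]

lemma hasDerivAt_gammaTailInt (N : ℕ) (x : ℝ) :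
    HasDerivAt (gammaTailInt N) (-gammaTail N x) x := by
  have h := HasDerivAt.fun_sum (u := Finset.range N) fun i _ => hasDerivAt_gammaTail_succ i x
  convert! h using 1
  rw [Finset.sum_neg_distrib, gammaTail, Finset.mul_sum]

lemma gammaTailInt_sub_le {N : ℕ} {x y : ℝ} (hx : 0 ≤ x) (hxy : x ≤ y) :
    gammaTailInt N x - gammaTailInt N y ≤ gammaTail N x * (y - x) ∧
      gammaTail N y * (y - x) ≤ gammaTailInt N x - gammaTailInt N y := by
  rcases hxy.eq_or_lt with rfl | hlt
  · simp
  obtain ⟨c, hc, hd⟩ := exists_hasDerivAt_eq_slope (gammaTailInt N) _ hlt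
    (fun z _ => (hasDerivAt_gammaTailInt N z).continuousAt.continuousWithinAt)
    (fun z _ => hasDerivAt_gammaTailInt N z)
  rw [eq_div_iff (by linarith)] at hd
  have h1 := antitoneOn_gammaTail N (Set.mem_Ici.mpr hx) (Set.mem_Ici.mpr (hx.trans hc.1.le)) hc.1.le
  have h2 := antitoneOn_gammaTail N (Set.mem_Ici.mpr (hx.trans hc.1.le))
    (Set.mem_Ici.mpr (hx.trans hxy)) hc.2.le
  constructor <;> nlinarith

lemma tendsto_gammaTailInt (N : ℕ) : Tendsto (gammaTailInt N) atTop (nhds 0) := by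
  have h1 : ∀ M, Tendsto (gammaTail M) atTop (nhds 0) := by
    intro M
    have : gammaTail M = fun x => ∑ j ∈ Finset.range M, (x ^ j * Real.exp (-x)) / j ! := by
      ext x
      rw [gammaTail, Finset.mul_sum]
      exact Finset.sum_congr rfl fun j _ => by ring
    rw [this]
    rw [show (0 : ℝ) = ∑ j ∈ Finset.range M, (0 : ℝ) / (j ! : ℝ) by simp]
    exact tendsto_finsetSum _ fun j _ =>
      (Real.tendsto_pow_mul_exp_neg_atTop_nhds_zero j).div_const _
  unfold gammaTailInt
  rw [show (0 : ℝ) = ∑ i ∈ Finset.range N, (0 : ℝ) by simp]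
  exact tendsto_finsetSum _ fun i _ => h1 (i + 1)

lemma gammaTailInt_self (N : ℕ) :
    gammaTailInt N N = Real.exp (-N) * ((N : ℝ) ^ (N + 1) / N !) := by
  have key : ∀ M : ℕ, ∑ i ∈ Finset.range M, ∑ j ∈ Finset.range (i + 1), (N : ℝ) ^ j / j ! =
      ((M : ℝ) - N) * ∑ j ∈ Finset.range M, (N : ℝ) ^ j / j ! + M * ((N : ℝ) ^ M / M !) := by
    intro M
    induction M with
    | zero => simp
    | succ M ih =>
      rw [Finset.sum_range_succ, ih, Finset.sum_range_succ]
      have : (M ! : ℝ) ≠ 0 := by positivity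
      push_cast [Nat.factorial_succ]
      have h : (((M : ℝ) + 1) * ((N : ℝ) ^ (M + 1) / (((M : ℝ) + 1) * M !))) = N * ((N : ℝ) ^ M / M !) := by
        field_simp; ring
      rw [h]
      ring
  unfold gammaTailInt gammaTail
  rw [← Finset.mul_sum, key N]
  ring

lemma gammaTailInt_self_le {N : ℕ} (hN : 1 ≤ N) : gammaTailInt N N ≤ N / √(2 * π * N) := by
  rw [gammaTailInt_self]
  have hN' : (0 : ℝ) < N := by exact_mod_cast hN
  have h := Stirling.le_factorial_stirling N
  have hs : 0 < √(2 * π * N) := Real.sqrt_pos.mpr (by positivity)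
  have h1 : Real.exp (-N) * ((N : ℝ) ^ (N + 1) / N !) = N * (((N : ℝ) / Real.exp 1) ^ N / N !) := by
    rw [div_pow, ← Real.exp_nat_mul, mul_one, Real.exp_neg, pow_succ]
    field_simp
  rw [h1, div_eq_mul_inv (N : ℝ) (√(2 * π * N))]
  refine mul_le_mul_of_nonneg_left ?_ hN'.le
  rw [div_le_iff₀ (by positivity), ← div_eq_inv_mul, le_div_iff₀ hs]
  linarith

lemma gammaWeight_nonneg (N : ℕ) {δ u : ℝ} (hδ : 0 < δ) (hu : 0 ≤ u) : 0 ≤ gammaWeight N δ u :=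
  gammaTail_nonneg N (by positivity)

lemma gammaWeight_le_one (N : ℕ) {δ u : ℝ} (hδ : 0 < δ) (hu : 0 ≤ u) : gammaWeight N δ u ≤ 1 :=
  gammaTail_le_one N (by positivity)

lemma antitone_gammaWeight_log (N : ℕ) {δ : ℝ} (hδ : 0 < δ) :
    Antitone fun i : ℕ => gammaWeight N δ (Real.log (i + 1)) := by
  intro i j hij
  have hi : (0 : ℝ) ≤ Real.log (i + 1) := Real.log_nonneg (by linarith [(Nat.cast_nonneg i : (0:ℝ) ≤ i)])
  have hij' : Real.log ((i : ℝ) + 1) ≤ Real.log (j + 1) :=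
    Real.log_le_log (by positivity) (by gcongr)
  exact antitoneOn_gammaTail N (Set.mem_Ici.mpr (by positivity))
    (Set.mem_Ici.mpr (mul_nonneg hδ.le (hi.trans hij'))) (mul_le_mul_of_nonneg_left hij' hδ.le)

/-- Lower bound for the smoothed Mertens sum. -/
lemma le_tsum_vonMangoldt_gammaWeight (N : ℕ) {δ : ℝ} (hδ : 0 < δ) :
    N / δ - 1 ≤ ∑' n : ℕ, vonMangoldt n / n * gammaWeight N δ (Real.log n) := by
  set w : ℕ → ℝ := fun i => gammaWeight N δ (Real.log (i + 1)) with hw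
  have hlog : ∀ i : ℕ, (0 : ℝ) ≤ Real.log (i + 1) := fun i =>
    Real.log_nonneg (by linarith [(Nat.cast_nonneg i : (0:ℝ) ≤ i)])
  have hwn : ∀ i, 0 ≤ w i := fun i => gammaWeight_nonneg N hδ (hlog i)
  have hterm : ∀ n : ℕ, 0 ≤ vonMangoldt n / n * gammaWeight N δ (Real.log n) := fun n =>
    mul_nonneg (div_nonneg ArithmeticFunction.vonMangoldt_nonneg (Nat.cast_nonneg _))
      (gammaWeight_nonneg N hδ (Real.log_natCast_nonneg n))
  have hpart : ∀ M : ℕ, (N - gammaTailInt N (δ * Real.log (M + 1))) / δ - 1 ≤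
      ∑' n : ℕ, vonMangoldt n / n * gammaWeight N δ (Real.log n) := by
    intro M
    set c : ℕ → ℝ := fun i => vonMangoldt (i + 1) / ((i + 1 : ℕ) : ℝ) -
      (Real.log (((i + 1 : ℕ) : ℝ) + 1) - Real.log ((i : ℝ) + 1)) + if i = 0 then 1 else 0 with hc
    have hcs : ∀ n, 0 ≤ ∑ i ∈ Finset.range n, c i := by
      intro n
      rcases Nat.eq_zero_or_pos n with rfl | hn
      · simp
      have h1 := log_succ_sub_one_le_sum_vonMangoldt_div n
      have h2 : ∑ d ∈ Finset.Ioc 0 n, vonMangoldt d / d =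
          ∑ i ∈ Finset.range n, vonMangoldt (i + 1) / ((i + 1 : ℕ) : ℝ) := by
        rw [Finset.range_eq_Ico, Finset.sum_Ico_add' (fun d => vonMangoldt d / (d : ℝ)) 0 n 1]
        rfl
      simp only [hc, Finset.sum_add_distrib, Finset.sum_sub_distrib]
      have h3 := Finset.sum_range_sub (fun i : ℕ => Real.log ((i : ℝ) + 1)) n
      rw [Finset.sum_sub_distrib] at h3
      rw [Finset.sum_ite_eq' (Finset.range n) 0 (fun _ => (1 : ℝ)), if_pos (Finset.mem_range.mpr hn)]
      simp only [Nat.cast_zero, zero_add, Real.log_one, sub_zero] at h3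
      linarith
    have h := sum_mul_nonneg_of_antitone (antitone_gammaWeight_log N hδ) hwn hcs M
    have h4 : ∀ i ∈ Finset.range M,
        (gammaTailInt N (δ * Real.log (i + 1)) / δ - gammaTailInt N (δ * Real.log ((i + 1 : ℕ) + 1)) / δ) -
          (if i = 0 then 1 else 0) + c i * w i ≤
        vonMangoldt (i + 1) / ((i + 1 : ℕ) : ℝ) * gammaWeight N δ (Real.log ((i + 1 : ℕ) : ℝ)) := by
      intro i _
      have hle : Real.log ((i : ℝ) + 1) ≤ Real.log (((i + 1 : ℕ) : ℝ) + 1) :=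
        Real.log_le_log (by positivity) (by push_cast; linarith)
      have h5 := (gammaTailInt_sub_le (N := N) (mul_nonneg hδ.le (hlog i))
        (mul_le_mul_of_nonneg_left hle hδ.le)).1
      rw [← gammaWeight_eq, ← mul_sub, mul_left_comm, ← div_le_iff₀' hδ, sub_div] at h5
      have h6 : (if i = 0 then (1 : ℝ) else 0) * w i ≤ if i = 0 then 1 else 0 :=
        mul_le_of_le_one_right (by split_ifs <;> norm_num) (gammaWeight_le_one N hδ (hlog i))
      have h7 : gammaWeight N δ (Real.log ((i + 1 : ℕ) : ℝ)) = w i := by simp [hw]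
      rw [h7]
      simp only [hc, hw] at *
      linarith
    have h8 := Finset.sum_le_sum h4
    rw [Finset.sum_add_distrib, Finset.sum_sub_distrib] at h8
    have h9 := Finset.sum_range_sub' (fun i : ℕ => gammaTailInt N (δ * Real.log (i + 1)) / δ) M
    have h10 : ∑ i ∈ Finset.range M, (if i = 0 then (1 : ℝ) else 0) ≤ 1 := by
      rw [Finset.sum_ite_eq' (Finset.range M) 0 (fun _ => (1 : ℝ))]; split_ifs <;> norm_num
    have h11 : ∑ i ∈ Finset.range M, vonMangoldt (i + 1) / ((i + 1 : ℕ) : ℝ) *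
        gammaWeight N δ (Real.log ((i + 1 : ℕ) : ℝ)) ≤
        ∑' n : ℕ, vonMangoldt n / n * gammaWeight N δ (Real.log n) := by
      refine le_trans ?_ ((summable_vonMangoldt_gammaWeight hδ N).sum_le_tsum
        (Finset.range (M + 1)) fun n _ => hterm n)
      rw [Finset.sum_range_succ']
      have := hterm 0
      linarith
    simp only [Nat.cast_zero, zero_add, Real.log_one, mul_zero, gammaTailInt_zero] at h9
    rw [sub_div]
    push_cast at *
    linarith
  have hlim : Tendsto (fun M : ℕ => (N - gammaTailInt N (δ * Real.log (M + 1))) / δ - 1) atTop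
      (nhds ((N - 0) / δ - 1)) := by
    refine Tendsto.sub_const (Tendsto.div_const (Tendsto.const_sub _ ?_) _) _
    refine (tendsto_gammaTailInt N).comp (Tendsto.const_mul_atTop hδ ?_)
    refine Real.tendsto_log_atTop.comp ?_
    exact tendsto_atTop_add_const_right _ _ tendsto_natCast_atTop_atTop
  rw [sub_zero] at hlim
  exact le_of_tendsto' hlim hpart

lemma sum_log_prime_mul_le {g : ℕ → ℝ} (hg : Antitone g) (hg0 : ∀ n, 0 ≤ g n) (M : ℕ) :
    ∑ i ∈ Finset.range M, (if (i + 1).Prime then Real.log ((i + 1 : ℕ) : ℝ) else 0) * g i ≤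
      Real.log 4 * ∑ i ∈ Finset.range M, g i := by
  have h := sum_mul_nonneg_of_antitone
    (c := fun i => Real.log 4 - if (i + 1).Prime then Real.log ((i + 1 : ℕ) : ℝ) else 0) hg hg0 ?_ M
  · simp only [sub_mul, Finset.sum_sub_distrib] at h
    rw [Finset.mul_sum]
    linarith
  · intro n
    have h1 := Chebyshev.theta_le_log4_mul_x (Nat.cast_nonneg n : (0 : ℝ) ≤ n)
    rw [Chebyshev.theta, Nat.floor_natCast, Finset.sum_filter] at h1
    rw [Finset.sum_sub_distrib, Finset.sum_const, Finset.card_range, nsmul_eq_mul]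
    have h2 : ∑ p ∈ Finset.Ioc 0 n, (if p.Prime then Real.log (p : ℝ) else 0) =
        ∑ i ∈ Finset.range n, if (i + 1).Prime then Real.log ((i + 1 : ℕ) : ℝ) else 0 := by
      rw [Finset.range_eq_Ico,
        Finset.sum_Ico_add' (fun d : ℕ => if d.Prime then Real.log (d : ℝ) else 0) 0 n 1]
      rfl
    linarith

lemma sum_gammaWeight_mul_min_le {N n : ℕ} (hn : 1 ≤ n) {δ : ℝ} (hδ : 0 < δ) (M : ℕ) :
    ∑ i ∈ Finset.range M, gammaWeight N δ (Real.log (i + 1)) * min (1 / (n : ℝ)) (1 / ((i : ℝ) + 1)) ≤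
      1 + gammaTailInt N (δ * Real.log n) / δ := by
  have hn' : (0 : ℝ) < n := by exact_mod_cast hn
  have hlog : ∀ i : ℕ, (0 : ℝ) ≤ Real.log (i + 1) := fun i =>
    Real.log_nonneg (by linarith [(Nat.cast_nonneg i : (0:ℝ) ≤ i)])
  have key : ∀ K : ℕ, ∑ i ∈ Finset.range (n + K),
      gammaWeight N δ (Real.log (i + 1)) * min (1 / (n : ℝ)) (1 / ((i : ℝ) + 1)) ≤
      1 + (gammaTailInt N (δ * Real.log n) - gammaTailInt N (δ * Real.log ((n + K : ℕ) : ℝ))) / δ := by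
    intro K
    induction K with
    | zero =>
      simp only [add_zero, sub_self, zero_div]
      calc _ ≤ ∑ i ∈ Finset.range n, 1 / (n : ℝ) := Finset.sum_le_sum fun i _ => by
              calc _ ≤ 1 * (1 / (n : ℝ)) := mul_le_mul (gammaWeight_le_one N hδ (hlog i))
                    (min_le_left _ _) (by positivity) zero_le_one
                _ = _ := one_mul _
        _ = 1 := by rw [Finset.sum_const, Finset.card_range, nsmul_eq_mul]; field_simp
    | succ K ih =>
      rw [← add_assoc, Finset.sum_range_succ]
      set a : ℕ := n + K with ha
      have ha0 : (0 : ℝ) < a := by have : 0 < a := by omega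
                                   exact_mod_cast this
      have hle : Real.log (a : ℝ) ≤ Real.log ((a + 1 : ℕ) : ℝ) :=
        Real.log_le_log ha0 (by push_cast; linarith)
      have h1 := (gammaTailInt_sub_le (N := N) (mul_nonneg hδ.le (Real.log_natCast_nonneg a))
        (mul_le_mul_of_nonneg_left hle hδ.le)).2
      rw [← gammaWeight_eq, ← mul_sub, mul_left_comm, ← le_div_iff₀' hδ] at h1
      have h2 : 1 / ((a : ℝ) + 1) ≤ Real.log ((a + 1 : ℕ) : ℝ) - Real.log a := by
        rw [← Real.log_div (by positivity) ha0.ne']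
        have := Real.one_sub_inv_le_log_of_pos (x := ((a + 1 : ℕ) : ℝ) / a) (by positivity)
        refine le_trans (le_of_eq ?_) this
        push_cast
        field_simp
        ring
      have hw := gammaWeight_nonneg N hδ (hlog a)
      have h3 : gammaWeight N δ (Real.log (a + 1)) * min (1 / (n : ℝ)) (1 / ((a : ℝ) + 1)) ≤
          gammaWeight N δ (Real.log ((a + 1 : ℕ) : ℝ)) * (Real.log ((a + 1 : ℕ) : ℝ) - Real.log a) := by
        push_cast at h2 ⊢
        exact mul_le_mul_of_nonneg_left ((min_le_right _ _).trans h2) hw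
      have h4 := h3.trans h1
      rw [sub_div] at *
      linarith
  have hterm : ∀ i : ℕ, 0 ≤ gammaWeight N δ (Real.log (i + 1)) * min (1 / (n : ℝ)) (1 / ((i : ℝ) + 1)) :=
    fun i => mul_nonneg (gammaWeight_nonneg N hδ (hlog i)) (le_min (by positivity) (by positivity))
  refine (Finset.sum_le_sum_of_subset_of_nonneg (Finset.range_mono (Nat.le_add_left M n))
    fun i _ _ => hterm i).trans ((key M).trans ?_)
  have := gammaTailInt_nonneg N (mul_nonneg hδ.le (Real.log_natCast_nonneg (n + M)))
  gcongr
  linarith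

lemma sum_vonMangoldt_div_primePow_le {S U : Finset ℕ} {r : ℕ} (hS : ∀ p ∈ S, p.Prime)
    (hU : ∀ n ∈ U, vonMangoldt n ≠ 0 → ∃ p ∈ S, ∃ j, n = p ^ (j + r)) (hr : r ≠ 0) :
    ∑ n ∈ U, vonMangoldt n / n ≤
      ∑ p ∈ S, Real.log p / ((p : ℝ) ^ (r - 1) * ((p : ℝ) - 1)) := by
  classical
  have hnn : ∀ n : ℕ, 0 ≤ vonMangoldt n / (n : ℝ) := fun n =>
    div_nonneg ArithmeticFunction.vonMangoldt_nonneg (Nat.cast_nonneg n)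
  obtain ⟨J, hJ⟩ : ∃ J, ∀ n ∈ U, n < J :=
    ⟨U.sup id + 1, fun n hn => Nat.lt_succ_of_le (Finset.le_sup (f := id) hn)⟩
  set g : ℕ × ℕ → ℕ := fun q => q.1 ^ (q.2 + r) with hg
  have hsub : U.filter (fun n => vonMangoldt n ≠ 0) ⊆ (S ×ˢ Finset.range J).image g := by
    intro n hn
    rw [Finset.mem_filter] at hn
    obtain ⟨p, hp, j, rfl⟩ := hU n hn.1 hn.2
    refine Finset.mem_image.mpr ⟨(p, j), Finset.mem_product.mpr ⟨hp, ?_⟩, rfl⟩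
    rw [Finset.mem_range]
    calc j ≤ j + r := Nat.le_add_right _ _
      _ ≤ p ^ (j + r) := (Nat.lt_pow_self (hS p hp).one_lt).le
      _ < J := hJ _ hn.1
  calc ∑ n ∈ U, vonMangoldt n / n
      = ∑ n ∈ U.filter (fun n => vonMangoldt n ≠ 0), vonMangoldt n / n := by
        rw [Finset.sum_filter]
        refine Finset.sum_congr rfl fun n _ => ?_
        split_ifs with h
        · rfl
        · push Not at h
          rw [h, zero_div]
    _ ≤ ∑ n ∈ (S ×ˢ Finset.range J).image g, vonMangoldt n / n :=
        Finset.sum_le_sum_of_subset_of_nonneg hsub fun n _ _ => hnn n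
    _ ≤ ∑ q ∈ S ×ˢ Finset.range J, vonMangoldt (g q) / (g q : ℝ) :=
        Finset.sum_image_le_of_nonneg fun n _ => hnn n
    _ = ∑ p ∈ S, ∑ j ∈ Finset.range J, vonMangoldt (p ^ (j + r)) / ((p ^ (j + r) : ℕ) : ℝ) := by
        rw [Finset.sum_product]
    _ ≤ _ := by
        refine Finset.sum_le_sum fun p hp => ?_
        have hp1 : (1 : ℝ) < p := by exact_mod_cast (hS p hp).one_lt
        have h1 : ∀ j ∈ Finset.range J, vonMangoldt (p ^ (j + r)) / ((p ^ (j + r) : ℕ) : ℝ) =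
            Real.log p / (p : ℝ) ^ r * ((p : ℝ)⁻¹) ^ j := by
          intro j _
          rw [ArithmeticFunction.vonMangoldt_apply_pow (by omega),
            ArithmeticFunction.vonMangoldt_apply_prime (hS p hp)]
          push_cast
          rw [pow_add, inv_pow]
          field_simp
        rw [Finset.sum_congr rfl h1, ← Finset.mul_sum]
        have h2 : ∑ j ∈ Finset.range J, ((p : ℝ)⁻¹) ^ j ≤ (1 - (p : ℝ)⁻¹)⁻¹ :=
          (hasSum_geometric_of_lt_one (by positivity) (inv_lt_one_of_one_lt₀ hp1)).tsum_eq ▸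
            (summable_geometric_of_lt_one (by positivity) (inv_lt_one_of_one_lt₀ hp1)).sum_le_tsum
              (Finset.range J) (fun j _ => by positivity)
        have hl : 0 ≤ Real.log p := Real.log_nonneg hp1.le
        refine (mul_le_mul_of_nonneg_left h2 (by positivity)).trans (le_of_eq ?_)
        obtain ⟨s, rfl⟩ := Nat.exists_eq_succ_of_ne_zero hr
        have : (p : ℝ) - 1 ≠ 0 := by linarith
        simp only [Nat.succ_eq_add_one, Nat.add_sub_cancel, pow_succ]
        field_simp

lemma sum_log_div_mul_pred_le (M : ℕ) :
    ∑ i ∈ Finset.range M, Real.log ((i : ℝ) + 2) / (((i : ℝ) + 2) * ((i : ℝ) + 1)) ≤ Real.log 4 := by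
  have key : ∀ M : ℕ, ∑ i ∈ Finset.range M, Real.log ((i : ℝ) + 2) / (((i : ℝ) + 2) * ((i : ℝ) + 1)) ≤
      Real.log 4 - (Real.log ((M : ℝ) + 1) + Real.log 4) / ((M : ℝ) + 1) := by
    intro M
    induction M with
    | zero => simp
    | succ M ih =>
      rw [Finset.sum_range_succ]
      have h1 : Real.log ((M : ℝ) + 2) / (((M : ℝ) + 2) * ((M : ℝ) + 1)) ≤
          (Real.log ((M : ℝ) + 1) + Real.log 4) / ((M : ℝ) + 1) -
            (Real.log ((M : ℝ) + 2) + Real.log 4) / ((M : ℝ) + 2) := by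
        rw [div_sub_div _ _ (by positivity) (by positivity), mul_comm ((M : ℝ) + 2)]
        gcongr
        have h2 : ((M : ℝ) + 2) * (Real.log ((M : ℝ) + 2) - Real.log ((M : ℝ) + 1)) ≤ Real.log 4 := by
          rw [← Real.log_div (by positivity) (by positivity)]
          have e : ((M : ℝ) + 2) / ((M : ℝ) + 1) = 1 + 1 / ((M : ℝ) + 1) := by field_simp; ring
          rw [e]
          have hM : (0 : ℝ) ≤ M := Nat.cast_nonneg M
          have l2 := Real.log_two_gt_d9
          have l4 : Real.log 4 = 2 * Real.log 2 := by
            rw [show (4 : ℝ) = 2 ^ 2 by norm_num, Real.log_pow]; norm_num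
          rcases Nat.lt_or_ge M 2 with h | h
          · interval_cases M
            · norm_num [l4]
            · have h3 : Real.log (1 + 1 / ((1 : ℕ) + 1 : ℝ)) ≤ 0.4375 := by
                have : (1 + 1 / ((1 : ℕ) + 1 : ℝ)) = (9 / 4 : ℝ) ^ ((1:ℝ) / 2) := by
                  rw [← Real.sqrt_eq_rpow, show (9 / 4 : ℝ) = (3 / 2) ^ 2 by norm_num,
                    Real.sqrt_sq (by norm_num)]; norm_num
                rw [this, Real.log_rpow (by norm_num),
                  show (9 / 4 : ℝ) = 2 * (9 / 8) by norm_num,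
                  Real.log_mul (by norm_num) (by norm_num)]
                have := Real.log_le_sub_one_of_pos (show (0 : ℝ) < 9 / 8 by norm_num)
                have := Real.log_two_lt_d9
                linarith
              push_cast at h3 ⊢
              linarith
          · have h3 := Real.log_le_sub_one_of_pos (show (0 : ℝ) < 1 + 1 / ((M : ℝ) + 1) by positivity)
            have h4 : ((M : ℝ) + 2) * Real.log (1 + 1 / ((M : ℝ) + 1)) ≤
                ((M : ℝ) + 2) * (1 / ((M : ℝ) + 1)) := by gcongr; linarith
            refine h4.trans ?_
            rw [mul_one_div, div_le_iff₀ (by positivity)]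
            have : (2 : ℝ) ≤ M := by exact_mod_cast h
            nlinarith
        nlinarith
      push_cast
      rw [show (M : ℝ) + 1 + 1 = M + 2 by ring]
      linarith
  refine (key M).trans ?_
  have : 0 ≤ (Real.log ((M : ℝ) + 1) + Real.log 4) / ((M : ℝ) + 1) := by
    have h1 : 0 ≤ Real.log ((M : ℝ) + 1) := Real.log_nonneg (by linarith [(Nat.cast_nonneg M : (0:ℝ) ≤ M)])
    have h2 : 0 ≤ Real.log (4 : ℝ) := Real.log_nonneg (by norm_num)
    positivity
  linarith

lemma exists_eq_pow_of_vonMangoldt_ne_zero {n : ℕ} (h : vonMangoldt n ≠ 0) :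
    ∃ p j : ℕ, p.Prime ∧ n = p ^ (j + 1) := by
  rw [ArithmeticFunction.vonMangoldt_ne_zero_iff, isPrimePow_nat_iff] at h
  obtain ⟨p, k, hp, hk, rfl⟩ := h
  exact ⟨p, k - 1, hp, by rw [Nat.sub_add_cancel hk]⟩

lemma sum_vonMangoldt_div_not_prime_le {U : Finset ℕ} (hU : ∀ n ∈ U, ¬ n.Prime) :
    ∑ n ∈ U, vonMangoldt n / n ≤ Real.log 4 := by
  obtain ⟨J, hJ⟩ : ∃ J, ∀ n ∈ U, n < J :=
    ⟨U.sup id + 1, fun n hn => Nat.lt_succ_of_le (Finset.le_sup (f := id) hn)⟩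
  have h1 := sum_vonMangoldt_div_primePow_le (S := (Finset.range J).filter Nat.Prime) (U := U) (r := 2)
    (fun p hp => (Finset.mem_filter.mp hp).2) ?_ two_ne_zero
  · refine h1.trans (le_trans ?_ (sum_log_div_mul_pred_le J))
    have e := Finset.sum_image (s := Finset.range J) (g := fun i => i + 2)
      (f := fun n : ℕ => Real.log (n : ℝ) / ((n : ℝ) ^ (2 - 1) * ((n : ℝ) - 1)))
      (by intro a _ b _ h; simpa using h)
    refine le_trans (b := ∑ n ∈ (Finset.range J).image (fun i : ℕ => (i + 2 : ℕ)),
      Real.log (n : ℝ) / ((n : ℝ) ^ (2 - 1) * ((n : ℝ) - 1))) ?_ (le_of_eq (e.trans ?_))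
    · refine Finset.sum_le_sum_of_subset_of_nonneg ?_ ?_
      · intro p hp
        rw [Finset.mem_filter, Finset.mem_range] at hp
        have := hp.2.two_le
        exact Finset.mem_image.mpr ⟨p - 2, Finset.mem_range.mpr (by omega), by omega⟩
      · intro n hn _
        obtain ⟨i, _, rfl⟩ := Finset.mem_image.mp hn
        have : (0 : ℝ) ≤ ((i + 2 : ℕ) : ℝ) - 1 := by push_cast; linarith [(Nat.cast_nonneg i : (0:ℝ) ≤ i)]
        have := Real.log_natCast_nonneg (i + 2)
        positivity
    · refine Finset.sum_congr rfl fun i _ => ?_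
      push_cast
      ring_nf
  · intro n hn h
    obtain ⟨p, j, hp, rfl⟩ := exists_eq_pow_of_vonMangoldt_ne_zero h
    have hj : j ≠ 0 := by rintro rfl; exact hU _ hn (by simpa using hp)
    refine ⟨p, Finset.mem_filter.mpr ⟨Finset.mem_range.mpr ?_, hp⟩, j - 1, by congr 1; omega⟩
    exact (Nat.le_self_pow (by omega) p).trans_lt (hJ _ hn)

lemma sum_vonMangoldt_div_not_coprime_le {m : ℕ} (hm : m ≠ 0) {U : Finset ℕ}
    (hU : ∀ n ∈ U, ¬ n.Coprime m) :
    ∑ n ∈ U, vonMangoldt n / n ≤ Real.log (2 * m) / 2 := by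
  have h1 := sum_vonMangoldt_div_primePow_le (S := m.primeFactors) (U := U) (r := 1)
    (fun p hp => Nat.prime_of_mem_primeFactors hp) ?_ one_ne_zero
  · refine h1.trans ?_
    have h2 : ∀ p ∈ m.primeFactors, Real.log p / ((p : ℝ) ^ (1 - 1) * ((p : ℝ) - 1)) ≤
        (if p = 2 then Real.log 2 / 2 else 0) + Real.log p / 2 := by
      intro p hp
      have hp' := Nat.prime_of_mem_primeFactors hp
      have hl : 0 ≤ Real.log (p : ℝ) := Real.log_natCast_nonneg p
      split_ifs with h
      · subst h; norm_num
      · have h3 : (3 : ℝ) ≤ p := by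
          have := hp'.two_le
          have : 3 ≤ p := by omega
          exact_mod_cast this
        simp only [Nat.sub_self, pow_zero, one_mul, zero_add]
        apply div_le_div_of_nonneg_left hl (by norm_num) (by linarith)
    refine (Finset.sum_le_sum h2).trans ?_
    rw [Finset.sum_add_distrib, ← Finset.sum_div, ← Real.log_prod
      (fun p hp => by have := (Nat.prime_of_mem_primeFactors hp).pos; positivity),
      Finset.sum_ite_eq', ← Nat.cast_prod]
    have h4 : Real.log ((∏ p ∈ m.primeFactors, p : ℕ) : ℝ) ≤ Real.log m := by
      refine Real.log_le_log ?_ ?_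
      · exact_mod_cast Finset.prod_pos fun p hp => (Nat.prime_of_mem_primeFactors hp).pos
      · exact_mod_cast Nat.le_of_dvd (Nat.pos_of_ne_zero hm) (Nat.prod_primeFactors_dvd m)
    have h5 : (if 2 ∈ m.primeFactors then Real.log 2 / 2 else 0) ≤ Real.log 2 / 2 := by
      have := Real.log_pos one_lt_two
      split_ifs <;> linarith
    rw [Real.log_mul two_ne_zero (by exact_mod_cast hm)]
    linarith
  · intro n hn h
    obtain ⟨p, j, hp, rfl⟩ := exists_eq_pow_of_vonMangoldt_ne_zero h
    refine ⟨p, ?_, j, rfl⟩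
    have := hU _ hn
    rw [Nat.coprime_pow_left_iff (by omega), hp.coprime_iff_not_dvd, not_not] at this
    exact Nat.mem_primeFactors.mpr ⟨hp, this, hm⟩

/-- The Fourier coefficients of a set of reduced residues. -/
def residueCoeff {m : ℕ} (A : Finset ℕ) (χ : DirichletCharacter ℂ m) : ℂ :=
  ∑ a ∈ A, χ ((a : ZMod m)⁻¹)

lemma natCast_eq_iff_mod_eq {m : ℕ} {A : Finset ℕ} (hA : ∀ a ∈ A, a < m ∧ Nat.Coprime a m) {a : ℕ} (ha : a ∈ A) (n : ℕ) : (a : ZMod m) = n ↔ a = n % m := by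
  rw [ZMod.natCast_eq_natCast_iff', Nat.mod_eq_of_lt (hA a ha).1]

lemma sum_residueCoeff_mul {m : ℕ} [NeZero m] {A : Finset ℕ} (hA : ∀ a ∈ A, a < m ∧ Nat.Coprime a m)
    (n : ℕ) :
    ∑ χ : DirichletCharacter ℂ m, residueCoeff A χ * χ n =
      if n % m ∈ A then (m.totient : ℂ) else 0 := by
  simp only [residueCoeff, Finset.sum_mul]
  rw [Finset.sum_comm]
  have h : ∀ a ∈ A, ∑ χ : DirichletCharacter ℂ m, χ ((a : ZMod m)⁻¹) * χ n =
      if a = n % m then (m.totient : ℂ) else 0 := by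
    intro a ha
    rw [DirichletCharacter.sum_char_inv_mul_char_eq ℂ ((ZMod.isUnit_iff_coprime a m).mpr (hA a ha).2)]
    simp only [natCast_eq_iff_mod_eq hA ha]
  rw [Finset.sum_congr rfl h, Finset.sum_ite_eq']

lemma residueCoeff_one {m : ℕ} {A : Finset ℕ} (hA : ∀ a ∈ A, a < m ∧ Nat.Coprime a m) :
    residueCoeff A (1 : DirichletCharacter ℂ m) = A.card := by
  rw [residueCoeff, Finset.sum_congr rfl fun a ha => ?_, Finset.sum_const, nsmul_one]
  have hu : IsUnit (a : ZMod m) := (ZMod.isUnit_iff_coprime a m).mpr (hA a ha).2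
  rw [MulChar.one_apply]
  obtain ⟨u, hu⟩ := hu
  rw [← hu, ZMod.inv_coe_unit]
  exact u⁻¹.isUnit

lemma sum_norm_sq_residueCoeff {m : ℕ} [NeZero m] {A : Finset ℕ} (hA : ∀ a ∈ A, a < m ∧ Nat.Coprime a m) :
    ∑ χ : DirichletCharacter ℂ m, ‖residueCoeff A χ‖ ^ 2 = m.totient * A.card := by
  have h1 : ∀ χ : DirichletCharacter ℂ m, ((‖residueCoeff A χ‖ ^ 2 : ℝ) : ℂ) =
      ∑ a ∈ A, residueCoeff A χ * χ a := by
    intro χ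
    rw [← Finset.mul_sum]
    push_cast
    rw [← Complex.mul_conj']
    congr 1
    rw [residueCoeff, map_sum]
    refine Finset.sum_congr rfl fun a ha => ?_
    have hu : IsUnit (a : ZMod m) := (ZMod.isUnit_iff_coprime a m).mpr (hA a ha).2
    obtain ⟨u, hu⟩ := hu
    rw [← hu, ZMod.inv_coe_unit, ← Complex.inv_eq_conj (χ.unit_norm_eq_one _),
      inv_eq_of_mul_eq_one_right]
    rw [← map_mul, Units.inv_mul, map_one]
  have h2 : ((∑ χ : DirichletCharacter ℂ m, ‖residueCoeff A χ‖ ^ 2 : ℝ) : ℂ) = m.totient * A.card := by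
    rw [Complex.ofReal_sum, Finset.sum_congr rfl fun χ _ => h1 χ, Finset.sum_comm,
      Finset.sum_congr rfl fun a ha => ?_, Finset.sum_const, nsmul_eq_mul, mul_comm]
    rw [sum_residueCoeff_mul hA, Nat.mod_eq_of_lt (hA a ha).1, if_pos ha]
  exact_mod_cast h2

lemma le_tsum_residues {m : ℕ} [NeZero m] {A : Finset ℕ} (hA : ∀ a ∈ A, a < m ∧ Nat.Coprime a m)
    {f : ℕ → ℝ} (hf : Summable f) (hf0 : ∀ n, 0 ≤ f n) {S : ℝ} (hS0 : 0 ≤ S)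
    (hS : ∀ χ : DirichletCharacter ℂ m, χ ≠ 1 → ‖∑' n : ℕ, χ n * (f n : ℂ)‖ ≤ S)
    (hcard : (m.totient : ℝ) ≤ 2 * A.card) :
    (A.card : ℝ) * ((∑' n : ℕ, if n.Coprime m then f n else 0) - √(m.totient - 1) * S) ≤
      m.totient * ∑' n : ℕ, if n % m ∈ A then f n else 0 := by
  have hsum : ∀ χ : DirichletCharacter ℂ m, Summable fun n : ℕ => χ n * (f n : ℂ) := by
    intro χ
    refine Summable.of_norm_bounded hf fun n => ?_
    rw [norm_mul, Complex.norm_real, Real.norm_of_nonneg (hf0 n)]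
    exact mul_le_of_le_one_left (hf0 n) (χ.norm_le_one _)
  have e1 : ((m.totient * ∑' n : ℕ, if n % m ∈ A then f n else 0 : ℝ) : ℂ) =
      ∑ χ : DirichletCharacter ℂ m, residueCoeff A χ * ∑' n : ℕ, χ n * (f n : ℂ) := by
    simp_rw [← tsum_mul_left]
    rw [← Summable.tsum_finsetSum fun χ _ => (hsum χ).mul_left _]
    rw [Complex.ofReal_tsum]
    refine tsum_congr fun n => ?_
    simp_rw [← mul_assoc]
    rw [← Finset.sum_mul, sum_residueCoeff_mul hA]
    split_ifs <;> simp
  have e2 : ∑' n : ℕ, (1 : DirichletCharacter ℂ m) n * (f n : ℂ) =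
      ((∑' n : ℕ, if n.Coprime m then f n else 0 : ℝ) : ℂ) := by
    rw [Complex.ofReal_tsum]
    refine tsum_congr fun n => ?_
    by_cases h : n.Coprime m
    · rw [if_pos h, MulChar.one_apply ((ZMod.isUnit_iff_coprime n m).mpr h), one_mul]
    · rw [if_neg h, MulChar.map_nonunit _ fun h' => h ((ZMod.isUnit_iff_coprime n m).mp h')]
      simp
  rw [← Finset.add_sum_erase _ _ (Finset.mem_univ (1 : DirichletCharacter ℂ m)), e2,
    residueCoeff_one hA] at e1
  have hφ : (1 : ℝ) ≤ m.totient := by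
    exact_mod_cast Nat.totient_pos.mpr (Nat.pos_of_ne_zero (NeZero.ne m))
  have hnorm : ‖∑ χ ∈ Finset.univ.erase (1 : DirichletCharacter ℂ m),
      residueCoeff A χ * ∑' n : ℕ, χ n * (f n : ℂ)‖ ≤ A.card * (√(m.totient - 1) * S) := by
    calc _ ≤ ∑ χ ∈ Finset.univ.erase (1 : DirichletCharacter ℂ m), ‖residueCoeff A χ‖ * S := by
          refine norm_sum_le_of_le _ fun χ hχ => ?_
          rw [norm_mul]
          exact mul_le_mul_of_nonneg_left (hS χ (Finset.ne_of_mem_erase hχ)) (norm_nonneg _)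
      _ = (∑ χ ∈ Finset.univ.erase (1 : DirichletCharacter ℂ m), ‖residueCoeff A χ‖) * S := by
          rw [Finset.sum_mul]
      _ ≤ (√(m.totient - 1) * A.card) * S := by
          refine mul_le_mul_of_nonneg_right ?_ hS0
          have h1 := sq_sum_le_card_mul_sum_sq (s := Finset.univ.erase (1 : DirichletCharacter ℂ m))
            (f := fun χ => ‖residueCoeff A χ‖)
          have h2 := sum_norm_sq_residueCoeff hA
          rw [← Finset.add_sum_erase _ _ (Finset.mem_univ (1 : DirichletCharacter ℂ m)),
            residueCoeff_one hA, Complex.norm_natCast] at h2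
          have h3 : ((Finset.univ.erase (1 : DirichletCharacter ℂ m)).card : ℝ) = m.totient - 1 := by
            rw [Finset.card_erase_of_mem (Finset.mem_univ _), Finset.card_univ,
              ← Nat.card_eq_fintype_card,
              DirichletCharacter.card_eq_totient_of_hasEnoughRootsOfUnity ℂ m, Nat.cast_sub
              (by exact_mod_cast hφ), Nat.cast_one]
          rw [h3] at h1
          refine abs_le_of_sq_le_sq' ?_ (by positivity) |>.2
          rw [mul_pow, Real.sq_sqrt (by linarith)]
          refine h1.trans (mul_le_mul_of_nonneg_left ?_ (by linarith))
          nlinarith [(Nat.cast_nonneg A.card : (0 : ℝ) ≤ A.card)]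
      _ = _ := by ring
  have hre := congrArg Complex.re e1
  rw [Complex.add_re, Complex.ofReal_re, ← Complex.ofReal_natCast, ← Complex.ofReal_mul,
    Complex.ofReal_re] at hre
  have := (abs_le.mp ((Complex.abs_re_le_norm _).trans hnorm)).1
  rw [hre, mul_sub]
  linarith

/-- The part of `log n!` coming from the primes in the residue classes `A` modulo `m`. -/
def logFactorialPart (m : ℕ) (A : Finset ℕ) (n : ℕ) : ℝ :=
  ∑ p ∈ (Finset.range (n + 1)).filter fun p => p.Prime ∧ p % m ∈ A,
    ((n !).factorization p : ℝ) * Real.log p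

lemma logFactorialPart_nonneg (m : ℕ) (A : Finset ℕ) (n : ℕ) : 0 ≤ logFactorialPart m A n :=
  Finset.sum_nonneg fun p _ => mul_nonneg (Nat.cast_nonneg _) (Real.log_natCast_nonneg p)

lemma div_le_factorization_factorial {p : ℕ} (hp : p.Prime) (n : ℕ) :
    n / p ≤ (n !).factorization p := by
  rw [Nat.factorization_factorial hp (Nat.lt_succ_of_le (Nat.le_succ (Nat.log p n)))]
  have : n / p = ∑ i ∈ Finset.Ico 1 2, n / p ^ i := by simp
  rw [this]
  exact Finset.sum_le_sum_of_subset (Finset.Ico_subset_Ico le_rfl (by omega))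

lemma mul_tsum_residues_le {m : ℕ} (A : Finset ℕ) {N n : ℕ} (hn : 1 ≤ n) {δ : ℝ} (hδ : 0 < δ) :
    n * (∑' k : ℕ, if k % m ∈ A then vonMangoldt k / k * gammaWeight N δ (Real.log k) else 0) ≤
      logFactorialPart m A n + n * (Real.log 4 * (2 + gammaTailInt N (δ * Real.log n) / δ)) := by
  have hn' : (0 : ℝ) < n := by exact_mod_cast hn
  have hlog : ∀ i : ℕ, (0 : ℝ) ≤ Real.log (i + 1) := fun i =>
    Real.log_nonneg (by linarith [(Nat.cast_nonneg i : (0:ℝ) ≤ i)])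
  set f : ℕ → ℝ := fun k => vonMangoldt k / k * gammaWeight N δ (Real.log k) with hf
  have hw0 : ∀ k : ℕ, 0 ≤ gammaWeight N δ (Real.log k) := fun k =>
    gammaWeight_nonneg N hδ (Real.log_natCast_nonneg k)
  have hw1 : ∀ k : ℕ, gammaWeight N δ (Real.log k) ≤ 1 := fun k =>
    gammaWeight_le_one N hδ (Real.log_natCast_nonneg k)
  have hf0 : ∀ k, 0 ≤ f k := fun k =>
    mul_nonneg (div_nonneg ArithmeticFunction.vonMangoldt_nonneg (Nat.cast_nonneg _)) (hw0 k)
  set g : ℕ → ℝ := fun i => gammaWeight N δ (Real.log (i + 1)) *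
    min (1 / (n : ℝ)) (1 / ((i : ℝ) + 1)) with hg
  have hg0 : ∀ i, 0 ≤ g i := fun i =>
    mul_nonneg (gammaWeight_nonneg N hδ (hlog i)) (le_min (by positivity) (by positivity))
  have hganti : Antitone g := by
    intro i j hij
    refine mul_le_mul (antitone_gammaWeight_log N hδ hij) ?_ (le_min (by positivity) (by positivity))
      (gammaWeight_nonneg N hδ (hlog i))
    have : (i : ℝ) ≤ j := by exact_mod_cast hij
    exact min_le_min_left _ (one_div_le_one_div_of_le (by positivity) (by linarith))
  rw [← le_div_iff₀' hn']
  refine Real.tsum_le_of_sum_range_le (fun k => by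
    split_ifs
    exacts [hf0 k, le_rfl]) fun M => ?_
  rw [le_div_iff₀' hn']
  have hsplit : ∀ k ∈ Finset.range M, (if k % m ∈ A then f k else 0) ≤
      (if k.Prime ∧ k % m ∈ A then f k else 0) + (if ¬ k.Prime then vonMangoldt k / k else 0) := by
    intro k _
    have h1 : f k ≤ vonMangoldt k / k :=
      mul_le_of_le_one_right (div_nonneg ArithmeticFunction.vonMangoldt_nonneg (Nat.cast_nonneg _)) (hw1 k)
    have h2 := hf0 k
    have h3 := h2.trans h1
    by_cases hA : k % m ∈ A <;> by_cases hp : k.Prime <;> simp only [hA, hp, and_true, and_false,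
      if_true, if_false, not_true, not_false_eq_true] <;> linarith
  have h1 := Finset.sum_le_sum hsplit
  rw [Finset.sum_add_distrib, ← Finset.sum_filter (fun k : ℕ => ¬ k.Prime)] at h1
  have h2 := sum_vonMangoldt_div_not_prime_le (U := (Finset.range M).filter fun k => ¬ k.Prime)
    fun k hk => (Finset.mem_filter.mp hk).2
  have h3 : n * ∑ k ∈ Finset.range M, (if k.Prime ∧ k % m ∈ A then f k else 0) ≤
      logFactorialPart m A n + n * (Real.log 4 * (1 + gammaTailInt N (δ * Real.log n) / δ)) := by
    have h4 : ∀ k ∈ Finset.range (M + n + 1), (n : ℝ) * (if k.Prime ∧ k % m ∈ A then f k else 0) ≤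
        (if k < n + 1 then (if k.Prime ∧ k % m ∈ A then ((n !).factorization k : ℝ) * Real.log k else 0) else 0)
         + n * ((if k.Prime then Real.log k else 0) * g (k - 1)) := by
      intro k _
      by_cases hk : k.Prime ∧ k % m ∈ A
      · have hk0 : (0 : ℝ) < k := by exact_mod_cast hk.1.pos
        have hl : 0 ≤ Real.log (k : ℝ) := Real.log_natCast_nonneg k
        have hgk : g (k - 1) = gammaWeight N δ (Real.log k) * min (1 / (n : ℝ)) (1 / (k : ℝ)) := by
          simp only [hg]
          rw [Nat.cast_sub hk.1.pos]
          simp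
        rw [if_pos hk, if_pos hk, if_pos hk.1, hgk, hf]
        simp only
        rw [ArithmeticFunction.vonMangoldt_apply_prime hk.1]
        by_cases hkn : k < n + 1
        · have hle : (k : ℝ) ≤ n := by exact_mod_cast Nat.lt_succ_iff.mp hkn
          rw [if_pos hkn, min_eq_left (one_div_le_one_div_of_le hk0 hle)]
          have h5 : (n : ℝ) / k ≤ (n !).factorization k + 1 := by
            have h6 : (n : ℝ) / k < ((n / k : ℕ) : ℝ) + 1 := by
              rw [div_lt_iff₀ hk0]
              have := Nat.lt_div_mul_add (a := n) hk.1.pos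
              have h7 : (n : ℝ) < ((n / k * k + k : ℕ) : ℝ) := by exact_mod_cast this
              push_cast at h7
              linarith
            have h7 : ((n / k : ℕ) : ℝ) ≤ (n !).factorization k := by
              exact_mod_cast div_le_factorization_factorial hk.1 n
            linarith
          set w := gammaWeight N δ (Real.log k)
          have hw0' : 0 ≤ w := hw0 k
          have hw1' : w ≤ 1 := hw1 k
          calc (n : ℝ) * (Real.log k / k * w) = ((n : ℝ) / k) * (Real.log k * w) := by ring
            _ ≤ ((n !).factorization k + 1) * (Real.log k * w) := by gcongr
            _ = (n !).factorization k * Real.log k * w + Real.log k * w := by ring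
            _ ≤ (n !).factorization k * Real.log k * 1 + Real.log k * w := by gcongr
            _ = _ := by field_simp
        · have hle : (n : ℝ) ≤ k := by
            have : n ≤ k := by omega
            exact_mod_cast this
          rw [if_neg hkn, min_eq_right (one_div_le_one_div_of_le hn' hle)]
          exact le_of_eq (by ring)
      · rw [if_neg hk, if_neg hk]
        have : 0 ≤ (if k.Prime then Real.log (k : ℝ) else 0) * g (k - 1) :=
          mul_nonneg (by split_ifs; exacts [Real.log_natCast_nonneg k, le_rfl]) (hg0 _)
        simp only [mul_zero, ite_self, zero_add]
        positivity
    have h5 := Finset.sum_le_sum h4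
    rw [Finset.sum_add_distrib, ← Finset.mul_sum, ← Finset.mul_sum] at h5
    have h6 : ∑ k ∈ Finset.range (M + n + 1), (if k < n + 1 then
        (if k.Prime ∧ k % m ∈ A then ((n !).factorization k : ℝ) * Real.log k else 0) else 0) =
        logFactorialPart m A n := by
      rw [logFactorialPart, Finset.sum_filter, ← Finset.sum_filter]
      refine Finset.sum_congr ?_ fun _ _ => rfl
      ext k
      simp only [Finset.mem_filter, Finset.mem_range]
      omega
    have h7 : ∑ k ∈ Finset.range (M + n + 1), (if k.Prime then Real.log k else 0) * g (k - 1) ≤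
        Real.log 4 * (1 + gammaTailInt N (δ * Real.log n) / δ) := by
      rw [Finset.sum_range_succ']
      simp only [Nat.not_prime_zero, if_false, zero_mul, add_zero, Nat.add_sub_cancel]
      exact (sum_log_prime_mul_le hganti hg0 (M + n)).trans (mul_le_mul_of_nonneg_left
        (sum_gammaWeight_mul_min_le hn hδ (M + n)) (Real.log_nonneg (by norm_num)))
    have h8 : ∑ k ∈ Finset.range M, (if k.Prime ∧ k % m ∈ A then f k else 0) ≤
        ∑ k ∈ Finset.range (M + n + 1), (if k.Prime ∧ k % m ∈ A then f k else 0) :=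
      Finset.sum_le_sum_of_subset_of_nonneg (Finset.range_mono (by omega))
        fun k _ _ => by
          split_ifs
          exacts [hf0 k, le_rfl]
    have h9 := mul_le_mul_of_nonneg_left h8 hn'.le
    have h10 := mul_le_mul_of_nonneg_left h7 hn'.le
    linarith
  have h11 := mul_le_mul_of_nonneg_left (h1.trans (add_le_add_right h2 _)) hn'.le
  rw [mul_add] at h11
  nlinarith

/-- Lower bound for the part of `log n!` from primes in residue classes, given a bound `S` for the
smoothed nonprincipal character sums. -/
lemma le_logFactorialPart {m : ℕ} [NeZero m] {A : Finset ℕ} (hA : ∀ a ∈ A, a < m ∧ Nat.Coprime a m)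
    (hcard : (m.totient : ℝ) ≤ 2 * A.card) {N n : ℕ} (hn : 1 ≤ n) {δ S : ℝ} (hδ : 0 < δ) (hS0 : 0 ≤ S)
    (hS : ∀ χ : DirichletCharacter ℂ m, χ ≠ 1 →
      ‖∑' n : ℕ, χ n * ((vonMangoldt n / n * gammaWeight N δ (Real.log n) : ℝ) : ℂ)‖ ≤ S) :
    n * (A.card * (N / δ - 1 - Real.log (2 * m) / 2 - √(m.totient - 1) * S)) ≤
      m.totient * (logFactorialPart m A n +
        n * (Real.log 4 * (2 + gammaTailInt N (δ * Real.log n) / δ))) := by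
  set f : ℕ → ℝ := fun k => vonMangoldt k / k * gammaWeight N δ (Real.log k) with hf
  have hfs : Summable f := summable_vonMangoldt_gammaWeight hδ N
  have hw0 : ∀ k : ℕ, 0 ≤ gammaWeight N δ (Real.log k) := fun k =>
    gammaWeight_nonneg N hδ (Real.log_natCast_nonneg k)
  have hΛ : ∀ k : ℕ, 0 ≤ vonMangoldt k / (k : ℝ) := fun k =>
    div_nonneg ArithmeticFunction.vonMangoldt_nonneg (Nat.cast_nonneg _)
  have hf0 : ∀ k, 0 ≤ f k := fun k => mul_nonneg (hΛ k) (hw0 k)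
  have h1 := le_tsum_residues hA hfs hf0 hS0 hS hcard
  have h2 := le_tsum_vonMangoldt_gammaWeight N hδ
  have h3 := mul_tsum_residues_le (m := m) A (N := N) hn hδ
  have hc : Summable fun k : ℕ => if k.Coprime m then f k else 0 :=
    Summable.of_nonneg_of_le (fun k => by split_ifs; exacts [hf0 k, le_rfl])
      (fun k => by split_ifs; exacts [le_rfl, hf0 k]) hfs
  have h4 : ∑' k : ℕ, f k - ∑' k : ℕ, (if k.Coprime m then f k else 0) ≤ Real.log (2 * m) / 2 := by
    rw [← hfs.tsum_sub hc]
    refine Real.tsum_le_of_sum_range_le (fun k => ?_) fun M => ?_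
    · split_ifs
      exacts [(sub_self _).ge, by simpa using hf0 k]
    refine le_trans ?_ (sum_vonMangoldt_div_not_coprime_le (NeZero.ne m)
      (U := (Finset.range M).filter fun k => ¬ k.Coprime m) fun k hk => (Finset.mem_filter.mp hk).2)
    rw [Finset.sum_filter]
    refine Finset.sum_le_sum fun k _ => ?_
    by_cases hk : k.Coprime m
    · rw [if_pos hk, if_neg (not_not.mpr hk), sub_self]
    · rw [if_neg hk, if_pos hk, sub_zero]
      exact mul_le_of_le_one_right (hΛ k) (gammaWeight_le_one N hδ (Real.log_natCast_nonneg k))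
  have hn' : (0 : ℝ) ≤ n := Nat.cast_nonneg n
  have h5 : (A.card : ℝ) * (N / δ - 1 - Real.log (2 * m) / 2 - √(m.totient - 1) * S) ≤
      m.totient * ∑' k : ℕ, if k % m ∈ A then f k else 0 := by
    refine le_trans (mul_le_mul_of_nonneg_left ?_ (Nat.cast_nonneg _)) h1
    linarith
  calc _ ≤ n * (m.totient * ∑' k : ℕ, if k % m ∈ A then f k else 0) :=
        mul_le_mul_of_nonneg_left h5 hn'
    _ = m.totient * (n * ∑' k : ℕ, if k % m ∈ A then f k else 0) := by ring
    _ ≤ _ := mul_le_mul_of_nonneg_left h3 (Nat.cast_nonneg _)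

lemma pow_ratio_le_exp {T δ : ℝ} {N : ℕ} (hT : 0 < T) (hN : T ^ 2 ≤ N) (hδ : δ = N / T) :
    (δ / (δ + 1 / 2)) ^ N ≤ Real.exp (-(T / 2 - 1 / 8)) := by
  have hN0 : (0 : ℝ) < N := lt_of_lt_of_le (by positivity) hN
  have hδ0 : 0 < δ := by rw [hδ]; positivity
  have h1 := Real.le_log_one_add_of_nonneg (x := 1 / (2 * δ)) (by positivity)
  have h2 : δ / (δ + 1 / 2) = (1 + 1 / (2 * δ))⁻¹ := by field_simp
  rw [h2, ← Real.exp_log (show (0 : ℝ) < 1 + 1 / (2 * δ) by positivity), ← Real.exp_neg,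
    ← Real.exp_nat_mul, Real.exp_le_exp]
  have h3 : 2 * (1 / (2 * δ)) / (1 / (2 * δ) + 2) = 2 / (4 * δ + 1) := by field_simp; ring
  rw [h3] at h1
  have h4 : T / 2 - 1 / 8 ≤ N * (2 / (4 * δ + 1)) := by
    rw [← mul_div_assoc, le_div_iff₀ (by positivity)]
    have h5 : (N : ℝ) = δ * T := by rw [hδ]; field_simp
    have h6 : T ≤ δ := by rw [hδ, le_div_iff₀ hT]; nlinarith
    rw [h5]
    nlinarith
  nlinarith

lemma weight_poly_le {T δ : ℝ} {N : ℕ} (hT : 16 ≤ T) (hN : (N : ℝ) ≤ T ^ 2 + 1) (hδ : δ = N / T) :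
    8 * δ + 4 * (N + 1) ≤ 4 * T ^ 2 + 8 * T + 9 := by
  have h1 : δ ≤ T + 1 / 16 := by
    rw [hδ, div_le_iff₀ (by linarith)]
    nlinarith
  linarith

lemma log_ratio_le_of_one {T δ : ℝ} {N : ℕ} (hT : 17.297 ≤ T) (hN : T ^ 2 ≤ N)
    (hN' : (N : ℝ) ≤ T ^ 2 + 1) (hδ : δ = N / T) :
    Real.log ((1 + δ) / √(δ + 3 / 4) * (2 * √1 - 1) * 1.0001) ≤
      1.4625 + 0.027 * (T - 17.297) := by
  have h1 : δ ≤ T + 1 / 16 := by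
    rw [hδ, div_le_iff₀ (by linarith)]
    nlinarith
  have h2 : T ≤ δ := by rw [hδ, le_div_iff₀ (by linarith)]; nlinarith
  have hs : 0 < √(δ + 3 / 4) := Real.sqrt_pos.mpr (by linarith)
  have hs2 := Real.sq_sqrt (show 0 ≤ δ + 3 / 4 by linarith)
  have h3 : (1 + δ) / √(δ + 3 / 4) ≤ 4.315 * (1 + 0.027 * (T - 17.297)) := by
    have hx : 0 ≤ T - 17.297 := by linarith
    rw [div_le_iff₀ hs]
    refine abs_le_of_sq_le_sq' ?_ (by positivity) |>.2
    rw [mul_pow, hs2]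
    have h4 : (1 + δ) ^ 2 ≤ (δ + 1.2535) * (δ + 3 / 4) := by nlinarith
    refine h4.trans (mul_le_mul_of_nonneg_right ?_ (by linarith))
    nlinarith [mul_nonneg hx hx]
  have h0 : 0 < (1 + δ) / √(δ + 3 / 4) := div_pos (by linarith) hs
  have hx : 0 ≤ T - 17.297 := by linarith
  rw [Real.sqrt_one, Real.log_le_iff_le_exp (by norm_num [h0])]
  have h5 : (4.3155 : ℝ) ≤ Real.exp 1.4624 := by
    rw [show (1.4624 : ℝ) = 1 + 0.4624 by norm_num, Real.exp_add]
    have := Real.sum_le_exp_of_nonneg (show (0 : ℝ) ≤ 0.4624 by norm_num) 6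
    norm_num [Finset.sum_range_succ, Nat.factorial] at this
    nlinarith [Real.exp_one_gt_d9]
  calc (1 + δ) / √(δ + 3 / 4) * (2 * 1 - 1) * 1.0001
      ≤ 4.315 * (1 + 0.027 * (T - 17.297)) * (2 * 1 - 1) * 1.0001 := by gcongr
    _ ≤ 4.3155 * (0.027 * (T - 17.297) + 1) := by nlinarith
    _ ≤ Real.exp 1.4624 * Real.exp (0.027 * (T - 17.297)) := by
      gcongr
      exact Real.add_one_le_exp _
    _ = Real.exp (1.4624 + 0.027 * (T - 17.297)) := by rw [← Real.exp_add]
    _ ≤ _ := Real.exp_le_exp.mpr (by linarith)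

lemma remainder_le_of_one {T δ : ℝ} {N : ℕ} (hT : 17.297 ≤ T) (hN : T ^ 2 ≤ N)
    (hN' : (N : ℝ) ≤ T ^ 2 + 1) (hδ : δ = N / T) :
    Real.log ((1 + δ) / √(δ + 3 / 4) * (2 * √1 - 1) * 1.0001) *
      ((δ / (δ + 1 / 2)) ^ N * (8 * δ + 4 * (N + 1))) ≤ 0.4 := by
  have h1 := log_ratio_le_of_one hT hN hN' hδ
  have h2 := pow_ratio_le_exp (by linarith) hN hδ
  have h3 := weight_poly_le (by linarith) hN' hδ
  have hδ0 : 0 ≤ δ := by rw [hδ]; positivity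
  obtain ⟨x, rfl⟩ : ∃ x, T = 17.297 + x := ⟨T - 17.297, by ring⟩
  have hx : 0 ≤ x := by linarith
  have h4 : Real.exp (-((17.297 + x) / 2 - 1 / 8)) ≤ 1 / (5029 * (1 + x / 2 + (x / 2) ^ 2 / 2 + (x / 2) ^ 3 / 6)) := by
    rw [show -((17.297 + x) / 2 - 1 / 8) = -(8.5235 + x / 2) by ring, Real.exp_neg, ← one_div]
    refine one_div_le_one_div_of_le (by positivity) ?_
    rw [Real.exp_add]
    have h5 : (5029 : ℝ) ≤ Real.exp 8.5235 := by
      rw [show (8.5235 : ℝ) = (8 : ℕ) * 1 + 0.5235 by norm_num, Real.exp_add, Real.exp_nat_mul]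
      have h7 : (2.7182818 : ℝ) ^ 8 ≤ Real.exp 1 ^ 8 :=
        pow_le_pow_left₀ (by norm_num) (by linarith [Real.exp_one_gt_d9]) 8
      refine le_trans ?_ (mul_le_mul h7
        (Real.sum_le_exp_of_nonneg (show (0 : ℝ) ≤ 0.5235 by norm_num) 6)
        (by positivity) (by positivity))
      norm_num [Finset.sum_range_succ, Nat.factorial]
    refine mul_le_mul h5 (le_trans (le_of_eq ?_)
      (Real.sum_le_exp_of_nonneg (show (0 : ℝ) ≤ x / 2 by positivity) 4))
      (by positivity) (by positivity)
    norm_num [Finset.sum_range_succ, Nat.factorial]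
  have hq : 0 ≤ (δ / (δ + 1 / 2)) ^ N := by positivity
  refine (mul_le_mul_of_nonneg_right h1 (by positivity)).trans ?_
  refine (mul_le_mul_of_nonneg_left (mul_le_mul (h2.trans h4) h3 (by positivity) (by positivity))
    (by linarith)).trans ?_
  rw [one_div_mul_eq_div, ← mul_div_assoc, div_le_iff₀ (by positivity)]
  have hx2 := mul_nonneg hx hx
  have hx3 := mul_nonneg hx2 hx
  nlinarith

lemma remainder_le_of_large {T δ B : ℝ} {N : ℕ} (hT : 34.6 ≤ T) (hB : 1 ≤ B) (hBT : 8 * B ≤ T)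
    (hN : T ^ 2 ≤ N) (hN' : (N : ℝ) ≤ T ^ 2 + 1) (hδ : δ = N / T) :
    Real.log ((1 + δ) / √(δ + 3 / 4) * (2 * √B - 1) * 1.0001) *
      ((δ / (δ + 1 / 2)) ^ N * (8 * δ + 4 * (N + 1))) ≤ 0.007 := by
  have h2 := pow_ratio_le_exp (by linarith) hN hδ
  have h3 := weight_poly_le (by linarith) hN' hδ
  have h1 : δ ≤ T + 1 / 16 := by
    rw [hδ, div_le_iff₀ (by linarith)]
    nlinarith
  have hδT : T ≤ δ := by rw [hδ, le_div_iff₀ (by linarith)]; nlinarith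
  have hB1 : 1 ≤ √B := Real.one_le_sqrt.mpr hB
  have hBs : √B ≤ B := by nlinarith [Real.sq_sqrt (show 0 ≤ B by linarith)]
  have hs1 : 1 ≤ √(δ + 3 / 4) := Real.one_le_sqrt.mpr (by linarith)
  have hlog : Real.log ((1 + δ) / √(δ + 3 / 4) * (2 * √B - 1) * 1.0001) ≤ T := by
    have h0 : 0 < (1 + δ) / √(δ + 3 / 4) := div_pos (by linarith) (by linarith)
    have hb : 0 < 2 * √B - 1 := by linarith
    rw [Real.log_le_iff_le_exp (by positivity)]
    have h5 : (1 + δ) / √(δ + 3 / 4) ≤ 1 + δ := div_le_self (by linarith) hs1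
    have h6 := Real.quadratic_le_exp_of_nonneg (show 0 ≤ T by linarith)
    calc (1 + δ) / √(δ + 3 / 4) * (2 * √B - 1) * 1.0001 ≤ (1 + δ) * (T / 4 - 1) * 1.0001 := by
          gcongr <;> linarith
      _ ≤ (T + 17 / 16) * (T / 4 - 1) * 1.0001 := by
        refine mul_le_mul_of_nonneg_right (mul_le_mul_of_nonneg_right ?_ ?_) ?_ <;> linarith
      _ ≤ _ := by nlinarith
  obtain ⟨x, rfl⟩ : ∃ x, T = 34.6 + x := ⟨T - 34.6, by ring⟩
  have hx : 0 ≤ x := by linarith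
  have h4 : Real.exp (-((34.6 + x) / 2 - 1 / 8)) ≤
      1 / (28700000 * (1 + x / 2 + (x / 2) ^ 2 / 2 + (x / 2) ^ 3 / 6)) := by
    rw [show -((34.6 + x) / 2 - 1 / 8) = -(17.175 + x / 2) by ring, Real.exp_neg, ← one_div]
    refine one_div_le_one_div_of_le (by positivity) ?_
    rw [Real.exp_add]
    have h5 : (28700000 : ℝ) ≤ Real.exp 17.175 := by
      rw [show (17.175 : ℝ) = (17 : ℕ) * 1 + 0.175 by norm_num, Real.exp_add, Real.exp_nat_mul]
      have h7 : (2.7182818 : ℝ) ^ 17 ≤ Real.exp 1 ^ 17 :=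
        pow_le_pow_left₀ (by norm_num) (by linarith [Real.exp_one_gt_d9]) 17
      refine le_trans ?_ (mul_le_mul h7
        (Real.sum_le_exp_of_nonneg (show (0 : ℝ) ≤ 0.175 by norm_num) 4)
        (by positivity) (by positivity))
      norm_num [Finset.sum_range_succ, Nat.factorial]
    refine mul_le_mul h5 (le_trans (le_of_eq ?_)
      (Real.sum_le_exp_of_nonneg (show (0 : ℝ) ≤ x / 2 by positivity) 4))
      (by positivity) (by positivity)
    norm_num [Finset.sum_range_succ, Nat.factorial]
  have hδ0 : 0 ≤ δ := by linarith
  have hq : 0 ≤ (δ / (δ + 1 / 2)) ^ N := by positivity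
  refine (mul_le_mul_of_nonneg_right hlog (by positivity)).trans ?_
  refine (mul_le_mul_of_nonneg_left (mul_le_mul (h2.trans h4) h3 (by positivity) (by positivity))
    (by linarith)).trans ?_
  rw [one_div_mul_eq_div, ← mul_div_assoc, div_le_iff₀ (by positivity)]
  have hx2 := mul_nonneg hx hx
  have hx3 := mul_nonneg hx2 hx
  nlinarith

lemma exp_lower_bound {x c : ℝ} (hx : 0 ≤ x) (n : ℕ)
    (h : c ≤ ∑ i ∈ Finset.range n, x ^ i / (i ! : ℝ)) : c ≤ Real.exp x :=
  h.trans (Real.sum_le_exp_of_nonneg hx n)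

lemma log_three_half_ratio_le_of_one :
    Real.log ((1 + 1 / 2) / √(1 / 2 + 3 / 4) * (2 * √1 - 1) * 2.113) ≤ 1.0422 := by
  rw [Real.sqrt_one, Real.log_le_iff_le_exp (by positivity)]
  have h1 : (1 + 1 / 2) / √(1 / 2 + 3 / 4) ≤ (1.34165 : ℝ) := by
    rw [div_le_iff₀ (by positivity)]
    have : (1.11803 : ℝ) ≤ √(1 / 2 + 3 / 4) := Real.le_sqrt_of_sq_le (by norm_num)
    linarith
  have h2 : (2.83498 : ℝ) ≤ Real.exp 1.0422 := by
    refine exp_lower_bound (by norm_num) 10 ?_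
    norm_num [Finset.sum_range_succ, Nat.factorial]
  nlinarith

lemma log_three_half_ratio_le {B : ℝ} (hB : 1 ≤ B) :
    Real.log ((1 + 1 / 2) / √(1 / 2 + 3 / 4) * (2 * √B - 1) * 2.616) ≤
      1.2556 + Real.log (2 * √B - 1) := by
  have hb : 0 < 2 * √B - 1 := by linarith [Real.one_le_sqrt.mpr hB]
  rw [mul_right_comm, Real.log_mul (by positivity) hb.ne']
  have h1 : (1 + 1 / 2) / √(1 / 2 + 3 / 4) ≤ (1.34165 : ℝ) := by
    rw [div_le_iff₀ (by positivity)]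
    have : (1.11803 : ℝ) ≤ √(1 / 2 + 3 / 4) := Real.le_sqrt_of_sq_le (by norm_num)
    linarith
  have h2 : (3.50976 : ℝ) ≤ Real.exp 1.2556 := by
    refine exp_lower_bound (by norm_num) 11 ?_
    norm_num [Finset.sum_range_succ, Nat.factorial]
  gcongr
  rw [Real.log_le_iff_le_exp (by positivity)]
  nlinarith

lemma two_or_three_dvd_of_totient_eq_two {m : ℕ} (h : m.totient = 2) : 2 ∣ m ∨ 3 ∣ m := by
  by_contra! hc
  have h1 : m ≠ 0 := by rintro rfl; simp at h
  have h2 : m ≠ 1 := by rintro rfl; simp at h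
  obtain ⟨p, hp, hpm⟩ := Nat.exists_prime_and_dvd h2
  have h3 : p ≠ 2 := by rintro rfl; exact hc.1 hpm
  have h4 : p ≠ 3 := by rintro rfl; exact hc.2 hpm
  have h5 := Nat.le_of_dvd (by omega) (Nat.totient_dvd_of_dvd hpm)
  rw [Nat.totient_prime hp, h] at h5
  have := hp.two_le
  omega

lemma one_div_sqrt_two_pi_le : 1 / √(2 * Real.pi) ≤ 0.39895 := by
  rw [div_le_iff₀ (by positivity)]
  have : (2.50661 : ℝ) ≤ √(2 * Real.pi) :=
    Real.le_sqrt_of_sq_le (by nlinarith [Real.pi_gt_d6])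
  linarith

/-- A bound for the smoothed nonprincipal character sums, strong enough to keep the total loss in
the lower bound for `logFactorialPart` below `2 + φ(m) (log m + 6.55)`. -/
lemma exists_character_sum_bound {m : ℕ} [NeZero m] (hm : 3 ≤ m) (hG : GRH m) {T δ : ℝ} {N : ℕ}
    (hT : 2 + m.totient * (Real.log m + 6.55) ≤ T) (hN : T ^ 2 ≤ N)
    (hN' : (N : ℝ) ≤ T ^ 2 + 1) (hδ : δ = N / T) :
    ∃ S : ℝ, 0 ≤ S ∧
      (∀ χ : DirichletCharacter ℂ m, χ ≠ 1 →
        ‖∑' n : ℕ, χ n * ((vonMangoldt n / n * gammaWeight N δ (Real.log n) : ℝ) : ℂ)‖ ≤ S) ∧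
      1 + Real.log (2 * m) / 2 + √(m.totient - 1) * S + 2 * (Real.log 4 * (2 + 0.39895)) ≤
        2 + m.totient * (Real.log m + 6.55) := by
  have hm0 : (0 : ℝ) < m := by positivity
  have hm3 : (3 : ℝ) ≤ m := by exact_mod_cast hm
  have hlogm3 : 1.0986122885 < Real.log m :=
    Real.log_three_gt_d9.trans_le (Real.log_le_log (by norm_num) hm3)
  have hlog4 : Real.log 4 ≤ 1.3862944 := by
    rw [show (4 : ℝ) = 2 ^ 2 by norm_num, Real.log_pow]
    push_cast
    linarith [Real.log_two_lt_d9]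
  have hlog2m : Real.log (2 * m) ≤ 0.6931472 + Real.log m := by
    rw [Real.log_mul (by norm_num) hm0.ne']
    linarith [Real.log_two_lt_d9]
  obtain ⟨B, hB⟩ : ∃ B, m.totient = 2 * B := by
    obtain ⟨B, hB⟩ := Nat.totient_even (show 2 < m by omega)
    exact ⟨B, by omega⟩
  have hB1 : 1 ≤ B := by
    have := Nat.totient_pos.mpr (show 0 < m by omega)
    omega
  have hφ : (m.totient : ℝ) = 2 * B := by rw [hB]; push_cast; ring
  have hB1' : (1 : ℝ) ≤ B := by exact_mod_cast hB1
  rw [hφ] at hT ⊢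
  have hT17 : 17.297 ≤ T := by nlinarith
  have hδT : T ≤ δ := by rw [hδ, le_div_iff₀ (by linarith)]; nlinarith
  have hδ17 : 17 ≤ δ := by linarith
  rcases (show B = 1 ∨ 2 ≤ B by omega) with rfl | hB2
  · refine ⟨8 * 1.0422 + 0.4, by norm_num, fun χ hχ => ?_, ?_⟩
    · have hZ : ‖DirichletCharacter.LFunction χ ((3 / 2 : ℝ) : ℂ)‖⁻¹ ≤ 2.113 := by
        rcases two_or_three_dvd_of_totient_eq_two hB with h | h
        · exact norm_inv_LFunction_three_half_le_of_dvd χ (Or.inl rfl) h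
        · exact norm_inv_LFunction_three_half_le_of_dvd χ (Or.inr rfl) h
      have h1 := norm_tsum_twist_gammaWeight_le (by omega) hG hχ hB hδ17 hZ N
      have h2 := remainder_le_of_one hT17 hN hN' hδ
      have h3 := log_three_half_ratio_le_of_one
      rw [Nat.cast_one] at h1
      linarith
    · norm_num
      linarith
  have hB2' : (2 : ℝ) ≤ B := by exact_mod_cast hB2
  have hm5 : 5 ≤ m := by
    have := Nat.totient_lt m (by omega)
    omega
  have hlogm5 : 1.6094379123 < Real.log m :=
    Real.log_five_gt_d9.trans_le (Real.log_le_log (by norm_num) (by exact_mod_cast hm5))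
  have hT34 : 34.6 ≤ T := by nlinarith
  have hBT : 8 * (B : ℝ) ≤ T := by nlinarith
  set s : ℝ := √(B : ℝ) with hs
  have hsB : s ^ 2 = B := Real.sq_sqrt (by linarith)
  have hs1 : 1 ≤ s := Real.one_le_sqrt.mpr hB1'
  have hl0 : 0 ≤ Real.log (2 * s - 1) := Real.log_nonneg (by linarith)
  refine ⟨8 * (1.2556 + Real.log (2 * s - 1)) + 0.007, by positivity, fun χ hχ => ?_, ?_⟩
  · have h1 := norm_tsum_twist_gammaWeight_le (by omega) hG hχ hB hδ17
      (norm_inv_LFunction_three_half_le χ) N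
    have h2 := remainder_le_of_large hT34 hB1' hBT hN hN' hδ
    have h3 := log_three_half_ratio_le hB1'
    linarith
  · rcases (show B = 2 ∨ 3 ≤ B by omega) with h2 | h3
    · have hB' : (B : ℝ) = 2 := by rw [h2]; norm_num
      have hlog : Real.log (2 * s - 1) ≤ 0.6036 := by
        have hs2 : s ≤ 1.414214 := by
          rw [hs, hB', Real.sqrt_le_left (by norm_num)]
          norm_num
        rw [Real.log_le_iff_le_exp (by linarith)]
        refine exp_lower_bound (by norm_num) 9 (le_trans (by linarith : _ ≤ (1.828428 : ℝ)) ?_)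
        norm_num [Finset.sum_range_succ, Nat.factorial]
      have hs3 : √(2 * (B : ℝ) - 1) ≤ 1.73206 := by
        rw [hB', Real.sqrt_le_left (by norm_num)]
        norm_num
      have h4 : √(2 * (B : ℝ) - 1) * (8 * (1.2556 + Real.log (2 * s - 1)) + 0.007) ≤
          1.73206 * (8 * (1.2556 + 0.6036) + 0.007) := by gcongr
      rw [hB'] at h4 ⊢
      norm_num at h4 ⊢
      linarith
    · have hB3 : (3 : ℝ) ≤ B := by exact_mod_cast h3
      have hs17 : 1.732 ≤ s := Real.le_sqrt_of_sq_le (by norm_num; linarith)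
      have hm6 : 6 ≤ m := by
        have := Nat.totient_lt m (by omega)
        omega
      have hlogm6 : 1.79 < Real.log m := by
        refine lt_of_lt_of_le ?_ (Real.log_le_log (by norm_num) (by exact_mod_cast hm6 : (6 : ℝ) ≤ m))
        rw [show (6 : ℝ) = 2 * 3 by norm_num, Real.log_mul (by norm_num) (by norm_num)]
        linarith [Real.log_two_gt_d9, Real.log_three_gt_d9]
      have hlog : Real.log (2 * s - 1) ≤ s - 0.8068 := by
        have h4 := Real.log_le_sub_one_of_pos (show 0 < (2 * s - 1) / 2 by linarith)
        rw [Real.log_div (by linarith) (by norm_num)] at h4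
        linarith [Real.log_two_lt_d9]
      have hs3 : √(2 * (B : ℝ) - 1) ≤ 1.41422 * s := by
        rw [Real.sqrt_le_left (by positivity), mul_pow, hsB]
        linarith
      have h4 : √(2 * (B : ℝ) - 1) * (8 * (1.2556 + Real.log (2 * s - 1)) + 0.007) ≤
          1.41422 * s * (8 * (1.2556 + (s - 0.8068)) + 0.007) := by gcongr
      have h5 : (2 * (B : ℝ) - 1 / 2) * 1.79 ≤ (2 * (B : ℝ) - 1 / 2) * Real.log m :=
        mul_le_mul_of_nonneg_left hlogm6.le (by linarith)
      rw [← hsB] at h4 h5 ⊢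
      rw [← hsB] at hB3
      nlinarith

/-- Under GRH, primes in at least half of the reduced residue classes modulo `m` contribute nearly
their expected share to `log n!`. -/
theorem le_logFactorialPart_of_GRH {m : ℕ} (hm : 3 ≤ m) (hG : GRH m) {A : Finset ℕ}
    (hA : ∀ a ∈ A, a < m ∧ Nat.Coprime a m) (hcard : (m.totient : ℝ) ≤ 2 * A.card) {n : ℕ}
    (hn : 1 ≤ n) :
    (A.card : ℝ) / m.totient * (n * (Real.log n - (2 + m.totient * (Real.log m + 6.55)))) ≤
      logFactorialPart m A n := by
  have : NeZero m := ⟨by omega⟩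
  have hφ : (0 : ℝ) < m.totient := by exact_mod_cast Nat.totient_pos.mpr (show 0 < m by omega)
  have hn' : (0 : ℝ) < n := by exact_mod_cast hn
  set T0 : ℝ := 2 + m.totient * (Real.log m + 6.55) with hT0
  rcases le_total (Real.log n) T0 with hT | hT
  · refine le_trans ?_ (logFactorialPart_nonneg m A n)
    exact mul_nonpos_of_nonneg_of_nonpos (by positivity)
      (mul_nonpos_of_nonneg_of_nonpos hn'.le (by linarith))
  have hT0' : 2 ≤ T0 := by
    have : 0 ≤ Real.log (m : ℝ) := Real.log_natCast_nonneg m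
    rw [hT0]
    nlinarith
  set T := Real.log (n : ℝ) with hTdef
  have hTpos : 0 < T := by linarith
  set N := ⌈T ^ 2⌉₊ with hNdef
  have hN : T ^ 2 ≤ N := Nat.le_ceil _
  have hN' : (N : ℝ) ≤ T ^ 2 + 1 := (Nat.ceil_lt_add_one (by positivity)).le
  have hN0 : (0 : ℝ) < N := lt_of_lt_of_le (by positivity) hN
  set δ : ℝ := N / T with hδ
  have hδ0 : 0 < δ := by positivity
  obtain ⟨S, hS0, hS, hloss⟩ := exists_character_sum_bound hm hG hT hN hN' hδ
  have h1 := le_logFactorialPart hA hcard hn hδ0 hS0 hS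
  have hδT : δ * T = N := by rw [hδ]; field_simp
  have hNδ : (N : ℝ) / δ = T := by rw [hδ]; field_simp
  have hV : gammaTailInt N (δ * T) / δ ≤ 0.39895 := by
    rw [hδT, div_le_iff₀ hδ0]
    refine (gammaTailInt_self_le (by exact_mod_cast hN0)).trans ?_
    have h2 : T ≤ √N := Real.le_sqrt_of_sq_le hN
    have h3 : √(2 * Real.pi * N) = √(2 * Real.pi) * √N := Real.sqrt_mul (by positivity) _
    have h4 : (N : ℝ) / √(2 * Real.pi * N) = 1 / √(2 * Real.pi) * √N := by
      rw [h3]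
      have := Real.mul_self_sqrt hN0.le
      field_simp
      nlinarith
    have h5 : √(N : ℝ) ≤ δ := by
      rw [hδ, le_div_iff₀ hTpos]
      nlinarith [Real.mul_self_sqrt hN0.le, Real.sqrt_nonneg (N : ℝ)]
    rw [h4]
    exact mul_le_mul one_div_sqrt_two_pi_le h5 (by positivity) (by norm_num)
  rw [← hTdef, hNδ] at h1
  set Q := logFactorialPart m A n
  have hlog4 : 0 ≤ Real.log 4 := Real.log_nonneg (by norm_num)
  have h2 : Real.log 4 * (2 + gammaTailInt N (δ * T) / δ) ≤ Real.log 4 * (2 + 0.39895) := by gcongr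
  have h3 : (n : ℝ) * (A.card * (T - T0)) ≤ m.totient * Q := by
    have h4 : (m.totient : ℝ) * (n * (Real.log 4 * (2 + gammaTailInt N (δ * T) / δ))) ≤
        (2 * A.card) * (n * (Real.log 4 * (2 + 0.39895))) :=
      (mul_le_mul_of_nonneg_left (mul_le_mul_of_nonneg_left h2 hn'.le) hφ.le).trans
        (mul_le_mul_of_nonneg_right hcard (by positivity))
    have h5 : (n : ℝ) * (A.card * (1 + Real.log (2 * m) / 2 + √(m.totient - 1) * S +
        2 * (Real.log 4 * (2 + 0.39895)))) ≤ n * (A.card * T0) := by gcongr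
    linarith
  calc _ = ((n : ℝ) * (A.card * (T - T0))) / m.totient := by ring
    _ ≤ _ := by rw [div_le_iff₀ hφ]; linarith

open Polynomial in
/-- The polynomial `∏ (X - αⱼ)^l`. -/
def nodePoly {k : ℕ} (α : Fin k → ℤ) (l : ℕ) : ℤ[X] := ∏ j, (X - C (α j)) ^ l

lemma nodePoly_monic {k : ℕ} (α : Fin k → ℤ) (l : ℕ) : (nodePoly α l).Monic :=
  Polynomial.monic_prod_of_monic _ _ fun j _ => (Polynomial.monic_X_sub_C (α j)).pow l

lemma natDegree_nodePoly {k : ℕ} (α : Fin k → ℤ) (l : ℕ) : (nodePoly α l).natDegree = k * l := by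
  rw [nodePoly, Polynomial.natDegree_prod_of_monic _ _ fun j _ =>
    (Polynomial.monic_X_sub_C (α j)).pow l]
  simp only [Polynomial.natDegree_pow, Polynomial.natDegree_X_sub_C]
  simp

open Polynomial in
/-- The coefficient sums governing the remainders of the Padé approximants to the Euler series. -/
def padeRem {k : ℕ} (α : Fin k → ℤ) (l μ : ℕ) (j : Fin k) (r : ℕ) : ℤ :=
  ∑ h ∈ Finset.range (k * l + 1),
    (nodePoly α l).coeff h * ((h + μ + r).choose r : ℤ) * α j ^ (h + μ + r)

lemma padeRem_eq_taylor_coeff {k : ℕ} (α : Fin k → ℤ) (l μ : ℕ) (j : Fin k) (r : ℕ) :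
    padeRem α l μ j r = α j ^ r *
      (Polynomial.taylor (α j) (Polynomial.X ^ (μ + r) * nodePoly α l)).coeff r := by
  have h1 : Polynomial.X ^ (μ + r) * nodePoly α l =
      ∑ h ∈ Finset.range (k * l + 1), Polynomial.monomial (h + μ + r) ((nodePoly α l).coeff h) := by
    conv_lhs => rw [(nodePoly α l).as_sum_range' (k * l + 1) (by rw [natDegree_nodePoly]; omega)]
    rw [Finset.mul_sum]
    refine Finset.sum_congr rfl fun h _ => ?_
    rw [Polynomial.X_pow_mul_monomial, add_assoc]
  rw [Polynomial.taylor_coeff, h1, map_sum, Polynomial.eval_finsetSum, Finset.mul_sum, padeRem]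
  refine Finset.sum_congr rfl fun h _ => ?_
  rw [Polynomial.hasseDeriv_monomial, Polynomial.eval_monomial, Nat.add_sub_cancel]
  ring

lemma taylor_mul_nodePoly {k : ℕ} (α : Fin k → ℤ) (l : ℕ) (j : Fin k) (q : Polynomial ℤ) :
    Polynomial.taylor (α j) (q * nodePoly α l) = Polynomial.X ^ l * Polynomial.taylor (α j)
      (q * ∏ i ∈ Finset.univ.erase j, (Polynomial.X - Polynomial.C (α i)) ^ l) := by
  rw [nodePoly, ← Finset.mul_prod_erase _ _ (Finset.mem_univ j), Polynomial.taylor_mul,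
    Polynomial.taylor_mul, Polynomial.taylor_pow, Polynomial.taylor_mul, map_sub,
    Polynomial.taylor_X, Polynomial.taylor_C, add_sub_cancel_right]
  ring

lemma padeRem_eq_zero {k : ℕ} (α : Fin k → ℤ) {l : ℕ} (μ : ℕ) (j : Fin k) {r : ℕ} (hr : r < l) :
    padeRem α l μ j r = 0 := by
  rw [padeRem_eq_taylor_coeff, taylor_mul_nodePoly, Polynomial.coeff_X_pow_mul',
    if_neg (by omega), mul_zero]

lemma padeRem_self {k : ℕ} (α : Fin k → ℤ) (l μ : ℕ) (j : Fin k) :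
    padeRem α l μ j l = α j ^ μ * (α j ^ (2 * l) * ∏ i ∈ Finset.univ.erase j, (α j - α i) ^ l) := by
  rw [padeRem_eq_taylor_coeff, taylor_mul_nodePoly, Polynomial.coeff_X_pow_mul', if_pos le_rfl,
    Nat.sub_self, Polynomial.taylor_coeff_zero, Polynomial.eval_mul, Polynomial.eval_prod]
  simp
  ring

/-- The coefficients `(kl+μ)!/(h+μ)! · [w^h] ∏ (w - αⱼ)^l` of the Padé denominators. -/
def padeCoeff {k : ℕ} (α : Fin k → ℤ) (l μ h : ℕ) : ℤ :=
  (nodePoly α l).coeff h * ((k * l + μ).descFactorial (k * l - h) : ℤ)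

lemma padeCoeff_mul_factorial {k : ℕ} (α : Fin k → ℤ) {l μ h : ℕ} (hh : h ≤ k * l) (r : ℕ) :
    padeCoeff α l μ h * ((h + μ + r) ! : ℤ) =
      (nodePoly α l).coeff h * ((h + μ + r).choose r : ℤ) * ((k * l + μ) ! * r ! : ℤ) := by
  have h1 : ((h + μ) ! : ℤ) * ((k * l + μ).descFactorial (k * l - h) : ℤ) = ((k * l + μ) ! : ℤ) := by
    have := Nat.factorial_mul_descFactorial (show k * l - h ≤ k * l + μ by omega)
    rw [show k * l + μ - (k * l - h) = h + μ by omega] at this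
    exact_mod_cast this
  have h2 : ((h + μ + r) ! : ℤ) = ((h + μ + r).choose r : ℤ) * (r ! : ℤ) * ((h + μ) ! : ℤ) := by
    have := Nat.choose_mul_factorial_mul_factorial (show r ≤ h + μ + r by omega)
    rw [Nat.add_sub_cancel] at this
    exact_mod_cast this.symm
  rw [padeCoeff, h2, ← h1]
  ring

lemma sum_padeCoeff_mul_factorial {k : ℕ} (α : Fin k → ℤ) (l μ : ℕ) (j : Fin k) (r : ℕ) :
    ∑ h ∈ Finset.range (k * l + 1), padeCoeff α l μ h * (((h + μ + r) ! : ℤ) * α j ^ (h + μ + r)) =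
      ((k * l + μ) ! * r ! : ℤ) * padeRem α l μ j r := by
  rw [padeRem, Finset.mul_sum]
  refine Finset.sum_congr rfl fun h hh => ?_
  rw [← mul_assoc, padeCoeff_mul_factorial α (by simpa [Nat.lt_succ_iff] using hh)]
  ring

open Polynomial in
/-- The Padé denominators and numerators, as polynomials in the argument of the Euler series. -/
def padePoly {k : ℕ} (α : Fin k → ℤ) (l μ : ℕ) (i : Fin (k + 1)) : ℤ[X] :=
  Fin.cases (∑ h ∈ Finset.range (k * l + 1), C (padeCoeff α l μ h) * X ^ (k * l - h))
    (fun j => ∑ h ∈ Finset.range (k * l + 1), C (padeCoeff α l μ h) * (X ^ (k * l - h) *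
      ∑ i ∈ Finset.range (h + μ), C ((i ! : ℤ) * α j ^ i) * X ^ i)) i

/-- The formal Euler series `∑ n! aⁿ Xⁿ`, starting from the index `s`. -/
def eulerTail (a : ℤ) (s : ℕ) : PowerSeries ℤ :=
  PowerSeries.mk fun r => ((s + r) ! : ℤ) * a ^ (s + r)

lemma eulerTail_zero_eq (a : ℤ) (s : ℕ) :
    eulerTail a 0 = ((∑ i ∈ Finset.range s, Polynomial.C ((i ! : ℤ) * a ^ i) * Polynomial.X ^ i :
      Polynomial ℤ) : PowerSeries ℤ) + PowerSeries.X ^ s * eulerTail a s := by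
  ext n
  rw [map_add, Polynomial.coeff_coe, PowerSeries.coeff_X_pow_mul', Polynomial.finsetSum_coeff]
  simp only [eulerTail, PowerSeries.coeff_mk, zero_add, Polynomial.coeff_C_mul_X_pow]
  rw [Finset.sum_ite_eq]
  by_cases h : s ≤ n
  · rw [if_neg (by simpa using h), if_pos h, Nat.add_sub_cancel' h, zero_add]
  · rw [if_pos (by simpa using h), if_neg h, add_zero]

/-- The normalised formal remainder. -/
def padeTail {k : ℕ} (α : Fin k → ℤ) (l μ : ℕ) (j : Fin k) : PowerSeries ℤ :=
  PowerSeries.mk fun r => ((k * l + μ) ! * (l + r) ! : ℤ) * padeRem α l μ j (l + r)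

lemma padePoly_zero_mul_eulerTail {k : ℕ} (α : Fin k → ℤ) (l μ : ℕ) (j : Fin k) :
    (padePoly α l μ 0 : PowerSeries ℤ) * eulerTail (α j) 0 - (padePoly α l μ j.succ : PowerSeries ℤ) =
      PowerSeries.X ^ (k * l + l + μ) * padeTail α l μ j := by
  have h1 : (padePoly α l μ 0 : PowerSeries ℤ) * eulerTail (α j) 0 -
      (padePoly α l μ j.succ : PowerSeries ℤ) = PowerSeries.X ^ (k * l + μ) *
        ∑ h ∈ Finset.range (k * l + 1), PowerSeries.C (padeCoeff α l μ h) * eulerTail (α j) (h + μ) := by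
    simp only [padePoly, Fin.cases_zero, Fin.cases_succ]
    simp only [← Polynomial.coeToPowerSeries.ringHom_apply, map_sum, map_mul]
    rw [Finset.sum_mul, ← Finset.sum_sub_distrib, Finset.mul_sum]
    refine Finset.sum_congr rfl fun h hh => ?_
    have hh' : h ≤ k * l := by simpa [Nat.lt_succ_iff] using hh
    rw [eulerTail_zero_eq (α j) (h + μ)]
    simp only [← Polynomial.coeToPowerSeries.ringHom_apply, map_sum, map_mul, map_pow]
    simp only [Polynomial.coeToPowerSeries.ringHom_apply, Polynomial.coe_C, Polynomial.coe_X]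
    rw [show k * l + μ = (k * l - h) + (h + μ) by omega, pow_add]
    ring
  have h2 : ∑ h ∈ Finset.range (k * l + 1), PowerSeries.C (padeCoeff α l μ h) *
      eulerTail (α j) (h + μ) = PowerSeries.X ^ l * padeTail α l μ j := by
    ext r
    rw [PowerSeries.coeff_X_pow_mul', map_sum]
    simp only [PowerSeries.coeff_C_mul, eulerTail, PowerSeries.coeff_mk, padeTail]
    rw [sum_padeCoeff_mul_factorial]
    split_ifs with h
    · rw [Nat.add_sub_cancel' h]
    · rw [padeRem_eq_zero α μ j (by omega), mul_zero]
  rw [h1, h2, ← mul_assoc, ← pow_add, add_right_comm]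

lemma natDegree_padePoly {k : ℕ} (α : Fin k → ℤ) {l : ℕ} (hkl : 1 ≤ k * l) (μ : ℕ) (i : Fin (k + 1)) :
    (padePoly α l μ i).natDegree + 1 ≤ k * l + μ + if i = 0 then 1 else 0 := by
  cases i using Fin.cases with
  | zero =>
    simp only [padePoly, Fin.cases_zero, if_true]
    suffices h : (∑ h ∈ Finset.range (k * l + 1), Polynomial.C (padeCoeff α l μ h) *
        Polynomial.X ^ (k * l - h)).natDegree ≤ k * l by omega
    refine Polynomial.natDegree_sum_le_of_forall_le _ _ fun h _ => ?_
    exact (Polynomial.natDegree_C_mul_X_pow_le _ _).trans (Nat.sub_le _ _)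
  | succ j =>
    simp only [padePoly, Fin.cases_succ, Fin.succ_ne_zero, if_false]
    suffices h : (∑ h ∈ Finset.range (k * l + 1), Polynomial.C (padeCoeff α l μ h) *
        (Polynomial.X ^ (k * l - h) * ∑ i ∈ Finset.range (h + μ),
          Polynomial.C ((i ! : ℤ) * α j ^ i) * Polynomial.X ^ i)).natDegree ≤ k * l + μ - 1 by omega
    refine Polynomial.natDegree_sum_le_of_forall_le _ _ fun h hh => ?_
    have hh' : h ≤ k * l := by simpa [Nat.lt_succ_iff] using hh
    refine (Polynomial.natDegree_C_mul_le _ _).trans ?_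
    rw [Finset.mul_sum]
    refine Polynomial.natDegree_sum_le_of_forall_le _ _ fun i hi => ?_
    have hi' := Finset.mem_range.mp hi
    rw [mul_left_comm, ← pow_add]
    exact (Polynomial.natDegree_C_mul_X_pow_le _ _).trans (by omega)

open Polynomial in
/-- The matrix of Padé polynomials. -/
def padeMatrix {k : ℕ} (α : Fin k → ℤ) (l : ℕ) : Matrix (Fin (k + 1)) (Fin (k + 1)) ℤ[X] :=
  Matrix.of fun μ i => padePoly α l μ i

lemma natDegree_det_padeMatrix {k : ℕ} (α : Fin k → ℤ) {l : ℕ} (hkl : 1 ≤ k * l) :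
    (padeMatrix α l).det.natDegree + k ≤ (k + 1) * (k * l) + ∑ μ : Fin (k + 1), (μ : ℕ) := by
  suffices h : (padeMatrix α l).det.natDegree ≤
      (k + 1) * (k * l) + ∑ μ : Fin (k + 1), (μ : ℕ) - k by
    have h1 : k ≤ ∑ μ : Fin (k + 1), (μ : ℕ) :=
      (Fin.val_last k).ge.trans (Finset.single_le_sum (f := fun μ : Fin (k + 1) => (μ : ℕ))
        (fun _ _ => Nat.zero_le _) (Finset.mem_univ (Fin.last k)))
    omega
  rw [Matrix.det_apply]
  refine Polynomial.natDegree_sum_le_of_forall_le _ _ fun σ _ => ?_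
  refine (Polynomial.natDegree_smul_le _ _).trans ((Polynomial.natDegree_prod_le _ _).trans ?_)
  have h1 : ∑ i, ((padeMatrix α l (σ i) i).natDegree + 1) ≤
      ∑ i : Fin (k + 1), (k * l + (σ i : ℕ) + if i = 0 then 1 else 0) :=
    Finset.sum_le_sum fun i _ => natDegree_padePoly α hkl _ i
  rw [Finset.sum_add_distrib, Finset.sum_add_distrib, Finset.sum_add_distrib,
    Equiv.sum_comp σ (fun μ : Fin (k + 1) => (μ : ℕ))] at h1
  simp only [Finset.sum_const, Finset.card_univ, Fintype.card_fin, smul_eq_mul, mul_one,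
    Finset.sum_ite_eq', Finset.mem_univ, if_true] at h1
  omega

/-- The column operations turning Padé numerators into remainders. -/
def remainderOp {k : ℕ} (α : Fin k → ℤ) : Matrix (Fin (k + 1)) (Fin (k + 1)) (PowerSeries ℤ) :=
  Matrix.of fun i j => if i = j then (if i = 0 then 1 else -1)
    else if i = 0 then Fin.cases 0 (fun j => eulerTail (α j) 0) j else 0

lemma isUnit_det_remainderOp {k : ℕ} (α : Fin k → ℤ) : IsUnit (remainderOp α).det := by
  rw [Matrix.det_of_isUpperTriangular]
  · rw [IsUnit.prod_univ_iff]
    intro i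
    simp only [remainderOp, Matrix.of_apply, if_true]
    split_ifs
    exacts [isUnit_one, isUnit_one.neg]
  · intro i j hij
    have h : j < i := hij
    simp [remainderOp, h.ne', (Fin.zero_le j |>.trans_lt h).ne']

/-- The matrix of normalised remainders. -/
def tailMatrix {k : ℕ} (α : Fin k → ℤ) (l : ℕ) :
    Matrix (Fin (k + 1)) (Fin (k + 1)) (PowerSeries ℤ) :=
  Matrix.of fun μ i => Fin.cases (PowerSeries.X ^ (k - (μ : ℕ)) * (padePoly α l μ 0 : PowerSeries ℤ))
    (fun j => padeTail α l μ j) i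

lemma padeMatrix_mul_remainderOp {k : ℕ} (α : Fin k → ℤ) (l : ℕ) :
    (Polynomial.coeToPowerSeries.ringHom.mapMatrix (padeMatrix α l)) * remainderOp α *
      Matrix.diagonal (fun i => if i = 0 then PowerSeries.X ^ (k * l + l + k) else 1) =
    Matrix.diagonal (fun μ : Fin (k + 1) => PowerSeries.X ^ (k * l + l + (μ : ℕ))) *
      tailMatrix α l := by
  ext1 μ i
  rw [Matrix.mul_diagonal, Matrix.diagonal_mul, Matrix.mul_apply, Fin.sum_univ_succ]
  cases i using Fin.cases with
  | zero =>
    simp only [remainderOp, tailMatrix, Matrix.of_apply, Fin.succ_ne_zero, if_true, if_false,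
      mul_zero, Finset.sum_const_zero, Fin.cases_zero, padeMatrix, RingHom.mapMatrix_apply,
      Matrix.map_apply, Polynomial.coeToPowerSeries.ringHom_apply]
    have hμ : k * l + l + k = k * l + l + μ + (k - μ) := by have := μ.is_le; omega
    rw [hμ, pow_add _ (k * l + l + μ)]
    ring
  | succ j =>
    simp only [remainderOp, tailMatrix, Matrix.of_apply, Fin.succ_ne_zero, if_true, if_false,
      Fin.cases_succ, padeMatrix, RingHom.mapMatrix_apply, (Fin.succ_ne_zero _).symm, Fin.succ_inj,
      Matrix.map_apply, Polynomial.coeToPowerSeries.ringHom_apply, mul_ite, mul_neg, mul_one,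
      mul_zero, Finset.sum_ite_eq', Finset.mem_univ]
    rw [← padePoly_zero_mul_eulerTail, sub_eq_add_neg]

lemma padePoly_zero_coeff_zero {k : ℕ} (α : Fin k → ℤ) (l μ : ℕ) :
    (padePoly α l μ 0).coeff 0 = 1 := by
  simp only [padePoly, Fin.cases_zero, Polynomial.finsetSum_coeff, Polynomial.coeff_C_mul_X_pow]
  rw [Finset.sum_eq_single (k * l)]
  · have h := (nodePoly_monic α l).coeff_natDegree
    rw [natDegree_nodePoly] at h
    simp [padeCoeff, h]
  · intro h hh hne
    have hh' : h ≤ k * l := by simpa [Nat.lt_succ_iff] using hh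
    rw [if_neg (by omega)]
  · intro h
    simp at h

lemma constantCoeff_det_tailMatrix_ne_zero {k : ℕ} {α : Fin k → ℤ} (hα : ∀ j, α j ≠ 0)
    (hinj : Function.Injective α) (l : ℕ) :
    PowerSeries.constantCoeff (tailMatrix α l).det ≠ 0 := by
  rw [RingHom.map_det, Matrix.det_succ_column_zero, Finset.sum_eq_single (Fin.last k)]
  · refine mul_ne_zero (mul_ne_zero (pow_ne_zero _ (by norm_num)) ?_) ?_
    · simp [tailMatrix, padePoly_zero_coeff_zero]
    · have h1 : (((PowerSeries.constantCoeff (R := ℤ)).mapMatrix (tailMatrix α l)).submatrix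
          (Fin.last k).succAbove Fin.succ) = Matrix.diagonal (fun μ : Fin k =>
            (((k * l + (μ : ℕ)) ! * l ! : ℕ) : ℤ)) * (Matrix.vandermonde α).transpose *
            Matrix.diagonal (fun j => α j ^ (2 * l) *
              ∏ i ∈ Finset.univ.erase j, (α j - α i) ^ l) := by
        ext μ j
        rw [Matrix.mul_diagonal, Matrix.diagonal_mul]
        simp only [Matrix.submatrix_apply, RingHom.mapMatrix_apply, Matrix.map_apply, tailMatrix,
          Matrix.of_apply, Fin.cases_succ, padeTail, Fin.succAbove_last, Matrix.transpose_apply,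
          Matrix.vandermonde_apply]
        rw [← PowerSeries.coeff_zero_eq_constantCoeff_apply, PowerSeries.coeff_mk, add_zero,
          padeRem_self]
        push_cast
        simp only [Fin.val_castSucc]
        ring
      rw [h1, Matrix.det_mul, Matrix.det_mul, Matrix.det_diagonal, Matrix.det_diagonal,
        Matrix.det_transpose]
      refine mul_ne_zero (mul_ne_zero ?_ (Matrix.det_vandermonde_ne_zero_iff.mpr hinj)) ?_
      · exact Finset.prod_ne_zero_iff.mpr fun μ _ => by positivity
      · refine Finset.prod_ne_zero_iff.mpr fun j _ => mul_ne_zero (pow_ne_zero _ (hα j))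
          (Finset.prod_ne_zero_iff.mpr fun i hi => pow_ne_zero _ (sub_ne_zero.mpr fun h => ?_))
        exact (Finset.mem_erase.mp hi).1 (hinj h.symm)
  · intro μ _ hμ
    have hlt : (μ : ℕ) < k := by
      have := Fin.val_lt_last hμ
      simpa using this
    simp [tailMatrix, Nat.sub_ne_zero_of_lt hlt]
  · simp

lemma eval_one_det_padeMatrix_ne_zero {k : ℕ} {α : Fin k → ℤ} (hα : ∀ j, α j ≠ 0)
    (hinj : Function.Injective α) {l : ℕ} (hkl : 1 ≤ k * l) :
    (padeMatrix α l).det.eval 1 ≠ 0 := by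
  set P := (padeMatrix α l).det with hP
  have h1 := congrArg Matrix.det (padeMatrix_mul_remainderOp α l)
  rw [Matrix.det_mul, Matrix.det_mul, Matrix.det_mul, Matrix.det_diagonal, Matrix.det_diagonal,
    ← RingHom.map_det, Fin.prod_univ_succ, Finset.prod_pow_eq_pow_sum] at h1
  simp only [Fin.succ_ne_zero, if_true, if_false, Finset.prod_const_one, mul_one,
    Polynomial.coeToPowerSeries.ringHom_apply, ← hP] at h1
  set s := ∑ μ : Fin (k + 1), (μ : ℕ) with hs
  have hsum : ∑ μ : Fin (k + 1), (k * l + l + (μ : ℕ)) = (k + 1) * (k * l) + s + (k * l + l) := by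
    rw [Finset.sum_add_distrib]
    simp only [Finset.sum_const, Finset.card_univ, Fintype.card_fin, smul_eq_mul]
    ring
  rw [hsum] at h1
  obtain ⟨u, hu⟩ := isUnit_det_remainderOp α
  have hks : k ≤ s :=
    (Fin.val_last k).ge.trans (Finset.single_le_sum (f := fun μ : Fin (k + 1) => (μ : ℕ))
      (fun _ _ => Nat.zero_le _) (Finset.mem_univ (Fin.last k)))
  obtain ⟨e, he⟩ : ∃ e, (k + 1) * (k * l) + s = e + k := ⟨(k + 1) * (k * l) + s - k, by omega⟩
  have hdeg : P.natDegree ≤ e := by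
    have := natDegree_det_padeMatrix α hkl
    rw [← hP] at this
    omega
  rw [he, ← hu, show e + k + (k * l + l) = e + (k * l + l + k) by ring,
    pow_add _ e, mul_right_comm (PowerSeries.X ^ e)] at h1
  have h2 : (P : PowerSeries ℤ) * (u : PowerSeries ℤ) = PowerSeries.X ^ e * (tailMatrix α l).det :=
    mul_right_cancel₀ (pow_ne_zero (k * l + l + k) PowerSeries.X_ne_zero) h1
  have h3 : (P : PowerSeries ℤ) = PowerSeries.X ^ e *
      ((tailMatrix α l).det * ((u⁻¹ : (PowerSeries ℤ)ˣ) : PowerSeries ℤ)) := by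
    rw [← mul_assoc, ← h2, mul_assoc, Units.mul_inv, mul_one]
  have hcoeff : ∀ n < e, P.coeff n = 0 := fun n hn => by
    rw [← Polynomial.coeff_coe, h3, PowerSeries.coeff_X_pow_mul', if_neg (by omega)]
  have hlead : P.coeff e ≠ 0 := by
    rw [← Polynomial.coeff_coe, h3, PowerSeries.coeff_X_pow_mul', if_pos le_rfl, Nat.sub_self,
      PowerSeries.coeff_zero_eq_constantCoeff_apply, map_mul]
    refine mul_ne_zero (constantCoeff_det_tailMatrix_ne_zero hα hinj l) ?_
    exact ((u⁻¹).isUnit.map PowerSeries.constantCoeff).ne_zero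
  rw [Polynomial.eval_eq_sum_range' (n := e + 1) (by omega), Finset.sum_range_succ,
    Finset.sum_eq_zero fun n hn => by rw [hcoeff n (Finset.mem_range.mp hn), zero_mul]]
  simpa using hlead

/-- For every nonzero integer vector, some Padé row at `1` does not annihilate it. -/
lemma exists_padePoly_eval_sum_ne_zero {k : ℕ} {α : Fin k → ℤ} (hα : ∀ j, α j ≠ 0)
    (hinj : Function.Injective α) {l : ℕ} (hkl : 1 ≤ k * l) {v : Fin (k + 1) → ℤ}
    (hv : ∃ i, v i ≠ 0) : ∃ μ ≤ k, ∑ i, (padePoly α l μ i).eval 1 * v i ≠ 0 := by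
  by_contra! hc
  have h1 : ((Polynomial.evalRingHom (1 : ℤ)).mapMatrix (padeMatrix α l)).det ≠ 0 := by
    rw [← RingHom.map_det]
    exact eval_one_det_padeMatrix_ne_zero hα hinj hkl
  obtain ⟨i, hi⟩ := hv
  refine hi (congrFun (Matrix.eq_zero_of_mulVec_eq_zero h1 ?_) i)
  ext μ
  simpa [Matrix.mulVec, dotProduct, padeMatrix] using hc μ μ.is_le

lemma abs_coeff_mul_le {P P' Q Q' : Polynomial ℤ} (hP : ∀ n, |P.coeff n| ≤ P'.coeff n)
    (hQ : ∀ n, |Q.coeff n| ≤ Q'.coeff n) (n : ℕ) : |(P * Q).coeff n| ≤ (P' * Q').coeff n := by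
  rw [Polynomial.coeff_mul, Polynomial.coeff_mul]
  refine (Finset.abs_sum_le_sum_abs _ _).trans (Finset.sum_le_sum fun x _ => ?_)
  rw [abs_mul]
  exact mul_le_mul (hP _) (hQ _) (abs_nonneg _) ((abs_nonneg _).trans (hP _))

lemma abs_coeff_pow_le {P P' : Polynomial ℤ} (hP : ∀ n, |P.coeff n| ≤ P'.coeff n) (l n : ℕ) :
    |(P ^ l).coeff n| ≤ (P' ^ l).coeff n := by
  induction l generalizing n with
  | zero => rw [pow_zero, pow_zero, Polynomial.coeff_one]; split_ifs <;> simp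
  | succ l ih => rw [pow_succ, pow_succ]; exact abs_coeff_mul_le ih hP n

lemma abs_coeff_prod_le {ι : Type*} (s : Finset ι) {P P' : ι → Polynomial ℤ}
    (hP : ∀ i n, |(P i).coeff n| ≤ (P' i).coeff n) (n : ℕ) :
    |(∏ i ∈ s, P i).coeff n| ≤ (∏ i ∈ s, P' i).coeff n := by
  classical
  induction s using Finset.induction_on generalizing n with
  | empty => rw [Finset.prod_empty, Finset.prod_empty, Polynomial.coeff_one]; split_ifs <;> simp
  | insert i s hi ih =>
    rw [Finset.prod_insert hi, Finset.prod_insert hi]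
    exact abs_coeff_mul_le (hP i) ih n

lemma natAbs_le_maxAbs {k : ℕ} (α : Fin k → ℤ) (j : Fin k) : (α j).natAbs ≤ maxAbs α :=
  Finset.le_sup (f := fun j => (α j).natAbs) (Finset.mem_univ j)

lemma sum_abs_coeff_nodePoly_mul_le {k : ℕ} (α : Fin k → ℤ) (l : ℕ) :
    ∑ h ∈ Finset.range (k * l + 1), |(nodePoly α l).coeff h| * (maxAbs α : ℤ) ^ h ≤
      (2 * (maxAbs α : ℤ)) ^ (k * l) := by
  set Q : Polynomial ℤ := ∏ j, (Polynomial.X + Polynomial.C |α j|) ^ l with hQ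
  have hmon : ∀ j, ((Polynomial.X + Polynomial.C |α j|) ^ l).Monic := fun j =>
    (Polynomial.monic_X_add_C _).pow l
  have hdeg : Q.natDegree = k * l := by
    rw [hQ, Polynomial.natDegree_prod_of_monic _ _ fun j _ => hmon j]
    simp only [Polynomial.natDegree_pow, Polynomial.natDegree_X_add_C]
    simp
  have h1 : ∀ n, |(nodePoly α l).coeff n| ≤ Q.coeff n := by
    refine abs_coeff_prod_le _ fun j => abs_coeff_pow_le (fun n => ?_) l
    rw [Polynomial.coeff_sub, Polynomial.coeff_add, Polynomial.coeff_X, Polynomial.coeff_C,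
      Polynomial.coeff_C]
    refine (abs_sub _ _).trans (add_le_add ?_ ?_) <;> split_ifs <;> simp
  calc _ ≤ ∑ h ∈ Finset.range (k * l + 1), Q.coeff h * (maxAbs α : ℤ) ^ h :=
        Finset.sum_le_sum fun h _ => mul_le_mul_of_nonneg_right (h1 h) (by positivity)
    _ = Q.eval (maxAbs α : ℤ) := (Polynomial.eval_eq_sum_range' (by omega) _).symm
    _ = ∏ j, ((maxAbs α : ℤ) + |α j|) ^ l := by rw [hQ, Polynomial.eval_prod]; simp
    _ ≤ ∏ _j : Fin k, (2 * (maxAbs α : ℤ)) ^ l := by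
      refine Finset.prod_le_prod (fun j _ => by positivity) fun j _ => ?_
      refine pow_le_pow_left₀ (by positivity) ?_ l
      have : |α j| ≤ maxAbs α := by
        rw [Int.abs_eq_natAbs]
        exact_mod_cast natAbs_le_maxAbs α j
      linarith
    _ = _ := by
      rw [Finset.prod_const, Finset.card_univ, Fintype.card_fin, ← pow_mul, mul_comm l]

lemma one_le_maxAbs {k : ℕ} (hk : 1 ≤ k) {α : Fin k → ℤ} (hα : ∀ j, α j ≠ 0) : 1 ≤ maxAbs α :=
  (Int.natAbs_pos.mpr (hα ⟨0, hk⟩)).trans_le (natAbs_le_maxAbs α ⟨0, hk⟩)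

lemma sum_factorial_mul_pow_le {a : ℤ} {b : ℕ} (hb : 1 ≤ b) (hab : |a| ≤ b) (n : ℕ) :
    |∑ i ∈ Finset.range n, (i ! : ℤ) * a ^ i| ≤ (n ! : ℤ) * (b : ℤ) ^ n := by
  have hb' : (1 : ℤ) ≤ b := by exact_mod_cast hb
  induction n with
  | zero => simp
  | succ n ih =>
    rw [Finset.sum_range_succ]
    refine (abs_add_le _ _).trans ?_
    have h1 : |(n ! : ℤ) * a ^ n| ≤ (n ! : ℤ) * (b : ℤ) ^ n := by
      rw [abs_mul, abs_pow, Nat.abs_cast]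
      gcongr
    rcases Nat.eq_zero_or_pos n with rfl | hn
    · simpa using hb'
    · have h2 : 2 * (n ! : ℤ) ≤ ((n + 1) ! : ℤ) := by
        rw [Nat.factorial_succ]
        push_cast
        have : (1 : ℤ) ≤ n := by exact_mod_cast hn
        nlinarith [Nat.factorial_pos n]
      calc _ ≤ 2 * (n ! : ℤ) * (b : ℤ) ^ n := by linarith
        _ ≤ ((n + 1) ! : ℤ) * (b : ℤ) ^ (n + 1) := by gcongr; omega

lemma descFactorial_mul_factorial {k l μ h : ℕ} (hh : h ≤ k * l) :
    (k * l + μ).descFactorial (k * l - h) * (h + μ) ! = (k * l + μ) ! := by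
  have := Nat.factorial_mul_descFactorial (show k * l - h ≤ k * l + μ by omega)
  rw [show k * l + μ - (k * l - h) = h + μ by omega] at this
  linarith

lemma abs_padePoly_eval_one_le {k : ℕ} (hk : 1 ≤ k) {α : Fin k → ℤ} (hα : ∀ j, α j ≠ 0) (l : ℕ)
    {μ : ℕ} (hμ : μ ≤ k) (i : Fin (k + 1)) :
    |(padePoly α l μ i).eval 1| ≤
      ((k * l + μ) ! : ℤ) * (2 * (maxAbs α : ℤ)) ^ (k * l) * (maxAbs α : ℤ) ^ k := by
  have ha : (1 : ℤ) ≤ maxAbs α := by exact_mod_cast one_le_maxAbs hk hα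
  have key : ∀ u : ℕ → ℤ, (∀ h ≤ k * l, |u h| ≤ ((h + μ) ! : ℤ) * (maxAbs α : ℤ) ^ (h + μ)) →
      |∑ h ∈ Finset.range (k * l + 1), padeCoeff α l μ h * u h| ≤
        ((k * l + μ) ! : ℤ) * (2 * (maxAbs α : ℤ)) ^ (k * l) * (maxAbs α : ℤ) ^ k := by
    intro u hu
    calc _ ≤ ∑ h ∈ Finset.range (k * l + 1), ((k * l + μ) ! : ℤ) * (maxAbs α : ℤ) ^ μ *
          (|(nodePoly α l).coeff h| * (maxAbs α : ℤ) ^ h) := by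
          refine (Finset.abs_sum_le_sum_abs _ _).trans (Finset.sum_le_sum fun h hh => ?_)
          have hh' : h ≤ k * l := by simpa [Nat.lt_succ_iff] using hh
          rw [padeCoeff, abs_mul, abs_mul, Nat.abs_cast]
          calc _ ≤ |(nodePoly α l).coeff h| * ((k * l + μ).descFactorial (k * l - h) : ℤ) *
                (((h + μ) ! : ℤ) * (maxAbs α : ℤ) ^ (h + μ)) := by gcongr; exact hu h hh'
            _ = _ := by
              rw [← descFactorial_mul_factorial hh']
              push_cast
              ring
      _ = ((k * l + μ) ! : ℤ) * (maxAbs α : ℤ) ^ μ *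
          ∑ h ∈ Finset.range (k * l + 1), |(nodePoly α l).coeff h| * (maxAbs α : ℤ) ^ h := by
        rw [Finset.mul_sum]
      _ ≤ ((k * l + μ) ! : ℤ) * (maxAbs α : ℤ) ^ k * (2 * (maxAbs α : ℤ)) ^ (k * l) := by
        gcongr
        exact sum_abs_coeff_nodePoly_mul_le α l
      _ = _ := by ring
  cases i using Fin.cases with
  | zero =>
    have h1 : (padePoly α l μ 0).eval 1 =
        ∑ h ∈ Finset.range (k * l + 1), padeCoeff α l μ h * 1 := by
      simp [padePoly, Polynomial.eval_finsetSum]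
    rw [h1]
    refine key _ fun h _ => ?_
    rw [abs_one]
    exact one_le_mul_of_one_le_of_one_le (by exact_mod_cast Nat.factorial_pos _) (one_le_pow₀ ha)
  | succ j =>
    have h1 : (padePoly α l μ j.succ).eval 1 = ∑ h ∈ Finset.range (k * l + 1), padeCoeff α l μ h *
        ∑ i ∈ Finset.range (h + μ), (i ! : ℤ) * α j ^ i := by
      simp [padePoly, Polynomial.eval_finsetSum]
    rw [h1]
    refine key _ fun h _ => sum_factorial_mul_pow_le (one_le_maxAbs hk hα) ?_ _
    rw [Int.abs_eq_natAbs]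
    exact_mod_cast natAbs_le_maxAbs α j

lemma norm_coeff_mul_le {p : ℕ} [Fact p.Prime] {M : ℝ} (hM : 0 ≤ M) {P Q : Polynomial ℤ} {d e : ℕ}
    (hP : ∀ n, ‖(P.coeff n : ℚ_[p])‖ * M ^ n ≤ M ^ d)
    (hQ : ∀ n, ‖(Q.coeff n : ℚ_[p])‖ * M ^ n ≤ M ^ e) (n : ℕ) :
    ‖((P * Q).coeff n : ℚ_[p])‖ * M ^ n ≤ M ^ (d + e) := by
  rcases hM.eq_or_lt with rfl | hM'
  · rcases Nat.eq_zero_or_pos n with rfl | hn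
    · have h1 := hP 0
      have h2 := hQ 0
      rw [Polynomial.mul_coeff_zero]
      push_cast
      rw [norm_mul, pow_add]
      simp only [pow_zero, mul_one] at h1 h2 ⊢
      gcongr
    · rw [zero_pow hn.ne', mul_zero]
      positivity
  · rw [← le_div_iff₀ (by positivity), Polynomial.coeff_mul]
    push_cast
    refine IsUltrametricDist.norm_sum_le_of_forall_le_of_nonneg (by positivity) fun x hx => ?_
    rw [le_div_iff₀ (by positivity), ← Finset.HasAntidiagonal.mem_antidiagonal.mp hx, norm_mul, pow_add, pow_add]
    calc _ = (‖(P.coeff x.1 : ℚ_[p])‖ * M ^ x.1) * (‖(Q.coeff x.2 : ℚ_[p])‖ * M ^ x.2) := by ring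
      _ ≤ _ := by gcongr; exacts [hP _, hQ _]

lemma norm_coeff_one_le (p : ℕ) [Fact p.Prime] (M : ℝ) (n : ℕ) :
    ‖((1 : Polynomial ℤ).coeff n : ℚ_[p])‖ * M ^ n ≤ M ^ 0 := by
  rw [Polynomial.coeff_one]
  split_ifs with h
  · simp [h]
  · simp

lemma norm_coeff_pow_le {p : ℕ} [Fact p.Prime] {M : ℝ} (hM : 0 ≤ M) {P : Polynomial ℤ} {d : ℕ}
    (hP : ∀ n, ‖(P.coeff n : ℚ_[p])‖ * M ^ n ≤ M ^ d) (l n : ℕ) :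
    ‖((P ^ l).coeff n : ℚ_[p])‖ * M ^ n ≤ M ^ (d * l) := by
  induction l generalizing n with
  | zero => exact norm_coeff_one_le p M n
  | succ l ih => rw [pow_succ, mul_add, mul_one]; exact norm_coeff_mul_le hM ih hP n

lemma norm_coeff_prod_le {p : ℕ} [Fact p.Prime] {M : ℝ} (hM : 0 ≤ M) {ι : Type*} (s : Finset ι)
    {P : ι → Polynomial ℤ} {d : ι → ℕ} (hP : ∀ i n, ‖((P i).coeff n : ℚ_[p])‖ * M ^ n ≤ M ^ d i)
    (n : ℕ) : ‖((∏ i ∈ s, P i).coeff n : ℚ_[p])‖ * M ^ n ≤ M ^ (∑ i ∈ s, d i) := by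
  classical
  induction s using Finset.induction_on generalizing n with
  | empty => exact norm_coeff_one_le p M n
  | insert i s hi ih =>
    rw [Finset.prod_insert hi, Finset.sum_insert hi]
    exact norm_coeff_mul_le hM (hP i) ih n

lemma norm_coeff_nodePoly_le {p : ℕ} [Fact p.Prime] {M : ℝ} (hM : 0 ≤ M) {k : ℕ} {α : Fin k → ℤ}
    (hα : ∀ j, ‖(α j : ℚ_[p])‖ ≤ M) (l n : ℕ) :
    ‖((nodePoly α l).coeff n : ℚ_[p])‖ * M ^ n ≤ M ^ (k * l) := by
  have h := norm_coeff_prod_le (p := p) hM Finset.univ (P := fun j => (Polynomial.X - Polynomial.C (α j)) ^ l)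
    (d := fun _ => 1 * l) (fun j n => norm_coeff_pow_le hM (fun n => ?_) l n) n
  · simpa [nodePoly] using h
  · rcases n with _ | _ | n
    · simpa using hα j
    · rw [Polynomial.coeff_sub, Polynomial.coeff_X, Polynomial.coeff_C]
      simp
    · rw [Polynomial.coeff_sub, Polynomial.coeff_X, Polynomial.coeff_C]
      simpa using hM

lemma norm_padeRem_le {p : ℕ} [Fact p.Prime] {M : ℝ} (hM : 0 ≤ M) {k : ℕ} {α : Fin k → ℤ}
    (hα : ∀ j, ‖(α j : ℚ_[p])‖ ≤ M) (l μ : ℕ) (j : Fin k) (r : ℕ) :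
    ‖(padeRem α l μ j r : ℚ_[p])‖ ≤ M ^ (k * l) * M ^ (μ + r) := by
  rw [padeRem]
  push_cast
  refine IsUltrametricDist.norm_sum_le_of_forall_le_of_nonneg (by positivity) fun h _ => ?_
  have h1 : ‖(((h + μ + r).choose r : ℕ) : ℚ_[p])‖ ≤ 1 := by
    exact_mod_cast Padic.norm_int_le_one ((h + μ + r).choose r : ℤ)
  rw [norm_mul, norm_mul, norm_pow]
  calc _ ≤ ‖((nodePoly α l).coeff h : ℚ_[p])‖ * 1 * M ^ (h + μ + r) := by gcongr; exact hα j
    _ = (‖((nodePoly α l).coeff h : ℚ_[p])‖ * M ^ h) * M ^ (μ + r) := by ring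
    _ ≤ _ := by gcongr; exact norm_coeff_nodePoly_le hM hα l h

lemma norm_factorial_le (p : ℕ) [hp : Fact p.Prime] (n : ℕ) :
    ‖(n ! : ℚ_[p])‖ ≤ (p : ℝ) ^ (-((n / p : ℕ) : ℤ)) := by
  have h : (p : ℤ) ^ (n / p) ∣ (n ! : ℤ) := by
    exact_mod_cast (pow_dvd_pow p (div_le_factorization_factorial hp.out n)).trans
      (Nat.ordProj_dvd _ _)
  exact_mod_cast (Padic.norm_int_le_pow_iff_dvd (n ! : ℤ) (n / p)).mpr (by exact_mod_cast h)

lemma tendsto_norm_factorial (p : ℕ) [hp : Fact p.Prime] :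
    Tendsto (fun n : ℕ => ‖(n ! : ℚ_[p])‖) atTop (nhds 0) := by
  have h1 : (1 : ℝ) < p := by exact_mod_cast hp.out.one_lt
  have h2 : Tendsto (fun n : ℕ => ((p : ℝ)⁻¹) ^ (n / p)) atTop (nhds 0) :=
    (tendsto_pow_atTop_nhds_zero_of_lt_one (by positivity) (inv_lt_one_of_one_lt₀ h1)).comp
      (Nat.tendsto_div_const_atTop hp.out.ne_zero)
  refine squeeze_zero (fun _ => norm_nonneg _) (fun n => ?_) h2
  rw [inv_pow, ← zpow_natCast, ← zpow_neg]
  exact norm_factorial_le p n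

lemma summable_eulerF (p : ℕ) [hp : Fact p.Prime] (t : ℤ) :
    Summable fun n : ℕ => (n ! : ℚ_[p]) * (t : ℚ_[p]) ^ n := by
  refine NonarchimedeanAddGroup.summable_of_tendsto_cofinite_zero ?_
  rw [Nat.cofinite_eq_atTop, tendsto_zero_iff_norm_tendsto_zero]
  refine squeeze_zero (fun _ => norm_nonneg _) (fun n => ?_) (tendsto_norm_factorial p)
  rw [norm_mul, norm_pow]
  exact mul_le_of_le_one_right (norm_nonneg _) (pow_le_one₀ (norm_nonneg _) (Padic.norm_int_le_one t))

lemma padePoly_zero_mul_eulerF_sub (p : ℕ) [Fact p.Prime] {k : ℕ} (α : Fin k → ℤ) (l μ : ℕ)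
    (j : Fin k) :
    (((padePoly α l μ 0).eval 1 : ℤ) : ℚ_[p]) * eulerF p (α j) - (((padePoly α l μ j.succ).eval 1 : ℤ) : ℚ_[p]) =
      ∑' r : ℕ, ((((k * l + μ) ! * r ! : ℤ) * padeRem α l μ j r : ℤ) : ℚ_[p]) := by
  have h0 : (padePoly α l μ 0).eval 1 = ∑ h ∈ Finset.range (k * l + 1), padeCoeff α l μ h := by
    simp [padePoly, Polynomial.eval_finsetSum]
  have h1 : (padePoly α l μ j.succ).eval 1 = ∑ h ∈ Finset.range (k * l + 1), padeCoeff α l μ h *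
      ∑ i ∈ Finset.range (h + μ), (i ! : ℤ) * α j ^ i := by
    simp [padePoly, Polynomial.eval_finsetSum]
  have hs := summable_eulerF p (α j)
  have hs' : ∀ s : ℕ, Summable fun r : ℕ => ((s + r) ! : ℚ_[p]) * (α j : ℚ_[p]) ^ (s + r) := fun s => by
    simpa [add_comm] using (summable_nat_add_iff s).mpr hs
  have h2 : ∀ s : ℕ, eulerF p (α j) - ∑ i ∈ Finset.range s, (i ! : ℚ_[p]) * (α j : ℚ_[p]) ^ i =
      ∑' r : ℕ, ((s + r) ! : ℚ_[p]) * (α j : ℚ_[p]) ^ (s + r) := fun s => by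
    rw [eulerF, ← hs.sum_add_tsum_nat_add s, add_sub_cancel_left]
    simp only [add_comm s]
  rw [h0, h1]
  push_cast
  rw [Finset.sum_mul, ← Finset.sum_sub_distrib]
  have h3 : ∀ r : ℕ, ((k * l + μ) ! : ℚ_[p]) * (r ! : ℚ_[p]) * (padeRem α l μ j r : ℚ_[p]) =
      ∑ h ∈ Finset.range (k * l + 1), (padeCoeff α l μ h : ℚ_[p]) *
        (((h + μ + r) ! : ℚ_[p]) * (α j : ℚ_[p]) ^ (h + μ + r)) := fun r => by
    exact_mod_cast congrArg (Int.cast : ℤ → ℚ_[p]) (sum_padeCoeff_mul_factorial α l μ j r).symm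
  simp only [h3]
  rw [Summable.tsum_finsetSum fun h _ => (hs' (h + μ)).mul_left _]
  refine Finset.sum_congr rfl fun h _ => ?_
  rw [tsum_mul_left, ← h2]
  ring

lemma norm_padePoly_zero_mul_eulerF_sub_le {p : ℕ} [Fact p.Prime] {M : ℝ} (hM : 0 ≤ M) (hM1 : M ≤ 1)
    {k : ℕ} {α : Fin k → ℤ} (hα : ∀ j, ‖(α j : ℚ_[p])‖ ≤ M) (l μ : ℕ) (j : Fin k) :
    ‖(((padePoly α l μ 0).eval 1 : ℤ) : ℚ_[p]) * eulerF p (α j) - (((padePoly α l μ j.succ).eval 1 : ℤ) : ℚ_[p])‖ ≤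
      ‖((k * l) ! : ℚ_[p])‖ * ‖(l ! : ℚ_[p])‖ * M ^ ((k + 1) * l) := by
  have hdvd : ∀ {a b : ℕ}, a ≤ b → ‖(b ! : ℚ_[p])‖ ≤ ‖(a ! : ℚ_[p])‖ := fun {a b} hab => by
    obtain ⟨c, hc⟩ := Nat.factorial_dvd_factorial hab
    rw [hc, Nat.cast_mul, norm_mul]
    exact mul_le_of_le_one_right (norm_nonneg _) (by exact_mod_cast Padic.norm_int_le_one (c : ℤ))
  rw [padePoly_zero_mul_eulerF_sub]
  refine (IsUltrametricDist.norm_tsum_le _).trans (ciSup_le fun r => ?_)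
  rcases lt_or_ge r l with hr | hr
  · rw [padeRem_eq_zero α μ j hr]
    simp only [mul_zero, Int.cast_zero, norm_zero]
    positivity
  · push_cast
    rw [norm_mul, norm_mul]
    have h1 : ‖(padeRem α l μ j r : ℚ_[p])‖ ≤ M ^ ((k + 1) * l) := by
      refine (norm_padeRem_le hM hα l μ j r).trans ?_
      rw [← pow_add]
      exact pow_le_pow_of_le_one hM hM1 (by linarith [Nat.zero_le μ, add_mul k 1 l, one_mul l])
    gcongr
    · exact hdvd (by omega)
    · exact hdvd hr

lemma log_padicNorm_natCast {p : ℕ} (hp : p.Prime) {n : ℕ} (hn : n ≠ 0) :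
    Real.log ((padicNorm p (n : ℚ) : ℚ) : ℝ) = -(n.factorization p * Real.log p) := by
  have := Fact.mk hp
  rw [padicNorm.eq_zpow_of_nonzero (by exact_mod_cast hn), padicValRat.of_nat,
    Nat.factorization_def n hp]
  rw [Rat.cast_zpow, Rat.cast_natCast, Real.log_zpow, Int.cast_neg, Int.cast_natCast, neg_mul]

lemma sum_factorization_mul_log_le (n : ℕ) (S : Finset ℕ) :
    ∑ p ∈ S, (n.factorization p : ℝ) * Real.log p ≤ Real.log n := by
  classical
  rw [Real.log_nat_eq_sum_factorization, Finsupp.sum]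
  calc _ ≤ ∑ p ∈ S ∪ n.factorization.support, (n.factorization p : ℝ) * Real.log p :=
        Finset.sum_le_sum_of_subset_of_nonneg Finset.subset_union_left fun p _ _ => by positivity
    _ = _ := (Finset.sum_subset Finset.subset_union_right fun p _ hp => by
        rw [Finsupp.notMem_support_iff.mp hp]; simp).symm

lemma norm_intCast_eq_padicNorm_natAbs (p : ℕ) [Fact p.Prime] (z : ℤ) :
    ‖(z : ℚ_[p])‖ = ((padicNorm p (z.natAbs : ℚ) : ℚ) : ℝ) := by
  have h : ‖(z : ℚ_[p])‖ = ‖((z.natAbs : ℤ) : ℚ_[p])‖ := by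
    rcases Int.natAbs_eq z with h | h
    · rw [← h]
    · conv_lhs => rw [h]
      push_cast
      rw [norm_neg]
  rw [h, Int.cast_natCast, ← Padic.eq_padicNorm, Rat.cast_natCast]

lemma norm_intCast_le_padicMaxAbs (p : ℕ) [Fact p.Prime] {k : ℕ} (α : Fin k → ℤ) (j : Fin k) :
    ‖(α j : ℚ_[p])‖ ≤ padicMaxAbs p α := by
  have h := le_ciSup (f := fun j => ((padicNorm p ((α j : ℚ))) : ℝ)) (Set.finite_range _).bddAbove j
  have h2 := Padic.eq_padicNorm (p := p) (α j : ℚ)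
  push_cast at h2
  rw [h2]
  exact h

lemma padicMaxAbs_pos {p : ℕ} (hp : p.Prime) {k : ℕ} (hk : 1 ≤ k) {α : Fin k → ℤ}
    (hα : ∀ j, α j ≠ 0) : 0 < padicMaxAbs p α := by
  have := Fact.mk hp
  refine lt_of_lt_of_le ?_ (norm_intCast_le_padicMaxAbs p α ⟨0, hk⟩)
  rw [norm_pos_iff]
  exact_mod_cast hα _

lemma padicMaxAbs_le_one {p : ℕ} (hp : p.Prime) {k : ℕ} (hk : 1 ≤ k) (α : Fin k → ℤ) :
    padicMaxAbs p α ≤ 1 := by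
  have := Fact.mk hp
  have : Nonempty (Fin k) := ⟨⟨0, hk⟩⟩
  refine ciSup_le fun j => ?_
  exact_mod_cast padicNorm.of_int (α j)

/-- A nonvanishing criterion: if the archimedean size of the auxiliary form is beaten by the
`p`-adic sizes of the remainders, the linear form is bounded below for some `p`. -/
lemma exists_exp_neg_le_norm_linearForm {k : ℕ} (hk : 1 ≤ k) {α : Fin k → ℤ} (hα : ∀ j, α j ≠ 0)
    (hinj : Function.Injective α) {lam : Fin (k + 1) → ℤ} (hlam : ∃ i, lam i ≠ 0) {l : ℕ}
    (hl : 1 ≤ l) {H : ℝ} (hH : ∀ i, (|lam i| : ℝ) ≤ H) {S : Finset ℕ} (hS : ∀ p ∈ S, p.Prime) {U : ℝ}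
    (hU : Real.log (k + 1) + Real.log H + Real.log ((k * l + k) ! : ℕ) +
      (k * l : ℕ) * Real.log (2 * maxAbs α) + k * Real.log (maxAbs α) ≤ U)
    (hneg : U + (k + 1) * l * ∑ p ∈ S, Real.log (padicMaxAbs p α) <
      ∑ p ∈ S, (((k * l) ! : ℕ).factorization p : ℝ) * Real.log p +
      ∑ p ∈ S, ((l ! : ℕ).factorization p : ℝ) * Real.log p) :
    ∃ p ∈ S, ∃ _ : Fact p.Prime, Real.exp (-U) ≤
      ‖(lam 0 : ℚ_[p]) + ∑ j : Fin k, (lam j.succ : ℚ_[p]) * eulerF p (α j)‖ := by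
  obtain ⟨μ, hμ, hW⟩ := exists_padePoly_eval_sum_ne_zero hα hinj (Nat.mul_pos hk hl) hlam
  set W : ℤ := ∑ i, (padePoly α l μ i).eval 1 * lam i with hWdef
  have hW' : W.natAbs ≠ 0 := Int.natAbs_ne_zero.mpr hW
  have ha : (1 : ℝ) ≤ maxAbs α := by exact_mod_cast one_le_maxAbs hk hα
  have hHpos : 0 < H := by
    obtain ⟨i, hi⟩ := hlam
    exact lt_of_lt_of_le (by positivity) (hH i)
  have hWU : Real.log W.natAbs ≤ U := by
    refine le_trans ?_ hU
    have h1 : (W.natAbs : ℝ) ≤ (k + 1) * H * ((k * l + k) ! : ℕ) *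
        (2 * maxAbs α : ℝ) ^ (k * l) * (maxAbs α : ℝ) ^ k := by
      have h2 : (W.natAbs : ℝ) = |(W : ℝ)| := by rw [Nat.cast_natAbs]; push_cast; rfl
      rw [h2, hWdef]
      push_cast
      refine (Finset.abs_sum_le_sum_abs _ _).trans ?_
      refine (Finset.sum_le_card_nsmul _ _ (((k * l + k) ! : ℕ) *
        (2 * maxAbs α : ℝ) ^ (k * l) * (maxAbs α : ℝ) ^ k * H) fun i _ => ?_).trans_eq ?_
      · rw [abs_mul]
        have h3 : |(((padePoly α l μ i).eval 1 : ℤ) : ℝ)| ≤ ((k * l + μ) ! : ℕ) *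
            (2 * maxAbs α : ℝ) ^ (k * l) * (maxAbs α : ℝ) ^ k := by
          exact_mod_cast abs_padePoly_eval_one_le hk hα l hμ i
        have h4 : (((k * l + μ) ! : ℕ) : ℝ) ≤ ((k * l + k) ! : ℕ) := by
          exact_mod_cast Nat.factorial_le (by omega)
        have h5 := hH i
        gcongr
        exact h3.trans (by gcongr)
      · rw [Finset.card_univ, Fintype.card_fin, nsmul_eq_mul]
        push_cast
        ring
    refine (Real.log_le_log (by exact_mod_cast Nat.pos_of_ne_zero hW') h1).trans_eq ?_
    have h6 : (((k * l + k) ! : ℕ) : ℝ) ≠ 0 := by exact_mod_cast Nat.factorial_ne_zero _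
    have h7 : (2 * maxAbs α : ℝ) ≠ 0 := by positivity
    rw [Real.log_mul (by positivity) (by positivity), Real.log_mul (by positivity) (by positivity),
      Real.log_mul (by positivity) h6, Real.log_mul (by positivity) (by positivity),
      Real.log_pow, Real.log_pow]
  obtain ⟨p, hpS, hp⟩ : ∃ p ∈ S, (W.natAbs.factorization p : ℝ) * Real.log p +
      (k + 1) * l * Real.log (padicMaxAbs p α) <
      (((k * l) ! : ℕ).factorization p : ℝ) * Real.log p +
      ((l ! : ℕ).factorization p : ℝ) * Real.log p := by
    refine Finset.exists_lt_of_sum_lt ?_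
    rw [Finset.sum_add_distrib, Finset.sum_add_distrib, ← Finset.mul_sum]
    linarith [sum_factorization_mul_log_le W.natAbs S]
  have hpp := hS p hpS
  have : Fact p.Prime := ⟨hpp⟩
  refine ⟨p, hpS, ‹_›, ?_⟩
  have hM := padicMaxAbs_pos hpp hk hα
  have hlognorm : ∀ z : ℤ, z ≠ 0 →
      Real.log ‖(z : ℚ_[p])‖ = -(z.natAbs.factorization p * Real.log p) := fun z hz => by
    rw [norm_intCast_eq_padicNorm_natAbs, log_padicNorm_natCast hpp (Int.natAbs_ne_zero.mpr hz)]
  have hlognat : ∀ n : ℕ, n ≠ 0 →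
      Real.log ‖(n : ℚ_[p])‖ = -(n.factorization p * Real.log p) := fun n hn => by
    simpa using hlognorm n (by exact_mod_cast hn)
  have hWpos : 0 < ‖(W : ℚ_[p])‖ := by
    rw [norm_pos_iff]
    exact_mod_cast hW
  have hnpos : ∀ n : ℕ, 0 < ‖(n ! : ℚ_[p])‖ := fun n => by
    rw [norm_pos_iff]
    exact_mod_cast Nat.factorial_ne_zero n
  have hlt : ‖((k * l) ! : ℚ_[p])‖ * ‖(l ! : ℚ_[p])‖ * padicMaxAbs p α ^ ((k + 1) * l) <
      ‖(W : ℚ_[p])‖ := by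
    have h1 := hnpos (k * l)
    have h2 := hnpos l
    rw [← Real.log_lt_log_iff (by positivity) hWpos, Real.log_mul (by positivity) (by positivity),
      Real.log_mul h1.ne' h2.ne', Real.log_pow, hlognorm W hW,
      hlognat _ (Nat.factorial_ne_zero _), hlognat _ (Nat.factorial_ne_zero _)]
    push_cast
    linarith
  set Lam : ℚ_[p] := (lam 0 : ℚ_[p]) + ∑ j : Fin k, (lam j.succ : ℚ_[p]) * eulerF p (α j) with hLam
  have hrem : ‖(((padePoly α l μ 0).eval 1 : ℤ) : ℚ_[p]) * Lam - W‖ < ‖(W : ℚ_[p])‖ := by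
    have h1 : (((padePoly α l μ 0).eval 1 : ℤ) : ℚ_[p]) * Lam - W = ∑ j : Fin k, (lam j.succ : ℚ_[p]) *
        ((((padePoly α l μ 0).eval 1 : ℤ) : ℚ_[p]) * eulerF p (α j) -
          (((padePoly α l μ j.succ).eval 1 : ℤ) : ℚ_[p])) := by
      rw [hLam, hWdef]
      push_cast
      rw [Fin.sum_univ_succ, mul_add, Finset.mul_sum]
      rw [add_sub_add_left_eq_sub, ← Finset.sum_sub_distrib]
      exact Finset.sum_congr rfl fun j _ => by ring
    rw [h1]
    refine lt_of_le_of_lt (IsUltrametricDist.norm_sum_le_of_forall_le_of_nonneg (by positivity)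
      fun j _ => ?_) hlt
    rw [norm_mul]
    refine (mul_le_of_le_one_left (norm_nonneg _) (Padic.norm_int_le_one _)).trans ?_
    exact norm_padePoly_zero_mul_eulerF_sub_le hM.le (padicMaxAbs_le_one hpp hk α)
      (norm_intCast_le_padicMaxAbs p α) l μ j
  have hle : ‖(W : ℚ_[p])‖ ≤ ‖Lam‖ := by
    by_contra! hcon
    have h2 : ‖(((padePoly α l μ 0).eval 1 : ℤ) : ℚ_[p]) * Lam‖ < ‖(W : ℚ_[p])‖ := by
      rw [norm_mul]
      exact lt_of_le_of_lt (mul_le_of_le_one_left (norm_nonneg _) (Padic.norm_int_le_one _)) hcon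
    have h3 := IsUltrametricDist.norm_add_le_max
      ((((padePoly α l μ 0).eval 1 : ℤ) : ℚ_[p]) * Lam)
      (-((((padePoly α l μ 0).eval 1 : ℤ) : ℚ_[p]) * Lam - W))
    rw [norm_neg, ← sub_eq_add_neg, sub_sub_cancel] at h3
    exact absurd (max_lt h2 hrem) (not_lt.mpr h3)
  refine le_trans ?_ hle
  rw [← Real.le_log_iff_exp_le hWpos, hlognorm W hW, neg_le_neg_iff]
  refine le_trans ?_ hWU
  simpa using sum_factorization_mul_log_le W.natAbs {p}

lemma log_le_div_of_large {L : ℝ} (hL : 1866 ≤ L) : Real.log L ≤ L / 70 := by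
  have h1 : Real.log L = Real.log (L / 1866) + Real.log 1866 := by
    rw [← Real.log_mul (by positivity) (by norm_num)]
    congr 1
    ring
  have h2 := Real.log_le_sub_one_of_pos (show (0 : ℝ) < L / 1866 by positivity)
  have h3 : Real.log 1866 ≤ 8 := by
    rw [Real.log_le_iff_le_exp (by norm_num)]
    refine exp_lower_bound (by norm_num) 20 ?_
    norm_num [Finset.sum_range_succ, Nat.factorial]
  rw [h1]
  linarith

lemma log_sq_lt_of_large {L : ℝ} (hL : 1866 ≤ L) : Real.log L ^ 2 < L := by
  have hy : (43 : ℝ) ≤ √L := Real.le_sqrt_of_sq_le (by linarith)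
  have h1 : Real.log (√L) = Real.log (√L / 43) + Real.log 43 := by
    rw [← Real.log_mul (by positivity) (by norm_num)]
    congr 1
    ring
  have h2 := Real.log_le_sub_one_of_pos (show (0 : ℝ) < √L / 43 by positivity)
  have h3 : Real.log 43 ≤ 4 := by
    rw [Real.log_le_iff_le_exp (by norm_num)]
    refine exp_lower_bound (by norm_num) 12 ?_
    norm_num [Finset.sum_range_succ, Nat.factorial]
  have h4 : Real.log L ≤ 8 * √L / 43 := by
    rw [Real.log_sqrt (by linarith)] at h1
    linarith
  have h5 : 0 ≤ Real.log L := Real.log_nonneg (by linarith)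
  calc Real.log L ^ 2 ≤ (8 * √L / 43) ^ 2 := by gcongr
    _ = 64 / 1849 * √L ^ 2 := by ring
    _ = 64 / 1849 * L := by rw [Real.sq_sqrt (by linarith)]
    _ < L := by linarith

lemma log_factorial_le {n : ℕ} (hn : 1 ≤ n) :
    Real.log (n ! : ℕ) ≤ n * Real.log n - n + Real.log n + 1 := by
  induction n, hn using Nat.le_induction with
  | base => simp
  | succ n hn ih =>
    have hn' : (0 : ℝ) < n := by exact_mod_cast hn
    have h1 : Real.log n ≤ Real.log (n + 1 : ℝ) - 1 / (n + 1) := by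
      have h2 := Real.log_le_sub_one_of_pos (show (0 : ℝ) < n / (n + 1) by positivity)
      rw [Real.log_div (by positivity) (by positivity)] at h2
      have h3 : (n : ℝ) / (n + 1) - 1 = -(1 / (n + 1)) := by field_simp; ring
      linarith
    have h4 : (n + 1 : ℝ) * Real.log n ≤ (n + 1) * Real.log (n + 1 : ℝ) - 1 := by
      calc _ ≤ (n + 1 : ℝ) * (Real.log (n + 1 : ℝ) - 1 / (n + 1)) := by gcongr
        _ = _ := by field_simp
    rw [Nat.factorial_succ, Nat.cast_mul, Real.log_mul (by positivity) (by positivity)]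
    push_cast
    linarith

lemma log_factorial_add_le {k l : ℕ} (hk : 1 ≤ k) (hl : 1 ≤ l) :
    Real.log ((k * l + k) ! : ℕ) ≤ (k * l : ℝ) * Real.log (k * l) - k * l +
      (k + 1) * Real.log (k * (l + 1)) + 1 := by
  have hkl : 1 ≤ k * l := Nat.mul_pos hk hl
  have hk' : (1 : ℝ) ≤ k := by exact_mod_cast hk
  have hl' : (1 : ℝ) ≤ l := by exact_mod_cast hl
  have h1 : (((k * l + k) ! : ℕ) : ℝ) ≤ ((k * l) ! : ℕ) * (k * (l + 1)) ^ k := by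
    have := Nat.factorial_mul_pow_le_factorial (m := k * l) (n := k)
    have h2 : (k * l + k) ! = (k * l) ! * (k * l + 1).ascFactorial k := by
      rw [Nat.factorial_mul_ascFactorial]
    have h3 : (k * l + 1).ascFactorial k ≤ (k * l + k) ^ k := by
      simpa using Nat.ascFactorial_le_pow_add (k * l) k
    rw [h2]
    have h4 : ((k * l + k : ℕ) : ℝ) = k * (l + 1) := by push_cast; ring
    rw [← h4]
    exact_mod_cast Nat.mul_le_mul_left _ h3
  have h5 := log_factorial_le hkl
  push_cast at h5
  refine (Real.log_le_log (by positivity) h1).trans ?_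
  rw [Real.log_mul (by positivity) (by positivity), Real.log_pow]
  have h6 : Real.log (k * l) ≤ Real.log (k * (l + 1)) :=
    Real.log_le_log (by positivity) (by nlinarith)
  linarith

/-- The choice of the approximation order makes the auxiliary form too small. -/
lemma lt_of_order_choice {k l L a T D C Q₁ Q₂ ρ F : ℝ} (hk : 1 ≤ k) (hL : 1866 ≤ L) (ha : 1 ≤ a)
    (haL : a ≤ L) (hkL : k ≤ 2 * L) (hC : 10 * k ≤ C) (hD : 0 < D)
    (hl : L + 2 * C * L / (D * Real.log L) < l) (hl' : l ≤ 2 * L + 1)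
    (hF : F ≤ k * l * Real.log (k * l) - k * l + (k + 1) * Real.log (k * (l + 1)) + 1)
    (hρ : k / (k + 1) ≤ ρ) (hQ₁ : ρ * (k * l * (Real.log (k * l) - T)) ≤ Q₁) (hQ₁' : 0 ≤ Q₁)
    (hQ₂ : ρ * (l * (Real.log l - T)) ≤ Q₂) (hQ₂' : 0 ≤ Q₂) :
    Real.log (k + 1) + L * D + F + k * Real.log a - l * D - l * k * (Real.log k + T - 1) <
      Q₁ + Q₂ := by
  have hx : 0 < Real.log L := Real.log_pos (by linarith)
  have hδ : 0 < 2 * C * L / (D * Real.log L) := by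
    have : 0 < C := by linarith
    positivity
  have hlpos : 0 < l := by linarith
  have hkpos : 0 < k := by linarith
  have hρ' : 0 ≤ ρ := le_trans (by positivity) hρ
  have hlogk : 0 ≤ Real.log k := Real.log_nonneg hk
  have hkl : Real.log (k * l) = Real.log k + Real.log l := Real.log_mul hkpos.ne' hlpos.ne'
  have key1 : k * l * (Real.log l - T) ≤ Q₁ + Q₂ := by
    rcases le_total (Real.log l) T with h | h
    · have : k * l * (Real.log l - T) ≤ 0 := mul_nonpos_of_nonneg_of_nonpos (by positivity) (by linarith)
      linarith
    · have h1 : 0 ≤ Real.log l - T := by linarith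
      have h2 : k / (k + 1) * (k * l * (Real.log l - T)) ≤ Q₁ := by
        refine le_trans ?_ hQ₁
        rw [hkl]
        have : Real.log l - T ≤ Real.log k + Real.log l - T := by linarith
        gcongr
      have h3 : k / (k + 1) * (l * (Real.log l - T)) ≤ Q₂ := le_trans (by gcongr) hQ₂
      calc _ = k / (k + 1) * (k * l * (Real.log l - T)) + k / (k + 1) * (l * (Real.log l - T)) := by
            field_simp
        _ ≤ _ := add_le_add h2 h3
  have hpow : ∀ n : ℕ, Real.log (L ^ n) = n * Real.log L := fun n => Real.log_pow _ _
  have e1 : Real.log (k + 1) ≤ 2 * Real.log L := by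
    have := hpow 2
    push_cast at this
    rw [← this]
    exact Real.log_le_log (by positivity) (by nlinarith)
  have e2 : Real.log a ≤ Real.log L := Real.log_le_log (by linarith) haL
  have e3 : Real.log (k * (l + 1)) ≤ 3 * Real.log L := by
    have := hpow 3
    push_cast at this
    rw [← this]
    refine Real.log_le_log (by positivity) ?_
    calc k * (l + 1) ≤ (2 * L) * (2 * L + 1 + 1) := by gcongr
      _ ≤ L ^ 3 := by nlinarith [mul_pos (show 0 < L by linarith) (show 0 < L by linarith)]
  have hx1 : 1 ≤ Real.log L := by
    rw [Real.le_log_iff_exp_le (by linarith)]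
    linarith [Real.exp_one_lt_d9]
  have key2 : 20 * k * Real.log L < (l - L) * D := by
    have h1 : 2 * C * L / Real.log L < (l - L) * D := by
      have h2 : 2 * C * L / (D * Real.log L) < l - L := by linarith
      calc 2 * C * L / Real.log L = 2 * C * L / (D * Real.log L) * D := by field_simp
        _ < (l - L) * D := by gcongr
    refine lt_of_le_of_lt ?_ h1
    rw [le_div_iff₀ hx]
    have h3 := log_sq_lt_of_large hL
    calc 20 * k * Real.log L * Real.log L = 2 * (10 * k) * Real.log L ^ 2 := by ring
      _ ≤ 2 * C * L := by gcongr; linarith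
  have e4 : k * Real.log a ≤ k * Real.log L := by gcongr
  have e5 : (k + 1) * Real.log (k * (l + 1)) ≤ (k + 1) * (3 * Real.log L) := by gcongr
  have e6 : Real.log L ≤ k * Real.log L := le_mul_of_one_le_left hx.le hk
  rw [hkl] at hF
  nlinarith

/-- The archimedean size of the auxiliary form is dominated by the final exponent. -/
lemma size_lt_exponent {k l L a D C F : ℝ} (hk : 1 ≤ k) (hL : 1866 ≤ L) (ha : 1 ≤ a)
    (haL : a ≤ L) (hkL : k ≤ 2 * L) (hC : 0 ≤ C) (hD : 0 < D) (hCD : 2 * C / D ≤ Real.log L)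
    (hl0 : 0 ≤ l) (hl : l ≤ L + 2 * C * L / (D * Real.log L) + 1)
    (hF : F ≤ k * (l + 1) * Real.log (k * (l + 1)) - k * (l + 1) + Real.log (k * (l + 1)) + 1) :
    Real.log (k + 1) + L * D + F + k * l * Real.log (2 * a) + k * Real.log a <
      2 * k * L * Real.log L + (2 * k ^ 2 + 3 * k * Real.log 2 - 2 * k) * L + 4 * k * C * L / D +
        (0.015 * k ^ 2 + 0.235 * k + 1.034) * (L * D) := by
  have hx : 0 < Real.log L := Real.log_pos (by linarith)
  have hL0 : 0 < L := by linarith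
  set x := Real.log L with hxdef
  set δ : ℝ := 2 * C / (D * x) with hδdef
  have hδ0 : 0 ≤ δ := by positivity
  have hδ1 : δ ≤ 1 := by
    rw [hδdef, ← div_div, div_le_one hx]
    exact hCD
  have hl1 : l + 1 ≤ L * (1 + δ) + 2 := by
    have : 2 * C * L / (D * x) = L * δ := by rw [hδdef]; ring
    linarith
  have h4 : 4 * k * C * L / D = 2 * k * L * δ * x := by
    rw [hδdef]
    field_simp
    ring
  have hlp : 0 < l + 1 := by linarith
  have hkp : 0 < k := by linarith
  have hlogk : 0 ≤ Real.log k := Real.log_nonneg hk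
  have hpow : ∀ n : ℕ, Real.log (L ^ n) = n * Real.log L := fun n => Real.log_pow _ _
  have e1 : Real.log (k + 1) ≤ 2 * x := by
    have := hpow 2
    push_cast at this
    rw [hxdef, ← this]
    exact Real.log_le_log (by positivity) (by nlinarith)
  have e1' : Real.log k ≤ 2 * x := (Real.log_le_log hkp (by linarith)).trans e1
  have e2 : Real.log a ≤ x := Real.log_le_log (by linarith) haL
  have hl2 : l + 1 ≤ 2 * L + 2 := by nlinarith
  have e3 : Real.log (k * (l + 1)) ≤ 3 * x := by
    have := hpow 3
    push_cast at this
    rw [hxdef, ← this]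
    refine Real.log_le_log (by positivity) ?_
    calc k * (l + 1) ≤ (2 * L) * (2 * L + 2) := by gcongr
      _ ≤ L ^ 3 := by nlinarith [mul_pos (show 0 < L by linarith) (show 0 < L by linarith)]
  have e4 : Real.log (l + 1) ≤ x + δ + 2 / L := by
    have h1 : Real.log (l + 1) ≤ Real.log (L * (1 + δ + 2 / L)) := by
      refine Real.log_le_log hlp (hl1.trans_eq ?_)
      field_simp
    rw [Real.log_mul hL0.ne' (by positivity)] at h1
    have := Real.log_le_sub_one_of_pos (show 0 < 1 + δ + 2 / L by positivity)
    linarith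
  have e5 : Real.log (2 * a) ≤ Real.log 2 + x := by
    rw [Real.log_mul (by norm_num) (by linarith)]
    linarith
  have hlog2 := Real.log_two_gt_d9
  have hlog2' := Real.log_two_lt_d9
  have hx1 : 1 ≤ x := by
    rw [hxdef, Real.le_log_iff_exp_le (by linarith)]
    linarith [Real.exp_one_lt_d9]
  have e6 : k * l * Real.log (2 * a) ≤ k * (l + 1) * (Real.log 2 + x) := by
    have : 0 ≤ Real.log (2 * a) := Real.log_nonneg (by linarith)
    gcongr
    linarith
  have e7 : k * (l + 1) * Real.log (k * (l + 1)) ≤ k * (l + 1) * (Real.log k + (x + δ + 2 / L)) := by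
    rw [Real.log_mul hkp.ne' hlp.ne']
    gcongr
  have h2L : 2 / L ≤ 1 := by rw [div_le_one hL0]; linarith
  have h2L0 : 0 < 2 / L := by positivity
  set G := 2 * x + Real.log k + Real.log 2 - 1 + δ + 2 / L with hG
  have e8 : k * (l + 1) * G ≤ k * (L * (1 + δ) + 2) * G := by
    have : 0 ≤ G := by rw [hG]; linarith
    gcongr
  have e9 : k * (L * (1 + δ) + 2) * G = 2 * k * L * x + 2 * k * L * δ * x +
      k * L * ((1 + δ) * (Real.log k + Real.log 2 - 1 + δ)) + 2 * k * (1 + δ) + 2 * k * G := by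
    rw [hG]
    field_simp
    ring
  have e10 : (1 + δ) * (Real.log k + Real.log 2 - 1 + δ) ≤ 2 * k + 3 * Real.log 2 - 2 - 0.69 := by
    have h1 := Real.log_le_sub_one_of_pos hkp
    have h2 : (1 + δ) * (Real.log k + Real.log 2 - 1 + δ) ≤ (1 + δ) * (k - 2 + Real.log 2 + δ) := by
      gcongr
      linarith
    have h3 := mul_nonneg hδ0 (sub_nonneg.mpr hδ1)
    have h4 := mul_nonneg (sub_nonneg.mpr hδ1) hkp.le
    have h5 := mul_nonneg (sub_nonneg.mpr hδ1) (show 0 ≤ Real.log 2 by linarith)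
    linarith
  have e11 : k * L * ((1 + δ) * (Real.log k + Real.log 2 - 1 + δ)) ≤
      k * L * (2 * k + 3 * Real.log 2 - 2 - 0.69) := by gcongr
  have e12 : k * G ≤ k * (4 * x + 3) := by gcongr; rw [hG]; linarith
  have e13 : k * Real.log a ≤ k * x := by gcongr
  have e14 : x ≤ k * x := le_mul_of_one_le_left hx.le hk
  have e15 : k * (1 + δ) ≤ k * 2 := by gcongr; linarith
  have e16 : k * x ≤ k * (L / 70) := by gcongr; exact log_le_div_of_large hL
  have e17 : k * 1866 ≤ k * L := by gcongr
  have e18 : L * D ≤ (0.015 * k ^ 2 + 0.235 * k + 1.034) * (L * D) :=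
    le_mul_of_one_le_left (by positivity) (by linarith [sq_nonneg k])
  have e19 : F + k * l * Real.log (2 * a) ≤ k * (l + 1) * G + 3 * x + 1 := by
    have : k * (l + 1) * G = k * (l + 1) * (Real.log k + (x + δ + 2 / L)) - k * (l + 1) +
      k * (l + 1) * (Real.log 2 + x) := by rw [hG]; ring
    linarith
  rw [h4]
  linarith

lemma card_le_two_mul_maxAbs {k : ℕ} {α : Fin k → ℤ} (hα : ∀ j, α j ≠ 0)
    (hinj : Function.Injective α) : k ≤ 2 * maxAbs α := by
  have h1 : (Finset.univ.image α) ⊆ (Finset.Icc (-(maxAbs α : ℤ)) (maxAbs α)).erase 0 := fun z hz => by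
    obtain ⟨j, -, rfl⟩ := Finset.mem_image.mp hz
    have := natAbs_le_maxAbs α j
    rw [Finset.mem_erase, Finset.mem_Icc]
    exact ⟨hα j, by omega, by omega⟩
  have h2 := Finset.card_le_card h1
  rw [Finset.card_image_of_injective _ hinj, Finset.card_univ, Fintype.card_fin,
    Finset.card_erase_of_mem (by simp), Int.card_Icc] at h2
  omega

lemma two_le_totient {m : ℕ} (hm : 3 ≤ m) : 2 ≤ m.totient := by
  obtain ⟨c, hc⟩ := Nat.totient_even (show 2 < m from hm)
  have := Nat.totient_pos.mpr (show 0 < m by omega)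
  omega

lemma log_c2val {k : ℕ} (hk : 1 ≤ k) {α : Fin k → ℤ} (hα : ∀ j, α j ≠ 0) {S : Finset ℕ}
    (hS : ∀ p ∈ S, p.Prime) : 0 < c2val k α S ∧ Real.log (c2val k α S) =
      k * Real.log (2 * maxAbs α) + (k + 1) * ∑ p ∈ S, Real.log (padicMaxAbs p α) := by
  have ha : (0 : ℝ) < maxAbs α := by exact_mod_cast one_le_maxAbs hk hα
  have hpos : ∀ p ∈ S, 0 < padicMaxAbs p α ^ (k + 1) := fun p hp =>
    pow_pos (padicMaxAbs_pos (hS p hp) hk hα) _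
  have h1 : c2val k α S = (2 * maxAbs α : ℝ) ^ k * ∏ p ∈ S, padicMaxAbs p α ^ (k + 1) := by
    rw [c2val, c1val, mul_pow]
    congr 1
    exact Finset.tprod_subtype S fun p => padicMaxAbs p α ^ (k + 1)
  have h2 := Finset.prod_pos hpos
  rw [h1]
  refine ⟨by positivity, ?_⟩
  rw [Real.log_mul (by positivity) h2.ne', Real.log_pow, Real.log_prod fun p hp => (hpos p hp).ne',
    Finset.mul_sum]
  congr 1
  refine Finset.sum_congr rfl fun p _ => ?_
  rw [Real.log_pow]
  push_cast
  ring

lemma logFactorialPart_le_sum {m : ℕ} {A : Finset ℕ} {n : ℕ} {S : Finset ℕ}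
    (hS : ∀ p ≤ n, p.Prime → p % m ∈ A → p ∈ S) :
    logFactorialPart m A n ≤ ∑ p ∈ S, ((n !).factorization p : ℝ) * Real.log p := by
  refine Finset.sum_le_sum_of_subset_of_nonneg (fun p hp => ?_) fun p _ _ => by positivity
  rw [Finset.mem_filter, Finset.mem_range] at hp
  exact hS p (by omega) hp.2.1 hp.2.2

/-- Explicit `p`-adic lower bound for the linear form, for some
prime `p ∈ R″ = R ∩ [2, 2k log H/D + 2k)`. -/
theorem statement2 (k m : ℕ) (hk : 1 ≤ k) (hm : 3 ≤ m)
    (lam : Fin (k + 1) → ℤ) (hlam : ∃ i, lam i ≠ 0)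
    (A : Finset ℕ) (hA : ∀ a ∈ A, a < m ∧ Nat.Coprime a m)
    (hAcard : (k * m.totient : ℝ) / (k + 1) ≤ A.card)
    (R : Set ℕ) (hR : R = {p : ℕ | p.Prime ∧ p % m ∈ A})
    (hRH : RH) (hGRH : GRH m)
    (α : Fin k → ℤ) (hα : ∀ j, α j ≠ 0) (hαinj : Function.Injective α)
    (R' : Set ℕ)
    (hR' : R' = R ∩ Set.Icc 2 (k * (max (max 1865 (m ^ m.totient)) (maxAbs α) + 2)))
    (hc2 : c2val k α R' <
      ((k : ℝ) * Real.exp (1 + 6.550 * m.totient) * (m : ℝ) ^ m.totient) ^ (-(k : ℤ)))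
    (D : ℝ) (hD : D = Dval m k α R')
    (H : ℝ) (hH : ∀ i, (|lam i| : ℝ) ≤ H)
    (hlogH : Real.log H / D ≥
      max (max 1866 ((m : ℝ) ^ m.totient + 1))
        (max ((maxAbs α : ℝ) + 1)
          (Real.exp (2 * (2.539 * k * m.totient + 5.724 * k + 0.054) / D) + 1)))
    (R'' : Set ℕ)
    (hR'' : R'' = R ∩ {p : ℕ | 2 ≤ p ∧ (p : ℝ) < 2 * k * Real.log H / D + 2 * k}) :
    ∃ p ∈ R'', ∃ _ : Fact p.Prime,
      H ^ (-(2 * k * Real.log (Real.log H) / D +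
            (-(2 * k) * Real.log D + 2 * k ^ 2 + 3 * k * Real.log 2 - 2 * k) / D +
            4 * k * (2.539 * k * m.totient + 5.724 * k + 0.054) / D ^ 2 +
            0.015 * k ^ 2 + 0.235 * k + 1.034)) <
        ‖(lam 0 : ℚ_[p]) + ∑ j : Fin k, (lam j.succ : ℚ_[p]) * eulerF p (α j)‖ := by
  classical
  have hkR : (1 : ℝ) ≤ k := by exact_mod_cast hk
  have hmR : (0 : ℝ) < m := by exact_mod_cast (show 0 < m by omega)
  have hφ : (2 : ℝ) ≤ m.totient := by exact_mod_cast two_le_totient hm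
  have ha : (1 : ℝ) ≤ maxAbs α := by exact_mod_cast one_le_maxAbs hk hα
  have hka : (k : ℝ) ≤ 2 * maxAbs α := by exact_mod_cast card_le_two_mul_maxAbs hα hαinj
  set φm : ℝ := (m.totient : ℝ) with hφm
  have hR'fin : R'.Finite := (Set.finite_Icc _ _).subset (hR' ▸ Set.inter_subset_right)
  obtain ⟨S', hS'⟩ : ∃ S' : Finset ℕ, R' = S' := ⟨hR'fin.toFinset, hR'fin.coe_toFinset.symm⟩
  have hS'p : ∀ p ∈ S', p.Prime := fun p hp => by
    have : p ∈ R' := by rw [hS']; exact hp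
    rw [hR', hR] at this
    exact this.1.1
  obtain ⟨hc2pos, hlogc2⟩ := log_c2val hk hα hS'p
  rw [← hS'] at hc2pos hlogc2
  have hDpos : 0 < D := by
    have h1 := Real.log_lt_log hc2pos hc2
    rw [zpow_neg, zpow_natCast, Real.log_inv, Real.log_pow, Real.log_mul (by positivity) (by positivity),
      Real.log_mul (by positivity) (by positivity), Real.log_exp, Real.log_pow] at h1
    rw [hD, Dval]
    linarith
  set C : ℝ := 2.539 * k * φm + 5.724 * k + 0.054 with hC
  have hC10 : 10 * (k : ℝ) ≤ C := by
    have : (k : ℝ) * 2 ≤ k * φm := by gcongr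
    rw [hC]
    linarith
  set L : ℝ := Real.log H / D with hL
  have hlogH_eq : Real.log H = L * D := by rw [hL]; field_simp
  have hL1866 : 1866 ≤ L := ((le_max_left _ _).trans (le_max_left _ _)).trans hlogH
  have hLm : (m : ℝ) ^ m.totient + 1 ≤ L := ((le_max_right _ _).trans (le_max_left _ _)).trans hlogH
  have hLa : (maxAbs α : ℝ) + 1 ≤ L := ((le_max_left _ _).trans (le_max_right _ _)).trans hlogH
  have hLe : Real.exp (2 * C / D) + 1 ≤ L := ((le_max_right _ _).trans (le_max_right _ _)).trans hlogH
  have hCD : 2 * C / D ≤ Real.log L := by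
    rw [Real.le_log_iff_exp_le (by linarith)]
    linarith
  have hlogL : 0 < Real.log L := Real.log_pos (by linarith)
  have hHpos : 0 < H := by
    obtain ⟨i, hi⟩ := hlam
    exact lt_of_lt_of_le (by positivity) (hH i)
  have hXeq : 2 * k * Real.log H / D + 2 * k = 2 * k * L + 2 * k := by rw [hL]; ring
  have hR''fin : R''.Finite := by
    refine (Set.finite_Iio ⌈2 * k * L + 2 * k⌉₊).subset fun p hp => ?_
    rw [hR'', hXeq] at hp
    exact Nat.lt_ceil.mpr hp.2.2
  obtain ⟨S, hS⟩ : ∃ S : Finset ℕ, R'' = S := ⟨hR''fin.toFinset, hR''fin.coe_toFinset.symm⟩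
  have hmemS : ∀ p, p ∈ S ↔ (p.Prime ∧ p % m ∈ A) ∧ 2 ≤ p ∧ (p : ℝ) < 2 * k * L + 2 * k := fun p => by
    rw [← Finset.mem_coe, ← hS, hR'', hR, hXeq]
    rfl
  have hSp : ∀ p ∈ S, p.Prime := fun p hp => ((hmemS p).mp hp).1.1
  have hsub : S' ⊆ S := fun p hp => by
    have hp' : p ∈ R' := by rw [hS']; exact hp
    rw [hR', hR] at hp'
    refine (hmemS p).mpr ⟨hp'.1, hp'.2.1, ?_⟩
    have h1 : (p : ℝ) ≤ k * (max (max 1865 ((m : ℝ) ^ m.totient)) (maxAbs α) + 2) := by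
      exact_mod_cast hp'.2.2
    have h2 : max (max 1865 ((m : ℝ) ^ m.totient)) (maxAbs α) ≤ L - 1 :=
      max_le (max_le (by linarith) (by linarith)) (by linarith)
    have h3 : (k : ℝ) * (max (max 1865 ((m : ℝ) ^ m.totient)) (maxAbs α) + 2) ≤ k * (L - 1 + 2) := by
      gcongr
    have h4 : 0 < (k : ℝ) * L := by positivity
    linarith
  have hsum : ∑ p ∈ S, Real.log (padicMaxAbs p α) ≤ ∑ p ∈ S', Real.log (padicMaxAbs p α) := by
    rw [← Finset.sum_sdiff hsub]
    have : ∑ p ∈ S \ S', Real.log (padicMaxAbs p α) ≤ 0 := Finset.sum_nonpos fun p hp => by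
      have hp' := hSp p (Finset.mem_sdiff.mp hp).1
      exact Real.log_nonpos (padicMaxAbs_pos hp' hk hα).le (padicMaxAbs_le_one hp' hk α)
    linarith
  have hx0 : 0 ≤ 2 * C * L / (D * Real.log L) := by
    have : 0 ≤ C := by linarith
    positivity
  have hx1 : 2 * C * L / (D * Real.log L) ≤ L := by
    calc _ = 2 * C / D / Real.log L * L := by field_simp
      _ ≤ 1 * L := by gcongr; rwa [div_le_one hlogL]
      _ = L := one_mul L
  set l : ℕ := ⌊L + 2 * C * L / (D * Real.log L)⌋₊ + 1 with hldef
  have hl1 : L + 2 * C * L / (D * Real.log L) < l := by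
    rw [hldef]
    exact_mod_cast Nat.lt_floor_add_one _
  have hl2 : (l : ℝ) ≤ L + 2 * C * L / (D * Real.log L) + 1 := by
    rw [hldef]
    push_cast
    linarith [Nat.floor_le (show 0 ≤ L + 2 * C * L / (D * Real.log L) by linarith)]
  have hlpos : 1 ≤ l := Nat.le_add_left 1 _
  have hcard' : (m.totient : ℝ) ≤ 2 * A.card := by
    have h1 : φm / 2 ≤ k * φm / (k + 1) := by
      rw [div_le_div_iff₀ (by norm_num) (by positivity)]
      nlinarith
    linarith
  have hρ : (k : ℝ) / (k + 1) ≤ A.card / φm := by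
    rw [le_div_iff₀ (by linarith)]
    refine le_of_eq_of_le ?_ hAcard
    ring
  have hS_of_le : ∀ p ≤ k * l, p.Prime → p % m ∈ A → p ∈ S := fun p hp hpp hpA => by
    refine (hmemS p).mpr ⟨⟨hpp, hpA⟩, hpp.two_le, ?_⟩
    have h1 : (p : ℝ) ≤ k * l := by exact_mod_cast hp
    have h2 : (k : ℝ) * l ≤ k * (2 * L + 1) := by gcongr; linarith
    linarith
  have hlkl : l ≤ k * l := Nat.le_mul_of_pos_left l hk
  have hQ₁ := le_logFactorialPart_of_GRH hm hGRH hA hcard' (Nat.mul_pos hk hlpos)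
  have hQ₂ := le_logFactorialPart_of_GRH hm hGRH hA hcard' hlpos
  have hQ₁S := logFactorialPart_le_sum hS_of_le
  have hQ₂S := logFactorialPart_le_sum fun p (hp : p ≤ l) => hS_of_le p (hp.trans hlkl)
  push_cast at hQ₁
  have horder := lt_of_order_choice hkR hL1866 ha (by linarith) (by linarith) hC10 hDpos hl1
    (by linarith) (log_factorial_add_le hk hlpos) hρ hQ₁ (logFactorialPart_nonneg m A _) hQ₂
    (logFactorialPart_nonneg m A _)
  have hF := log_factorial_le (show 1 ≤ k * l + k by omega)
  push_cast at hF
  rw [show (k * l + k : ℝ) = k * (l + 1) by ring] at hF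
  have hsize := size_lt_exponent hkR hL1866 ha (by linarith) (by linarith) (by linarith) hDpos hCD
    (Nat.cast_nonneg l) hl2 hF
  obtain ⟨p, hpS, hp, hle⟩ := exists_exp_neg_le_norm_linearForm hk hα hαinj hlam hlpos hH hSp le_rfl (by
    have h1 : (k + 1 : ℝ) * l * ∑ p ∈ S, Real.log (padicMaxAbs p α) ≤
        (k + 1) * l * ∑ p ∈ S', Real.log (padicMaxAbs p α) := by gcongr
    have h2 : (l : ℝ) * Real.log (c2val k α R') =
        l * (-D - k * (Real.log k + (Real.log m + 6.550) * φm + 1)) := by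
      rw [hD, Dval]
      ring
    rw [hlogc2] at h2
    rw [hlogH_eq]
    push_cast
    linarith)
  refine ⟨p, by rw [hS]; exact hpS, hp, lt_of_lt_of_le ?_ hle⟩
  rw [Real.rpow_def_of_pos hHpos, Real.exp_lt_exp, hlogH_eq, Real.log_mul (by linarith) hDpos.ne']
  push_cast
  refine lt_of_eq_of_lt ?_ (neg_lt_neg (lt_of_eq_of_lt ?_ hsize))
  · field_simp
    ring
  · ring
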